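/- Let (1+√17)/2 < p < 5 and max{4/(p−1) − 1, 1} < γ₀ < min{p−1, 2}, and let B > 0. There exists a constant C > 0, depending only on p, γ₀ and B, such that every smooth solution φ of the defocusing semilinear wave equation with E_{0,γ₀}[φ] ≤ B and E_{1,γ₀}[φ] < ∞ satisfies, at every point (t₀, x₀) of the exterior region (i.e. t₀ ≥ 0 and |x₀| ≥ t₀ + 2), |φ(t₀,x₀)| ≤ C (1 + t₀ + |x₀|)^{−1} (1 + |x₀| − t₀)^{−(γ₀−1)/2} √(E_{1,γ₀}[φ]). -/

import Mathlib

open MeasureTheory Real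
open scoped ENNReal InnerProductSpace

noncomputable section

/-- Three-dimensional Euclidean space. -/
abbrev E3 : Type := EuclideanSpace ℝ (Fin 3)

/-- Second derivative of `f` at `x` in the direction `v`. -/
def der2 (f : E3 → ℝ) (x v : E3) : ℝ := fderiv ℝ (fun y => fderiv ℝ f y v) x v

/-- The (spatial) Laplacian on `ℝ³`. -/
def lap3 (f : E3 → ℝ) (x : E3) : ℝ :=
  ∑ i : Fin 3, der2 f x (EuclideanSpace.single i 1)

/-- First time derivative `∂_t φ`. -/
def dt1 (φ : ℝ → E3 → ℝ) (t : ℝ) (x : E3) : ℝ := deriv (fun s => φ s x) t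

/-- Second time derivative `∂_t² φ`. -/
def dtt (φ : ℝ → E3 → ℝ) (t : ℝ) (x : E3) : ℝ := deriv (fun s => dt1 φ s x) t

/-- `φ` is a smooth solution of the defocusing semilinear wave equation
`∂_t²φ − Δφ + |φ|^{p−1}φ = 0` on `[0,∞) × ℝ³`. -/
def IsNLWSolution (p : ℝ) (φ : ℝ → E3 → ℝ) : Prop :=
  ContDiff ℝ (⊤ : ℕ∞) (fun q : ℝ × E3 => φ q.1 q.2) ∧
    ∀ t : ℝ, 0 ≤ t → ∀ x : E3,
      dtt φ t x - lap3 (φ t) x + |φ t x| ^ (p - 1) * φ t x = 0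

/-- The weighted initial energy `E_{k,γ₀}[φ]`. -/
def wEnergy (p : ℝ) (k : ℕ) (γ₀ : ℝ) (φ : ℝ → E3 → ℝ) : ℝ≥0∞ :=
  (∑ l ∈ Finset.range (k + 1),
    ∫⁻ x : E3, ENNReal.ofReal ((1 + ‖x‖) ^ (γ₀ + 2 * (l : ℝ)) *
      (‖iteratedFDeriv ℝ (l + 1) (φ 0) x‖ ^ 2 + ‖iteratedFDeriv ℝ l (dt1 φ 0) x‖ ^ 2))) +
  ∫⁻ x : E3, ENNReal.ofReal ((1 + ‖x‖) ^ γ₀ * |φ 0 x| ^ (p + 1))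

/-- `u₊ = √(1+((t−r)/2)²)`. -/
def uplus (t r : ℝ) : ℝ := Real.sqrt (1 + ((t - r) / 2) ^ 2)

/-- `v₊ = √(1+((t+r)/2)²)`. -/
def vplus (t r : ℝ) : ℝ := Real.sqrt (1 + ((t + r) / 2) ^ 2)

/-- Surface measure on the unit sphere `S² ⊂ ℝ³` (total mass `4π`). -/
def sphereMeasure : Measure (Metric.sphere (0 : E3) 1) := (volume : Measure E3).toSphere

namespace NLW

/-- Integration in polar coordinates on `ℝ³`. -/
theorem lintegral_polar (f : E3 → ℝ≥0∞) (hf : Measurable f) :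
    ∫⁻ y, f y = ∫⁻ ω, (∫⁻ s in Set.Ioi (0 : ℝ), ENNReal.ofReal (s ^ 2) * f (s • (ω : E3)))
      ∂sphereMeasure := by
  have h1 : ∫⁻ y, f y = ∫⁻ y : ({(0 : E3)}ᶜ : Set E3), f y ∂((volume : Measure E3).comap (↑)) := by
    rw [lintegral_subtype_comap (measurableSet_singleton _).compl f, restrict_compl_singleton]
  have hd : Module.finrank ℝ E3 - 1 = 2 := by simp
  have h2 := (volume : Measure E3).measurePreserving_homeomorphUnitSphereProd.lintegral_comp_emb
    (Homeomorph.measurableEmbedding _) (fun z => f (z.2.1 • (z.1 : E3)))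
  have h3 : ∀ y : ({(0 : E3)}ᶜ : Set E3), f (((homeomorphUnitSphereProd E3) y).2.1 •
      (((homeomorphUnitSphereProd E3) y).1 : E3)) = f y := by
    intro y
    congr 1
    have : (y : E3) ≠ 0 := y.2
    simp [smul_smul, this]
  simp_rw [h3] at h2
  have hm : Measurable fun z : (Metric.sphere (0 : E3) 1) × (Set.Ioi (0 : ℝ)) =>
      f (z.2.1 • (z.1 : E3)) := by
    apply hf.comp
    fun_prop
  rw [h1, h2, lintegral_prod _ hm.aemeasurable, hd]
  refine lintegral_congr fun ω => ?_
  rw [Measure.volumeIoiPow, lintegral_withDensity_eq_lintegral_mul₀ (by fun_prop)]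
  · simp only [Pi.mul_apply]
    rw [lintegral_subtype_comap measurableSet_Ioi
      (fun s : ℝ => ENNReal.ofReal (s ^ 2) * f (s • (ω : E3)))]
  · exact (hm.comp (by fun_prop : Measurable fun s : Set.Ioi (0 : ℝ) => (ω, s))).aemeasurable

theorem measurePreserving_sphere (R : E3 ≃ₗᵢ[ℝ] E3) (hR : ∀ ω : Metric.sphere (0 : E3) 1,
      R ω ∈ Metric.sphere (0 : E3) 1) :
    MeasurePreserving (fun ω : Metric.sphere (0 : E3) 1 =>
      (⟨R ω, hR ω⟩ : Metric.sphere (0 : E3) 1)) sphereMeasure sphereMeasure := by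
  have hc : Continuous (fun ω : Metric.sphere (0 : E3) 1 =>
      (⟨R ω, hR ω⟩ : Metric.sphere (0 : E3) 1)) := by fun_prop
  refine ⟨hc.measurable, ?_⟩
  ext s hs
  rw [Measure.map_apply hc.measurable hs, sphereMeasure,
    Measure.toSphere_apply' _ (hc.measurable hs), Measure.toSphere_apply' _ hs]
  congr 1
  rw [← R.symm.measurePreserving.measure_preimage_equiv (f := R.symm.toMeasurableEquiv)]
  congr 1
  ext y
  simp only [Set.mem_smul, Set.mem_image, Set.mem_preimage]
  constructor
  · rintro ⟨t, ht, _, ⟨ω, hω, rfl⟩, h⟩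
    exact ⟨t, ht, _, ⟨_, hω, rfl⟩, by simpa using congrArg R h⟩
  · rintro ⟨t, ht, _, ⟨ω, hω, rfl⟩, h⟩
    refine ⟨t, ht, R.symm ω, ⟨⟨R.symm ω, by simp⟩, ?_, rfl⟩, ?_⟩
    · simpa using hω
    · simpa using congrArg R.symm h

/-- The standard basis vectors of `ℝ³`. -/
abbrev bv (i : Fin 3) : E3 := EuclideanSpace.single i 1

instance : IsFiniteMeasure sphereMeasure := by unfold sphereMeasure; infer_instance

theorem norm_sq_eq (x : E3) : ‖x‖ ^ 2 = x 0 ^ 2 + x 1 ^ 2 + x 2 ^ 2 := by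
  simp [EuclideanSpace.norm_sq_eq, Fin.sum_univ_three]

theorem coord_sum_sq (ω : Metric.sphere (0 : E3) 1) :
    (ω : E3) 0 ^ 2 + (ω : E3) 1 ^ 2 + (ω : E3) 2 ^ 2 = 1 := by
  rw [← norm_sq_eq]; simp

theorem eq_sum_bv (x : E3) : x = ∑ i, x i • bv i := by
  ext j
  fin_cases j <;> simp [Fin.sum_univ_three]

theorem fderiv_apply_eq_sum (L : E3 →L[ℝ] ℝ) (v : E3) : L v = ∑ i, v i * L (bv i) := by
  conv_lhs => rw [eq_sum_bv v]
  simp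

theorem intervalIntegral_sphere_swap {f : ℝ → Metric.sphere (0 : E3) 1 → ℝ} {a b : ℝ}
    (hf : Continuous (Function.uncurry f)) :
    ∫ s in a..b, ∫ ω, f s ω ∂sphereMeasure = ∫ ω, (∫ s in a..b, f s ω) ∂sphereMeasure := by
  apply intervalIntegral_integral_swap
  have h : (volume.restrict (Set.uIoc a b)).prod sphereMeasure =
      (volume.prod sphereMeasure).restrict (Set.uIoc a b ×ˢ Set.univ) := by
    rw [← Measure.prod_restrict, Measure.restrict_univ]
  rw [h]
  exact (hf.continuousOn.integrableOn_compact
    (isCompact_uIcc.prod isCompact_univ)).mono_set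
      (Set.prod_mono Set.uIoc_subset_uIcc subset_rfl)

/-- Rotation by the angle `θ` in the plane of the coordinates `i`, `j`, as a linear map. -/
def rotLin (i j : Fin 3) (θ : ℝ) : E3 →ₗ[ℝ] E3 where
  toFun y := y + ((cos θ - 1) * y i - sin θ * y j) • bv i
    + ((cos θ - 1) * y j + sin θ * y i) • bv j
  map_add' x y := by
    simp only [PiLp.add_apply]
    module
  map_smul' c x := by
    simp only [PiLp.smul_apply, smul_eq_mul, RingHom.id_apply]
    module

theorem norm_rotLin {i j : Fin 3} (hij : i ≠ j) (θ : ℝ) (y : E3) :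
    ‖rotLin i j θ y‖ = ‖y‖ := by
  rw [← sq_eq_sq₀ (norm_nonneg _) (norm_nonneg _), norm_sq_eq, norm_sq_eq]
  have := Real.sin_sq_add_cos_sq θ
  fin_cases i <;> fin_cases j <;> simp [rotLin] at hij ⊢ <;> ring_nf <;>
    rw [Real.sin_sq] <;> ring

/-- Rotation by the angle `θ` in the plane of the coordinates `i ≠ j`. -/
def rot {i j : Fin 3} (hij : i ≠ j) (θ : ℝ) : E3 ≃ₗᵢ[ℝ] E3 :=
  (⟨rotLin i j θ, norm_rotLin hij θ⟩ : E3 →ₗᵢ[ℝ] E3).toLinearIsometryEquiv rfl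

theorem rot_apply {i j : Fin 3} (hij : i ≠ j) (θ : ℝ) (y : E3) :
    rot hij θ y = y + ((cos θ - 1) * y i - sin θ * y j) • bv i
      + ((cos θ - 1) * y j + sin θ * y i) • bv j := rfl

theorem rot_apply_fst {i j : Fin 3} (hij : i ≠ j) (θ : ℝ) (y : E3) :
    (rot hij θ y) i = cos θ * y i - sin θ * y j := by
  rw [rot_apply]
  simp [hij]
  ring

theorem rot_apply_snd {i j : Fin 3} (hij : i ≠ j) (θ : ℝ) (y : E3) :
    (rot hij θ y) j = cos θ * y j + sin θ * y i := by
  rw [rot_apply]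
  simp [hij.symm]
  ring

theorem hasDerivAt_rot {i j : Fin 3} (hij : i ≠ j) (θ : ℝ) (y : E3) :
    HasDerivAt (fun θ => rot hij θ y) ((rot hij θ y) i • bv j - (rot hij θ y) j • bv i) θ := by
  have h1 : HasDerivAt (fun θ => y + ((cos θ - 1) * y i - sin θ * y j) • bv i
      + ((cos θ - 1) * y j + sin θ * y i) • bv j)
      ((-sin θ * y i - cos θ * y j) • bv i + (-sin θ * y j + cos θ * y i) • bv j) θ := by
    have hc := (Real.hasDerivAt_cos θ).sub_const 1
    have hs := Real.hasDerivAt_sin θ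
    exact ((((hc.mul_const (y i)).sub (hs.mul_const (y j))).smul_const (bv i)).const_add y).add
      (((hc.mul_const (y j)).add (hs.mul_const (y i))).smul_const (bv j))
  refine h1.congr_deriv ?_
  rw [rot_apply_fst, rot_apply_snd]
  module

theorem rot_mem_sphere {i j : Fin 3} (hij : i ≠ j) (θ : ℝ) (ω : Metric.sphere (0 : E3) 1) :
    rot hij θ ω ∈ Metric.sphere (0 : E3) 1 := by simp

theorem integral_sphere_rot {i j : Fin 3} (hij : i ≠ j) (θ : ℝ) (f : E3 → ℝ) :
    ∫ ω : Metric.sphere (0 : E3) 1, f (rot hij θ ω) ∂sphereMeasure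
      = ∫ ω : Metric.sphere (0 : E3) 1, f ω ∂sphereMeasure := by
  have hm := measurePreserving_sphere (rot hij θ) (rot_mem_sphere hij θ)
  have hc : Continuous (fun ω : Metric.sphere (0 : E3) 1 =>
      (⟨rot hij θ ω, rot_mem_sphere hij θ ω⟩ : Metric.sphere (0 : E3) 1)) := by fun_prop
  have he : MeasurableEmbedding (fun ω : Metric.sphere (0 : E3) 1 =>
      (⟨rot hij θ ω, rot_mem_sphere hij θ ω⟩ : Metric.sphere (0 : E3) 1)) := by
    refine (hc.isClosedEmbedding ?_).measurableEmbedding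
    intro a b hab
    simpa [Subtype.ext_iff] using hab
  exact hm.integral_comp he (fun ω => f ω)

/-- Angular derivatives have mean zero on the sphere. -/
theorem integral_sphere_angular {i j : Fin 3} (hij : i ≠ j) {h : E3 → ℝ} (hh : ContDiff ℝ 1 h) :
    ∫ ω : Metric.sphere (0 : E3) 1,
      ((ω : E3) i * fderiv ℝ h ω (bv j) - (ω : E3) j * fderiv ℝ h ω (bv i)) ∂sphereMeasure = 0 := by
  obtain ⟨k, hk⟩ : ∃ k : E3 → ℝ,
      k = fun y => y i * fderiv ℝ h y (bv j) - y j * fderiv ℝ h y (bv i) := ⟨_, rfl⟩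
  have hfc : Continuous (fderiv ℝ h) := hh.continuous_fderiv one_ne_zero
  have hkc : Continuous k := by
    rw [hk]
    fun_prop
  have hd : ∀ θ : ℝ, ∀ y : E3, HasDerivAt (fun θ => h (rot hij θ y)) (k (rot hij θ y)) θ := by
    intro θ y
    have h0 : HasFDerivAt h (fderiv ℝ h (rot hij θ y)) (rot hij θ y) :=
      (hh.differentiable one_ne_zero _).hasFDerivAt
    have h1 : HasDerivAt (fun θ => h (rot hij θ y)) (fderiv ℝ h (rot hij θ y)
        ((rot hij θ y) i • bv j - (rot hij θ y) j • bv i)) θ :=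
      h0.comp_hasDerivAt θ (hasDerivAt_rot hij θ y)
    simpa only [map_sub, map_smul, smul_eq_mul, hk] using h1
  have hkr : Continuous (Function.uncurry fun (θ : ℝ) (ω : Metric.sphere (0 : E3) 1) =>
      k (rot hij θ ω)) := by
    have hg : Continuous fun z : ℝ × Metric.sphere (0 : E3) 1 => rot hij z.1 (z.2 : E3) := by
      simp only [rot_apply]
      fun_prop
    exact hkc.comp hg
  have hftc : ∀ ω : Metric.sphere (0 : E3) 1, ∫ θ in (0 : ℝ)..1, k (rot hij θ ω)
      = h (rot hij 1 ω) - h (rot hij 0 ω) := by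
    intro ω
    refine intervalIntegral.integral_eq_sub_of_hasDerivAt (f := fun θ => h (rot hij θ ω))
      (f' := fun θ => k (rot hij θ ω)) (fun θ _ => hd θ ω) (Continuous.intervalIntegrable ?_ _ _)
    have hg : Continuous fun θ : ℝ => rot hij θ (ω : E3) := by
      simp only [rot_apply]
      fun_prop
    exact hkc.comp hg
  have h1 := intervalIntegral_sphere_swap (a := 0) (b := 1) hkr
  have hl : ∀ θ : ℝ, ∫ ω : Metric.sphere (0 : E3) 1, k (rot hij θ ω) ∂sphereMeasure
      = ∫ ω : Metric.sphere (0 : E3) 1, k ω ∂sphereMeasure :=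
    fun θ => integral_sphere_rot hij θ k
  have h_integrable : ∀ θ : ℝ, Integrable (fun ω : Metric.sphere (0 : E3) 1 => h (rot hij θ ω))
      sphereMeasure := by
    intro θ
    have hc : Continuous (fun ω : Metric.sphere (0 : E3) 1 => h (rot hij θ ω)) :=
      hh.continuous.comp (by fun_prop)
    exact hc.integrable_of_hasCompactSupport (HasCompactSupport.of_compactSpace _)
  have h2 : ∫ ω : Metric.sphere (0 : E3) 1, (∫ θ in (0 : ℝ)..1, k (rot hij θ ω)) ∂sphereMeasure
      = 0 := by
    rw [integral_congr_ae (Filter.Eventually.of_forall hftc), integral_sub (h_integrable 1) (h_integrable 0),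
      integral_sphere_rot hij 1 h, integral_sphere_rot hij 0 h, sub_self]
  have h3 : ∫ θ in (0 : ℝ)..1, (∫ ω : Metric.sphere (0 : E3) 1, k (rot hij θ ω) ∂sphereMeasure)
      = ∫ ω : Metric.sphere (0 : E3) 1, k ω ∂sphereMeasure := by
    rw [intervalIntegral.integral_congr (g := fun _ => ∫ ω : Metric.sphere (0 : E3) 1, k ω
      ∂sphereMeasure) (fun θ _ => hl θ)]
    simp
  have h4 := h3.symm.trans (h1.trans h2)
  rw [hk] at h4
  exact h4

/-- Second derivative of `f` in the directions `v`, `w`. -/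
def hess (f : E3 → ℝ) (v w : E3) (x : E3) : ℝ := fderiv ℝ (fun y => fderiv ℝ f y v) x w

theorem integral_sphere_sphericalLaplacian {f : E3 → ℝ} (hf : ContDiff ℝ 2 f) :
    ∫ ω : Metric.sphere (0 : E3) 1, (lap3 f ω - ∑ i, ∑ j, (ω : E3) i * (ω : E3) j *
      hess f (bv i) (bv j) ω - 2 * ∑ i, (ω : E3) i * fderiv ℝ f ω (bv i)) ∂sphereMeasure = 0 := by
  have hP : ∀ i, ContDiff ℝ 1 (fun y => fderiv ℝ f y (bv i)) := fun i => by
    have := hf.fderiv_right (m := 1) le_rfl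
    fun_prop
  have hx : ∀ i : Fin 3, ContDiff ℝ 1 (fun y : E3 => y i) := fun i => by fun_prop
  have hH : ∀ i j, Continuous (fun y => hess f (bv i) (bv j) y) := fun i j => by
    have := (hP i).continuous_fderiv one_ne_zero
    unfold hess
    fun_prop
  set h : Fin 3 → Fin 3 → E3 → ℝ := fun i j y =>
    y i * fderiv ℝ f y (bv j) - y j * fderiv ℝ f y (bv i) with hh
  have hhC : ∀ i j, ContDiff ℝ 1 (h i j) := fun i j =>
    ((hx i).mul (hP j)).sub ((hx j).mul (hP i))
  have hhd : ∀ i j y v, fderiv ℝ (h i j) y v = v i * fderiv ℝ f y (bv j) +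
      y i * hess f (bv j) v y - (v j * fderiv ℝ f y (bv i) + y j * hess f (bv i) v y) := by
    intro i j y v
    have hc : ∀ i : Fin 3, HasFDerivAt (fun y : E3 => y i)
        (EuclideanSpace.proj i : E3 →L[ℝ] ℝ) y := fun i =>
      (EuclideanSpace.proj i : E3 →L[ℝ] ℝ).hasFDerivAt
    have hp : ∀ i, HasFDerivAt (fun y => fderiv ℝ f y (bv i))
        (fderiv ℝ (fun y => fderiv ℝ f y (bv i)) y) y := fun i =>
      ((hP i).differentiable one_ne_zero y).hasFDerivAt
    have := (((hc i).mul (hp j)).sub ((hc j).mul (hp i))).fderiv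
    have h2 : h i j = (fun y : E3 => y i) * (fun y => fderiv ℝ f y (bv j)) -
        (fun y : E3 => y j) * (fun y => fderiv ℝ f y (bv i)) := rfl
    rw [h2, this]
    simp [hess]
    ring
  have hc : ∀ {i j : Fin 3}, Integrable (fun ω : Metric.sphere (0 : E3) 1 =>
      ((ω : E3) i * fderiv ℝ (h i j) ω (bv j) - (ω : E3) j * fderiv ℝ (h i j) ω (bv i)))
      sphereMeasure := by
    intro i j
    refine Continuous.integrable_of_hasCompactSupport ?_ (HasCompactSupport.of_compactSpace _)
    have := (hhC i j).continuous_fderiv one_ne_zero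
    fun_prop
  have e01 := integral_sphere_angular (show (0 : Fin 3) ≠ 1 by decide) (hhC 0 1)
  have e02 := integral_sphere_angular (show (0 : Fin 3) ≠ 2 by decide) (hhC 0 2)
  have e12 := integral_sphere_angular (show (1 : Fin 3) ≠ 2 by decide) (hhC 1 2)
  have key := (integral_add (hc.add hc) hc).trans (congrArg₂ (· + ·)
    ((integral_add hc hc).trans (congrArg₂ (· + ·) e01 e02)) e12)
  refine Eq.trans ?_ (key.trans (by norm_num))
  refine integral_congr_ae (Filter.Eventually.of_forall fun ω => ?_)
  have hω := coord_sum_sq ω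
  simp only [hhd, lap3, der2, Fin.sum_univ_three]
  have e1 : (0 : Fin 3) ≠ 1 := by decide
  have e2 : (0 : Fin 3) ≠ 2 := by decide
  have e3 : (1 : Fin 3) ≠ 2 := by decide
  simp only [Pi.add_apply, hhd, hess, PiLp.single_apply, if_neg e1, if_neg e2, if_neg e3,
    if_neg e1.symm, if_neg e2.symm, if_neg e3.symm, if_true]
  linear_combination (-(fderiv ℝ (fun y => fderiv ℝ f y (bv 0)) ω (bv 0)) -
    (fderiv ℝ (fun y => fderiv ℝ f y (bv 1)) ω (bv 1)) -
    (fderiv ℝ (fun y => fderiv ℝ f y (bv 2)) ω (bv 2))) * hω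

section

variable {F : ℝ × E3 → ℝ}

theorem hasFDerivAt_slice (hF : ContDiff ℝ 2 F) (t s : ℝ) (x y : E3) :
    HasFDerivAt (fun y => F (t, x + s • y)) ((fderiv ℝ F (t, x + s • y)).comp
      (s • ContinuousLinearMap.inr ℝ ℝ E3)) y := by
  have h1 : HasFDerivAt (fun y : E3 => (t, x + s • y)) (s • ContinuousLinearMap.inr ℝ ℝ E3) y := by
    have h2 : HasFDerivAt (fun y : E3 => x + s • y) (s • ContinuousLinearMap.id ℝ E3) y :=
      ((hasFDerivAt_id y).const_smul s).const_add x
    refine ((hasFDerivAt_const t y).prodMk h2).congr_fderiv ?_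
    ext v <;> simp
  exact ((hF.differentiable two_ne_zero) _).hasFDerivAt.comp y h1

theorem fderiv_slice (hF : ContDiff ℝ 2 F) (t s : ℝ) (x y v : E3) :
    fderiv ℝ (fun y => F (t, x + s • y)) y v = s * fderiv ℝ F (t, x + s • y) (0, v) := by
  rw [(hasFDerivAt_slice hF t s x y).fderiv]
  have : ((0 : ℝ), s • v) = s • ((0 : ℝ), v) := by simp
  simp [this]

theorem hess_slice (hF : ContDiff ℝ 2 F) (t s : ℝ) (x y v w : E3) :
    hess (fun y => F (t, x + s • y)) v w y =
      s ^ 2 * fderiv ℝ (fderiv ℝ F) (t, x + s • y) (0, w) (0, v) := by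
  unfold hess
  simp_rw [fderiv_slice hF]
  have hF' : ContDiff ℝ 1 (fderiv ℝ F) := hF.fderiv_right (m := 1) le_rfl
  have h1 : HasFDerivAt (fun y : E3 => (t, x + s • y)) (s • ContinuousLinearMap.inr ℝ ℝ E3) y := by
    have h2 : HasFDerivAt (fun y : E3 => x + s • y) (s • ContinuousLinearMap.id ℝ E3) y :=
      ((hasFDerivAt_id y).const_smul s).const_add x
    refine ((hasFDerivAt_const t y).prodMk h2).congr_fderiv ?_
    ext v <;> simp
  have h3 : HasFDerivAt (fun y : E3 => fderiv ℝ F (t, x + s • y))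
      ((fderiv ℝ (fderiv ℝ F) (t, x + s • y)).comp (s • ContinuousLinearMap.inr ℝ ℝ E3)) y :=
    ((hF'.differentiable one_ne_zero) _).hasFDerivAt.comp y h1
  have h4 := (h3.clm_apply (hasFDerivAt_const ((0 : ℝ), v) y)).const_mul s
  rw [h4.fderiv]
  have : ((0 : ℝ), s • w) = s • ((0 : ℝ), w) := by simp
  simp [this]
  ring

/-- Representation of a `C²` function along a backward light cone. -/
theorem kirchhoff (hF : ContDiff ℝ 2 F) {T : ℝ} (hT : 0 ≤ T) (x : E3) :
    sphereMeasure.real Set.univ * F (T, x) =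
      (∫ ω : Metric.sphere (0 : E3) 1, (F (0, x + T • (ω : E3)) +
        T * fderiv ℝ F (0, x + T • (ω : E3)) (1, (ω : E3))) ∂sphereMeasure) -
      ∫ s in (0 : ℝ)..T, ∫ ω : Metric.sphere (0 : E3) 1,
        s * ((∑ i, fderiv ℝ (fderiv ℝ F) (T - s, x + s • (ω : E3)) (0, bv i) (0, bv i)) -
          fderiv ℝ (fderiv ℝ F) (T - s, x + s • (ω : E3)) (1, 0) (1, 0)) ∂sphereMeasure := by
  have hF' : ContDiff ℝ 1 (fderiv ℝ F) := hF.fderiv_right (m := 1) le_rfl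
  have hc1 : Continuous (fderiv ℝ F) := hF'.continuous
  have hc2 : Continuous (fderiv ℝ (fderiv ℝ F)) := hF'.continuous_fderiv one_ne_zero
  have hc0 : Continuous F := hF.continuous
  obtain ⟨k, hk⟩ : ∃ k : ℝ → Metric.sphere (0 : E3) 1 → ℝ, ∀ s ω, k s ω =
      F (T - s, x + s • (ω : E3)) + s * fderiv ℝ F (T - s, x + s • (ω : E3)) (1, (ω : E3)) :=
    ⟨_, fun _ _ => rfl⟩
  obtain ⟨k', hk'⟩ : ∃ k' : ℝ → Metric.sphere (0 : E3) 1 → ℝ, k' = fun s (ω : Metric.sphere (0 : E3) 1) =>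
      2 * fderiv ℝ F (T - s, x + s • (ω : E3)) (0, (ω : E3)) +
      s * (fderiv ℝ (fderiv ℝ F) (T - s, x + s • (ω : E3)) (0, (ω : E3)) (0, (ω : E3)) -
        fderiv ℝ (fderiv ℝ F) (T - s, x + s • (ω : E3)) (1, 0) (1, 0)) := ⟨_, rfl⟩
  have hd : ∀ s ω, HasDerivAt (fun s => k s ω) (k' s ω) s := by
    intro s ω
    have hg : HasDerivAt (fun s : ℝ => (T - s, x + s • (ω : E3))) (-1, (ω : E3)) s := by
      have h1 : HasDerivAt (fun s : ℝ => T - s) (-1) s := (hasDerivAt_id s).const_sub T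
      have h2 : HasDerivAt (fun s : ℝ => x + s • (ω : E3)) (ω : E3) s := by
        simpa using ((hasDerivAt_id s).smul_const (ω : E3)).const_add x
      exact h1.prodMk h2
    have h0 : HasDerivAt (fun s : ℝ => F (T - s, x + s • (ω : E3)))
        (fderiv ℝ F (T - s, x + s • (ω : E3)) (-1, (ω : E3))) s :=
      ((hF.differentiable two_ne_zero) _).hasFDerivAt.comp_hasDerivAt s hg
    have h1 : HasDerivAt (fun s : ℝ => fderiv ℝ F (T - s, x + s • (ω : E3)))
        (fderiv ℝ (fderiv ℝ F) (T - s, x + s • (ω : E3)) (-1, (ω : E3))) s :=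
      ((hF'.differentiable one_ne_zero) _).hasFDerivAt.comp_hasDerivAt s hg
    have h2 := h1.clm_apply (hasDerivAt_const s ((1 : ℝ), (ω : E3)))
    have h3 := h0.add ((hasDerivAt_id s).mul h2)
    have hsymm : fderiv ℝ (fderiv ℝ F) (T - s, x + s • (ω : E3)) (1, 0) (0, (ω : E3)) =
        fderiv ℝ (fderiv ℝ F) (T - s, x + s • (ω : E3)) (0, (ω : E3)) (1, 0) :=
      (hF.contDiffAt.isSymmSndFDerivAt (by simp)) _ _
    have e1 : ((1 : ℝ), (ω : E3)) = (1, 0) + (0, (ω : E3)) := by simp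
    have e2 : ((-1 : ℝ), (ω : E3)) = -(1, 0) + (0, (ω : E3)) := by simp
    refine (h3.congr_deriv ?_).congr_of_eventuallyEq
      (Filter.Eventually.of_forall fun s => hk s ω)
    rw [hk', e1, e2]
    simp only [map_add, map_neg, add_apply, neg_apply,
      hsymm, id, map_zero, add_zero]
    ring
  have hγ : Continuous fun z : ℝ × Metric.sphere (0 : E3) 1 => (T - z.1, x + z.1 • (z.2 : E3)) := by
    fun_prop
  have hkc : Continuous (Function.uncurry k') := by
    rw [hk']
    have h1 := hc1.comp hγ
    have h2 := hc2.comp hγ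
    simp only [Function.comp_def] at h1 h2
    simp only [Function.uncurry_def]
    fun_prop
  have hswap := intervalIntegral_sphere_swap (a := 0) (b := T) hkc
  have hftc : ∀ ω, ∫ s in (0 : ℝ)..T, k' s ω = k T ω - k 0 ω := by
    intro ω
    refine intervalIntegral.integral_eq_sub_of_hasDerivAt (f := fun s => k s ω)
      (f' := fun s => k' s ω) (fun s _ => hd s ω) (Continuous.intervalIntegrable ?_ _ _)
    exact hkc.comp (by fun_prop : Continuous fun s : ℝ => (s, ω))
  have h_integrable : ∀ g : Metric.sphere (0 : E3) 1 → ℝ, Continuous g → Integrable g sphereMeasure :=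
    fun g hg => hg.integrable_of_hasCompactSupport (HasCompactSupport.of_compactSpace _)
  have hkT : Continuous (k T) := by
    have : k T = fun ω : Metric.sphere (0 : E3) 1 => F (T - T, x + T • (ω : E3)) +
      T * fderiv ℝ F (T - T, x + T • (ω : E3)) (1, (ω : E3)) := funext (hk T)
    rw [this]
    fun_prop
  have hk0 : k 0 = fun _ => F (T, x) := by
    funext ω
    rw [hk]
    simp
  have hlap : ∀ s ∈ Set.Ioc (0 : ℝ) T, ∫ ω, k' s ω ∂sphereMeasure =
      ∫ ω : Metric.sphere (0 : E3) 1,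
        s * ((∑ i, fderiv ℝ (fderiv ℝ F) (T - s, x + s • (ω : E3)) (0, bv i) (0, bv i)) -
          fderiv ℝ (fderiv ℝ F) (T - s, x + s • (ω : E3)) (1, 0) (1, 0)) ∂sphereMeasure := by
    intro s hs
    have hf : ContDiff ℝ 2 (fun y => F (T - s, x + s • y)) := by fun_prop
    have h1 := integral_sphere_sphericalLaplacian hf
    have e1 : ∀ ω : Metric.sphere (0 : E3) 1,
        fderiv ℝ (fderiv ℝ F) (T - s, x + s • (ω : E3)) (0, (ω : E3)) (0, (ω : E3)) =
        ∑ i, ∑ j, (ω : E3) i * (ω : E3) j *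
          fderiv ℝ (fderiv ℝ F) (T - s, x + s • (ω : E3)) (0, bv j) (0, bv i) := by
      intro ω
      have e : ((0 : ℝ), (ω : E3)) = ∑ i, (ω : E3) i • ((0 : ℝ), bv i) := by
        conv_lhs => rw [eq_sum_bv (ω : E3)]
        simp [Prod.ext_iff, Prod.fst_sum, Prod.snd_sum]
      rw [e]
      simp only [map_sum, map_smul, sum_apply, smul_eq_mul,
        smul_apply, Finset.mul_sum]
      refine Finset.sum_congr rfl fun i _ => Finset.sum_congr rfl fun j _ => ?_
      ring
    have e2 : ∀ ω : Metric.sphere (0 : E3) 1,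
        fderiv ℝ F (T - s, x + s • (ω : E3)) (0, (ω : E3)) =
        ∑ i, (ω : E3) i * fderiv ℝ F (T - s, x + s • (ω : E3)) (0, bv i) := by
      intro ω
      have e : ((0 : ℝ), (ω : E3)) = ∑ i, (ω : E3) i • ((0 : ℝ), bv i) := by
        conv_lhs => rw [eq_sum_bv (ω : E3)]
        simp [Prod.ext_iff, Prod.fst_sum, Prod.snd_sum]
      rw [e]
      simp only [map_sum, map_smul, smul_eq_mul]
    have h2 : ∀ ω : Metric.sphere (0 : E3) 1,
        lap3 (fun y => F (T - s, x + s • y)) ω - ∑ i, ∑ j, (ω : E3) i * (ω : E3) j *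
          hess (fun y => F (T - s, x + s • y)) (bv i) (bv j) ω
          - 2 * ∑ i, (ω : E3) i * fderiv ℝ (fun y => F (T - s, x + s • y)) ω (bv i) =
        s * (s * ((∑ i, fderiv ℝ (fderiv ℝ F) (T - s, x + s • (ω : E3)) (0, bv i) (0, bv i)) -
          fderiv ℝ (fderiv ℝ F) (T - s, x + s • (ω : E3)) (1, 0) (1, 0)) - k' s ω) := by
      intro ω
      have e3 : lap3 (fun y => F (T - s, x + s • y)) ω =
          ∑ i, hess (fun y => F (T - s, x + s • y)) (bv i) (bv i) ω := rfl
      rw [e3]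
      simp only [hess_slice hF, fderiv_slice hF, hk', e1, e2, Fin.sum_univ_three]
      ring
    simp_rw [h2] at h1
    rw [integral_const_mul] at h1
    have h3 := (mul_eq_zero.1 h1).resolve_left hs.1.ne'
    rw [integral_sub] at h3
    · linarith
    · apply h_integrable
      fun_prop
    · apply h_integrable
      exact hkc.comp (by fun_prop : Continuous fun ω : Metric.sphere (0 : E3) 1 => (s, ω))
  have hfin : ∫ s in (0 : ℝ)..T, ∫ ω, k' s ω ∂sphereMeasure =
      ∫ s in (0 : ℝ)..T, ∫ ω : Metric.sphere (0 : E3) 1,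
        s * ((∑ i, fderiv ℝ (fderiv ℝ F) (T - s, x + s • (ω : E3)) (0, bv i) (0, bv i)) -
          fderiv ℝ (fderiv ℝ F) (T - s, x + s • (ω : E3)) (1, 0) (1, 0)) ∂sphereMeasure := by
    rw [intervalIntegral.integral_of_le hT, intervalIntegral.integral_of_le hT]
    exact setIntegral_congr_fun measurableSet_Ioc hlap
  rw [← hfin, hswap, integral_congr_ae (Filter.Eventually.of_forall hftc),
    integral_sub (h_integrable _ hkT) (h_integrable _ (by rw [hk0]; fun_prop)), hk0]
  have hkT' : ∫ ω, k T ω ∂sphereMeasure = ∫ ω : Metric.sphere (0 : E3) 1,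
      (F (0, x + T • (ω : E3)) + T * fderiv ℝ F (0, x + T • (ω : E3)) (1, (ω : E3)))
      ∂sphereMeasure := by
    refine integral_congr_ae (Filter.Eventually.of_forall fun ω => ?_)
    simp [hk]
  rw [hkT']
  simp

end

section

variable {F : ℝ × E3 → ℝ}

/-- Integration in polar coordinates on `ℝ³`, with the radial integral outside. -/
theorem lintegral_polar_radial (f : E3 → ℝ≥0∞) (hf : Measurable f) :
    ∫⁻ y, f y = ∫⁻ s in Set.Ioi (0 : ℝ), ENNReal.ofReal (s ^ 2) *
      ∫⁻ ω : Metric.sphere (0 : E3) 1, f (s • (ω : E3)) ∂sphereMeasure := by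
  have hm : Measurable (Function.uncurry fun (ω : Metric.sphere (0 : E3) 1) (s : ℝ) =>
      ENNReal.ofReal (s ^ 2) * f (s • (ω : E3))) := by
    simp only [Function.uncurry_def]
    have : Measurable fun z : Metric.sphere (0 : E3) 1 × ℝ => z.2 • (z.1 : E3) := by fun_prop
    exact (by fun_prop : Measurable fun z : Metric.sphere (0 : E3) 1 × ℝ =>
      ENNReal.ofReal (z.2 ^ 2)).mul (hf.comp this)
  rw [lintegral_polar f hf, lintegral_lintegral_swap hm.aemeasurable]
  refine lintegral_congr fun s => ?_
  rw [lintegral_const_mul]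
  have : Measurable fun ω : Metric.sphere (0 : E3) 1 => s • (ω : E3) := by fun_prop
  exact hf.comp this

/-- The equation `∂_t²F − ΔF + |F|^{p−1}F = 0` at nonnegative times, in terms of the full
second derivative of `F`. -/
def SolvesNLW (p : ℝ) (F : ℝ × E3 → ℝ) : Prop :=
  ∀ q : ℝ × E3, 0 ≤ q.1 → (∑ i, fderiv ℝ (fderiv ℝ F) q (0, bv i) (0, bv i)) -
    fderiv ℝ (fderiv ℝ F) q (1, 0) (1, 0) = |F q| ^ (p - 1) * F q

theorem hasDerivAt_time_slice (hF : ContDiff ℝ 2 F) (t : ℝ) (x : E3) :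
    HasDerivAt (fun t => F (t, x)) (fderiv ℝ F (t, x) (1, 0)) t :=
  ((hF.differentiable two_ne_zero) _).hasFDerivAt.comp_hasDerivAt t
    ((hasDerivAt_id t).prodMk (hasDerivAt_const t x))

theorem solvesNLW_of_isNLWSolution {p : ℝ} {φ : ℝ → E3 → ℝ} (h : IsNLWSolution p φ) :
    SolvesNLW p (fun q => φ q.1 q.2) := by
  intro q hq
  have hF : ContDiff ℝ 2 (fun q : ℝ × E3 => φ q.1 q.2) := 
    h.1.of_le (WithTop.coe_le_coe.2 (le_top : (2 : ℕ∞) ≤ ⊤))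
  obtain ⟨F, hFd⟩ : ∃ F : ℝ × E3 → ℝ, F = fun q : ℝ × E3 => φ q.1 q.2 := ⟨_, rfl⟩
  rw [← hFd] at hF ⊢
  have e0 : ∀ t x, φ t x = F (t, x) := by simp [hFd]
  have h1 := h.2 q.1 hq q.2
  have hlap : lap3 (φ q.1) q.2 = ∑ i, fderiv ℝ (fderiv ℝ F) q (0, bv i) (0, bv i) := by
    have : lap3 (φ q.1) q.2 = ∑ i, hess (fun y => F (q.1, 0 + (1 : ℝ) • y)) (bv i) (bv i) q.2 := by
      simp only [zero_add, one_smul, ← e0]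
      rfl
    rw [this]
    simp only [hess_slice hF]
    simp
  have hdt : ∀ t x, dt1 φ t x = fderiv ℝ F (t, x) (1, 0) := by
    intro t x
    unfold dt1
    simp only [e0]
    exact (hasDerivAt_time_slice hF t x).deriv
  have hdtt : dtt φ q.1 q.2 = fderiv ℝ (fderiv ℝ F) q (1, 0) (1, 0) := by
    unfold dtt
    simp only [hdt]
    have hF' : ContDiff ℝ 1 (fderiv ℝ F) := hF.fderiv_right (m := 1) le_rfl
    have h2 : HasDerivAt (fun t => fderiv ℝ F (t, q.2)) (fderiv ℝ (fderiv ℝ F) (q.1, q.2) (1, 0))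
        q.1 :=
      ((hF'.differentiable one_ne_zero) _).hasFDerivAt.comp_hasDerivAt q.1
        ((hasDerivAt_id q.1).prodMk (hasDerivAt_const q.1 q.2))
    have h3 := h2.clm_apply (hasDerivAt_const q.1 ((1 : ℝ), (0 : E3)))
    rw [h3.deriv]
    simp
  rw [hlap, hdtt, e0] at h1
  linarith

/-- Pointwise bound of a solution by its free part and its source term on the light cone. -/
theorem kirchhoff_bound {p : ℝ} (hp : 1 < p) (hF : ContDiff ℝ 2 F) (hs : SolvesNLW p F)
    {T : ℝ} (hT : 0 ≤ T) (x : E3) :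
    ENNReal.ofReal (sphereMeasure.real Set.univ * |F (T, x)|) ≤
      (∫⁻ ω : Metric.sphere (0 : E3) 1, ENNReal.ofReal (|F (0, x + T • (ω : E3))| +
        T * |fderiv ℝ F (0, x + T • (ω : E3)) (1, (ω : E3))|) ∂sphereMeasure) +
      ∫⁻ y in Metric.ball (0 : E3) T, ENNReal.ofReal (|F (T - ‖y‖, x + y)| ^ p * ‖y‖⁻¹) := by
  have hc0 : Continuous F := hF.continuous
  have hnn : (0 : ℝ) ≤ sphereMeasure.real Set.univ := measureReal_nonneg
  have h1 : ENNReal.ofReal (sphereMeasure.real Set.univ * |F (T, x)|) =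
      ‖sphereMeasure.real Set.univ * F (T, x)‖ₑ := by
    rw [← ofReal_norm, norm_mul, Real.norm_of_nonneg hnn, Real.norm_eq_abs]
  rw [h1, kirchhoff hF hT x]
  refine (enorm_sub_le).trans (add_le_add ?_ ?_)
  · refine (enorm_integral_le_lintegral_enorm _).trans (lintegral_mono fun ω => ?_)
    rw [← ofReal_norm]
    apply ENNReal.ofReal_le_ofReal
    refine (norm_add_le _ _).trans ?_
    rw [norm_mul, Real.norm_of_nonneg hT]
    rfl
  · rw [← lintegral_indicator Metric.isOpen_ball.measurableSet, lintegral_polar_radial _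
      (Measurable.indicator (by fun_prop) Metric.isOpen_ball.measurableSet),
      intervalIntegral.integral_of_le hT]
    refine (enorm_integral_le_lintegral_enorm _).trans ?_
    rw [← Measure.restrict_congr_set (Ioo_ae_eq_Ioc (μ := volume) (a := (0:ℝ)) (b := T))]
    refine le_trans ?_ (lintegral_mono_set (show Set.Ioo (0 : ℝ) T ⊆ Set.Ioi 0 from fun s h => h.1))
    refine setLIntegral_mono' measurableSet_Ioo fun s hs' => ?_
    refine (enorm_integral_le_lintegral_enorm _).trans ?_
    rw [← lintegral_const_mul']
    · refine lintegral_mono fun ω => ?_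
      have hmem : s • (ω : E3) ∈ Metric.ball (0 : E3) T := by
        simp [norm_smul, abs_of_pos hs'.1, hs'.2]
      have hns : ‖s • (ω : E3)‖ = s := by simp [norm_smul, abs_of_pos hs'.1]
      rw [Set.indicator_of_mem hmem, hns, ← ENNReal.ofReal_mul (sq_nonneg s), ← ofReal_norm]
      apply ENNReal.ofReal_le_ofReal
      rw [hs (T - s, x + s • (ω : E3)) (by simpa using hs'.2.le), norm_mul,
        Real.norm_of_nonneg hs'.1.le, norm_mul, Real.norm_eq_abs, Real.norm_eq_abs,
        abs_of_nonneg (Real.rpow_nonneg (abs_nonneg _) _)]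
      have e : |F (T - s, x + s • (ω : E3))| ^ p =
          |F (T - s, x + s • (ω : E3))| ^ (p - 1) * |F (T - s, x + s • (ω : E3))| := by
        rw [← Real.rpow_add_one' (abs_nonneg _) (by linarith), sub_add_cancel]
      rw [e]
      have := hs'.1.ne'
      field_simp
      rfl
    · exact ENNReal.ofReal_ne_top

end

theorem hasFDerivAt_norm_of_ne_zero {y : E3} (hy : y ≠ 0) :
    HasFDerivAt (fun y : E3 => ‖y‖) (‖y‖⁻¹ • innerSL ℝ y) y := by
  have h1 := (hasStrictFDerivAt_norm_sq y).hasFDerivAt.sqrt (pow_ne_zero 2 (norm_ne_zero_iff.2 hy))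
  simp only [Real.sqrt_sq (norm_nonneg _)] at h1
  refine h1.congr_fderiv ?_
  ext v
  have := norm_ne_zero_iff.2 hy
  simp
  field_simp

theorem hasFDerivAt_cone (T : ℝ) {y : E3} (hy : y ≠ 0) :
    HasFDerivAt (fun y : E3 => (T - ‖y‖, y))
      ((-(‖y‖⁻¹ • innerSL ℝ y)).prod (ContinuousLinearMap.id ℝ E3)) y :=
  ((hasFDerivAt_norm_of_ne_zero hy).const_sub T).prodMk (hasFDerivAt_id y)

/-- A divergence theorem on a ball, for Lipschitz functions vanishing on the boundary. -/
theorem integral_ball_cone_deriv_eq_zero {Ψ : ℝ × E3 → ℝ} (hΨ : ContDiff ℝ 1 Ψ)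
    (hc : HasCompactSupport Ψ) (h0 : ∀ y, Ψ (0, y) = 0) {T : ℝ} (v : E3) :
    ∫ y in Metric.ball (0 : E3) T, fderiv ℝ Ψ (T - ‖y‖, y) (-(‖y‖⁻¹ * ⟪y, v⟫_ℝ), v) = 0 := by
  obtain ⟨C, hC⟩ := hΨ.lipschitzWith_of_hasCompactSupport hc one_ne_zero
  obtain ⟨g, hg⟩ : ∃ g : E3 → ℝ, g = fun y => Ψ (max (T - ‖y‖) 0, y) := ⟨_, rfl⟩
  have hgL : LipschitzWith (C * max 1 1) g := by
    rw [hg]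
    refine hC.comp (LipschitzWith.prodMk ?_ LipschitzWith.id)
    refine LipschitzWith.of_dist_le_mul fun y z => ?_
    rw [Real.dist_eq, NNReal.coe_one, one_mul, dist_eq_norm]
    refine (abs_max_sub_max_le_abs _ _ _).trans ?_
    rw [show T - ‖y‖ - (T - ‖z‖) = ‖z‖ - ‖y‖ by ring, abs_sub_comm]
    exact abs_norm_sub_norm_le y z
  have hgc : HasCompactSupport g := by
    refine HasCompactSupport.of_support_subset_isCompact (isCompact_closedBall (0 : E3) T) ?_
    intro y hy
    by_contra hyT
    apply hy
    simp only [Metric.mem_closedBall, dist_zero_right, not_le] at hyT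
    simp only [hg]
    rw [max_eq_right (by linarith), h0]
  have h1 := LipschitzWith.integral_lineDeriv_mul_eq (μ := volume)
    (LipschitzWith.const (1 : ℝ) : LipschitzWith 0 fun _ : E3 => (1 : ℝ)) hgL hgc (-v)
  simp only [lineDeriv, deriv_const, zero_mul, integral_zero, neg_neg, mul_one] at h1
  change (0 : ℝ) = ∫ y, lineDeriv ℝ g y v at h1
  have h2 : ∀ y ∉ Metric.closedBall (0 : E3) T, lineDeriv ℝ g y v = 0 := by
    intro y hy
    have : g =ᶠ[nhds y] fun _ => 0 := by
      filter_upwards [Metric.isClosed_closedBall.isOpen_compl.mem_nhds hy] with z hz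
      simp only [Set.mem_compl_iff, Metric.mem_closedBall, dist_zero_right, not_le] at hz
      simp only [hg]
      rw [max_eq_right (by linarith), h0]
    rw [this.lineDeriv_eq]
    simp [lineDeriv]
  rw [← setIntegral_eq_integral_of_forall_compl_eq_zero h2] at h1
  have h3 : (Metric.ball (0 : E3) T : Set E3) =ᵐ[volume] Metric.closedBall (0 : E3) T := by
    rw [← Metric.ball_union_sphere]
    refine (union_ae_eq_left_of_ae_eq_empty ?_).symm
    exact ae_eq_empty.2 (Measure.addHaar_sphere _ _ _)
  rw [← Measure.restrict_congr_set h3] at h1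
  refine Eq.trans ?_ h1.symm
  refine setIntegral_congr_ae Metric.isOpen_ball.measurableSet ?_
  have h4 : ∀ᵐ y : E3, y ≠ 0 := by simp [ae_iff]
  filter_upwards [h4] with y hy hyT
  have h5 : g =ᶠ[nhds y] fun y => Ψ (T - ‖y‖, y) := by
    filter_upwards [Metric.isOpen_ball.mem_nhds hyT] with z hz
    simp only [Metric.mem_ball, dist_zero_right] at hz
    simp only [hg]
    rw [max_eq_left (by linarith)]
  have h6 := HasFDerivAt.comp (g := Ψ) (f := fun y : E3 => (T - ‖y‖, y)) y
    ((hΨ.differentiable one_ne_zero) (T - ‖y‖, y)).hasFDerivAt (hasFDerivAt_cone T hy)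
  simp only [Function.comp_def] at h6
  rw [h5.lineDeriv_eq, (h6.hasLineDerivAt v).lineDeriv]
  simp

theorem measurable_fderiv_cone {Ψ : ℝ × E3 → ℝ} (hΨ : ContDiff ℝ 1 Ψ) (w : ℝ × E3) :
    Continuous fun q => fderiv ℝ Ψ q w := by
  have := hΨ.continuous_fderiv one_ne_zero
  fun_prop

/-- The flux of a dissipative current through a backward light cone is bounded by its initial
value; version for compactly supported currents. -/
theorem cone_flux_le_of_hasCompactSupport {J0 : ℝ × E3 → ℝ} {J : Fin 3 → ℝ × E3 → ℝ}
    (h0 : ContDiff ℝ 1 J0) (hJ : ∀ i, ContDiff ℝ 1 (J i)) (c0 : HasCompactSupport J0)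
    (cJ : ∀ i, HasCompactSupport (J i)) {T : ℝ} (x : E3)
    (hdiv : ∀ t y, 0 < t → ‖y‖ + t < T → fderiv ℝ J0 (t, x + y) (1, 0) +
      ∑ i, fderiv ℝ (J i) (t, x + y) (0, bv i) ≤ 0) :
    ∫ y in Metric.ball (0 : E3) T, (J0 (T - ‖y‖, x + y) +
        ∑ i, (‖y‖⁻¹ * y i) * J i (T - ‖y‖, x + y)) ≤
      ∫ y in Metric.ball (0 : E3) T, J0 (0, x + y) := by
  obtain ⟨g, hg⟩ : ∃ g : ℝ → E3 → ℝ, g = fun l y =>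
      (T - ‖y‖) * fderiv ℝ J0 (l * (T - ‖y‖), x + y) (1, 0) +
      ∑ i, (‖y‖⁻¹ * y i) * (J i (l * (T - ‖y‖), x + y) +
        l * ((T - ‖y‖) * fderiv ℝ (J i) (l * (T - ‖y‖), x + y) (1, 0))) := ⟨_, rfl⟩
  have hcJ : ∀ i, Continuous (J i) := fun i => (hJ i).continuous
  have hc0 : Continuous J0 := h0.continuous
  have hd0 := measurable_fderiv_cone h0 (1, 0)
  have hdJ := fun i => measurable_fderiv_cone (hJ i) (1, 0)
  have hγ : Continuous fun z : ℝ × E3 => (z.1 * (T - ‖z.2‖), x + z.2) := by fun_prop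
  have hn : ∀ i, ∀ y : E3, |‖y‖⁻¹ * y i| ≤ 1 := by
    intro i y
    rw [abs_mul, abs_of_nonneg (inv_nonneg.2 (norm_nonneg y))]
    refine (mul_le_mul_of_nonneg_left (PiLp.norm_apply_le y i) (by positivity)).trans ?_
    exact inv_mul_le_one
  have hgm : Measurable (Function.uncurry g) := by
    have a1 : Measurable fun z : ℝ × E3 => fderiv ℝ J0 (z.1 * (T - ‖z.2‖), x + z.2) (1, 0) :=
      (hd0.comp hγ).measurable
    have a2 : ∀ i, Measurable fun z : ℝ × E3 => J i (z.1 * (T - ‖z.2‖), x + z.2) :=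
      fun i => ((hcJ i).comp hγ).measurable
    have a3 : ∀ i, Measurable fun z : ℝ × E3 =>
        fderiv ℝ (J i) (z.1 * (T - ‖z.2‖), x + z.2) (1, 0) :=
      fun i => ((hdJ i).comp hγ).measurable
    rw [hg]
    simp only [Function.uncurry_def]
    fun_prop
  have hbd : ∃ M, ∀ l ∈ Set.uIoc (0 : ℝ) 1, ∀ y ∈ Metric.ball (0 : E3) T, ‖g l y‖ ≤ M := by
    obtain ⟨M0, hM0⟩ := (c0.fderiv_apply (𝕜 := ℝ) (1, 0)).exists_bound_of_continuous hd0
    choose M1 hM1 using fun i => (cJ i).exists_bound_of_continuous (hcJ i)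
    choose M2 hM2 using fun i =>
      ((cJ i).fderiv_apply (𝕜 := ℝ) (1, 0)).exists_bound_of_continuous (hdJ i)
    refine ⟨T * M0 + ∑ i, (M1 i + T * M2 i), fun l hl y hy => ?_⟩
    rw [Set.uIoc_of_le zero_le_one] at hl
    simp only [Metric.mem_ball, dist_zero_right] at hy
    have hy0 := norm_nonneg y
    have hTy : ‖T - ‖y‖‖ ≤ T := by
      rw [Real.norm_of_nonneg (by linarith)]
      linarith
    have hT0 : 0 ≤ T := by linarith
    rw [hg]
    refine (norm_add_le _ _).trans (add_le_add ?_ ?_)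
    · rw [norm_mul]
      exact mul_le_mul hTy (hM0 _) (norm_nonneg _) hT0
    · refine (norm_sum_le _ _).trans (Finset.sum_le_sum fun i _ => ?_)
      rw [norm_mul]
      refine (mul_le_mul (hn i y) le_rfl (norm_nonneg _) zero_le_one).trans ?_
      rw [one_mul]
      refine (norm_add_le _ _).trans (add_le_add (hM1 i _) ?_)
      rw [norm_mul, norm_mul, Real.norm_of_nonneg hl.1.le]
      have h2 := mul_le_mul hTy (hM2 i (l * (T - ‖y‖), x + y)) (norm_nonneg _) hT0
      have h3 : 0 ≤ ‖T - ‖y‖‖ * ‖fderiv ℝ (J i) (l * (T - ‖y‖), x + y) (1, 0)‖ := by positivity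
      nlinarith [hl.2]
  obtain ⟨M, hM⟩ := hbd
  have hfin : volume (Metric.ball (0 : E3) T) < ⊤ := measure_ball_lt_top
  have hftc : ∀ y ∈ Metric.ball (0 : E3) T, ∫ l in (0 : ℝ)..1, g l y = (J0 (T - ‖y‖, x + y) +
        ∑ i, (‖y‖⁻¹ * y i) * J i (T - ‖y‖, x + y)) - J0 (0, x + y) := by
    intro y _
    have hder : ∀ l : ℝ, HasDerivAt (fun l => (l * (T - ‖y‖), x + y)) (T - ‖y‖, (0 : E3)) l := by
      intro l
      have := ((hasDerivAt_id l).mul_const (T - ‖y‖)).prodMk (hasDerivAt_const l (x + y))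
      simpa using this
    have hsm : ((T - ‖y‖, (0 : E3)) : ℝ × E3) = (T - ‖y‖) • (1, 0) := by simp
    have hder0 : ∀ l : ℝ, HasDerivAt (fun l => J0 (l * (T - ‖y‖), x + y))
        ((T - ‖y‖) * fderiv ℝ J0 (l * (T - ‖y‖), x + y) (1, 0)) l := by
      intro l
      have h := ((h0.differentiable one_ne_zero) _).hasFDerivAt.comp_hasDerivAt l (hder l)
      rw [hsm, map_smul] at h
      exact h
    have hderJ : ∀ i, ∀ l : ℝ, HasDerivAt (fun l => J i (l * (T - ‖y‖), x + y))
        ((T - ‖y‖) * fderiv ℝ (J i) (l * (T - ‖y‖), x + y) (1, 0)) l := by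
      intro i l
      have h := (((hJ i).differentiable one_ne_zero) _).hasFDerivAt.comp_hasDerivAt l (hder l)
      rw [hsm, map_smul] at h
      exact h
    have hderG : ∀ l : ℝ, HasDerivAt (fun l => J0 (l * (T - ‖y‖), x + y) +
        ∑ i, (‖y‖⁻¹ * y i) * (l * J i (l * (T - ‖y‖), x + y))) (g l y) l := by
      intro l
      have h := (hder0 l).fun_add (HasDerivAt.fun_sum (u := Finset.univ) fun i _ =>
        ((hasDerivAt_id' l).fun_mul (hderJ i l)).const_mul (‖y‖⁻¹ * y i))
      refine h.congr_deriv ?_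
      rw [hg]
      simp
    rw [intervalIntegral.integral_eq_sub_of_hasDerivAt (fun l _ => hderG l)]
    · simp
    · apply Continuous.intervalIntegrable
      rw [hg]
      have a0 : Continuous fun l : ℝ => (l * (T - ‖y‖), x + y) := by fun_prop
      have a1 := hd0.comp a0
      have a2 := fun i => (hcJ i).comp a0
      have a3 := fun i => (hdJ i).comp a0
      simp only [Function.comp_def] at a1 a2 a3
      fun_prop
  have hslice : ∀ l ∈ Set.Ioo (0 : ℝ) 1, ∫ y in Metric.ball (0 : E3) T, g l y ≤ 0 := by
    intro l hl
    obtain ⟨Ψ, hΨ⟩ : ∃ Ψ : Fin 3 → ℝ × E3 → ℝ, Ψ = fun i z => z.1 * J i (l * z.1, x + z.2) :=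
      ⟨_, rfl⟩
    have hΨd : ∀ i, ContDiff ℝ 1 (Ψ i) := by
      intro i
      rw [hΨ]
      have := hJ i
      fun_prop
    have hΨc : ∀ i, HasCompactSupport (Ψ i) := by
      intro i
      have hemb : Topology.IsClosedEmbedding fun z : ℝ × E3 => (l * z.1, x + z.2) :=
        ((Homeomorph.mulLeft₀ l hl.1.ne').prodCongr (Homeomorph.addLeft x)).isClosedEmbedding
      have := (cJ i).comp_isClosedEmbedding hemb
      rw [hΨ]
      exact this.mul_left
    have hΨ0 : ∀ i y, Ψ i (0, y) = 0 := by simp [hΨ]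
    have hz := fun i => integral_ball_cone_deriv_eq_zero (hΨd i) (hΨc i) (hΨ0 i) (T := T) (bv i)
    have hΨf : ∀ i (z : ℝ × E3) (w : ℝ × E3), fderiv ℝ (Ψ i) z w =
        w.1 * J i (l * z.1, x + z.2) + z.1 * (l * w.1 * fderiv ℝ (J i) (l * z.1, x + z.2) (1, 0) +
          fderiv ℝ (J i) (l * z.1, x + z.2) (0, w.2)) := by
      intro i z w
      have b1 : HasFDerivAt (fun z : ℝ × E3 => (l * z.1, x + z.2))
          ((l • ContinuousLinearMap.fst ℝ ℝ E3).prod (ContinuousLinearMap.snd ℝ ℝ E3)) z :=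
        (hasFDerivAt_fst.const_mul l).prodMk (hasFDerivAt_snd.const_add x)
      have b2 := hasFDerivAt_fst.fun_mul
        ((((hJ i).differentiable one_ne_zero) (l * z.1, x + z.2)).hasFDerivAt.comp z b1)
      have b3 := b2.fderiv
      have b5 : Ψ i = fun z : ℝ × E3 => z.1 * (J i ∘ fun z : ℝ × E3 => (l * z.1, x + z.2)) z := by
        rw [hΨ]
        rfl
      rw [← b5] at b3
      have b4 : ((l * w.1, w.2) : ℝ × E3) = (l * w.1) • (1, 0) + (0, w.2) := by simp
      have b6 : fderiv ℝ (J i) (l * z.1, x + z.2) (l * w.1, w.2) =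
          l * w.1 * fderiv ℝ (J i) (l * z.1, x + z.2) (1, 0) +
            fderiv ℝ (J i) (l * z.1, x + z.2) (0, w.2) := by
        rw [b4, map_add, map_smul, smul_eq_mul]
      rw [b3]
      simp [b6]
      ring
    have h_integrable : ∀ i, IntegrableOn (fun y => fderiv ℝ (Ψ i) (T - ‖y‖, y)
        (-(‖y‖⁻¹ * ⟪y, bv i⟫_ℝ), bv i)) (Metric.ball (0 : E3) T) := by
      intro i
      obtain ⟨N, hN⟩ := ((hΨc i).fderiv ℝ).exists_bound_of_continuous
        ((hΨd i).continuous_fderiv one_ne_zero)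
      refine Measure.integrableOn_of_bounded (M := N) hfin.ne ?_ ?_
      · have h1 := measurable_fderiv_cone (hΨd i) (1, 0)
        have h2 := measurable_fderiv_cone (hΨd i) (0, bv i)
        have e : (fun y : E3 => fderiv ℝ (Ψ i) (T - ‖y‖, y) (-(‖y‖⁻¹ * ⟪y, bv i⟫_ℝ), bv i)) =
            fun y => -(‖y‖⁻¹ * ⟪y, bv i⟫_ℝ) * fderiv ℝ (Ψ i) (T - ‖y‖, y) (1, 0) +
              fderiv ℝ (Ψ i) (T - ‖y‖, y) (0, bv i) := by
          funext y
          have e1 : ((-(‖y‖⁻¹ * ⟪y, bv i⟫_ℝ), bv i) : ℝ × E3) =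
            (-(‖y‖⁻¹ * ⟪y, bv i⟫_ℝ)) • (1, 0) + (0, bv i) := by simp
          rw [e1, map_add, map_smul, smul_eq_mul]
        rw [e]
        have c1 : Continuous fun y : E3 => (T - ‖y‖, y) := by fun_prop
        have m1 := (h1.comp c1).measurable
        have m2 := (h2.comp c1).measurable
        simp only [Function.comp_def] at m1 m2
        exact (by fun_prop : Measurable _).aestronglyMeasurable
      · refine Filter.Eventually.of_forall fun y => ?_
        refine (ContinuousLinearMap.le_of_opNorm_le _ (hN _) _).trans ?_
        have hN0 : 0 ≤ N := (norm_nonneg _).trans (hN 0)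
        refine (mul_le_mul_of_nonneg_left ?_ hN0).trans (mul_one N).le
        have := hn i y
        rw [Prod.norm_def]
        simpa [EuclideanSpace.inner_single_right] using this
    have hle : ∫ y in Metric.ball (0 : E3) T, g l y ≤ ∫ y in Metric.ball (0 : E3) T,
        -∑ i, fderiv ℝ (Ψ i) (T - ‖y‖, y) (-(‖y‖⁻¹ * ⟪y, bv i⟫_ℝ), bv i) := by
      refine setIntegral_mono_on ?_ ?_ Metric.isOpen_ball.measurableSet ?_
      · refine Measure.integrableOn_of_bounded (M := M) hfin.ne ?_ ?_
        · exact (hgm.comp (by fun_prop : Measurable fun y : E3 => (l, y))).aestronglyMeasurable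
        · filter_upwards [ae_restrict_mem Metric.isOpen_ball.measurableSet] with y hy
          exact hM l (by rw [Set.uIoc_of_le zero_le_one]; exact ⟨hl.1, hl.2.le⟩) y hy
      · exact (integrable_finsetSum _ fun i _ => h_integrable i).neg
      · intro y hy
        simp only [Metric.mem_ball, dist_zero_right] at hy
        have h1 := hdiv (l * (T - ‖y‖)) y (mul_pos hl.1 (by linarith)) (by nlinarith [hl.2])
        rw [hg]
        simp only [hΨf, EuclideanSpace.inner_single_right, Fin.sum_univ_three] at h1 ⊢
        simp only [map_one, one_mul, conj_trivial]
        have h2 : 0 ≤ T - ‖y‖ := by linarith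
        nlinarith [mul_nonpos_of_nonneg_of_nonpos h2 h1]
    refine hle.trans ?_
    rw [integral_neg, integral_finsetSum _ fun i _ => h_integrable i]
    simp [hz]
  have hswap : ∫ l in (0 : ℝ)..1, ∫ y in Metric.ball (0 : E3) T, g l y =
      ∫ y in Metric.ball (0 : E3) T, ∫ l in (0 : ℝ)..1, g l y := by
    apply intervalIntegral_integral_swap
    rw [Measure.prod_restrict]
    refine Measure.integrableOn_of_bounded (M := M) ?_ hgm.aestronglyMeasurable ?_
    · rw [Measure.prod_prod]
      exact ENNReal.mul_ne_top (by simp) hfin.ne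
    · filter_upwards [ae_restrict_mem
        (measurableSet_uIoc.prod Metric.isOpen_ball.measurableSet)] with z hz
      exact hM z.1 hz.1 z.2 hz.2
  have hneg : ∫ l in (0 : ℝ)..1, ∫ y in Metric.ball (0 : E3) T, g l y ≤ 0 := by
    rw [intervalIntegral.integral_of_le zero_le_one, integral_Ioc_eq_integral_Ioo]
    exact setIntegral_nonpos measurableSet_Ioo hslice
  have hb0 : ∃ M, ∀ z, ‖J0 z‖ ≤ M := c0.exists_bound_of_continuous hc0
  choose M1 hM1 using fun i => (cJ i).exists_bound_of_continuous (hcJ i)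
  obtain ⟨M0, hM0⟩ := hb0
  have hc : Continuous fun y : E3 => (T - ‖y‖, x + y) := by fun_prop
  rw [hswap, setIntegral_congr_fun Metric.isOpen_ball.measurableSet hftc, integral_sub] at hneg
  · linarith
  · refine Integrable.add ?_ (integrable_finsetSum _ fun i _ => ?_)
    · exact Measure.integrableOn_of_bounded (M := M0) hfin.ne
        (hc0.comp hc).aestronglyMeasurable (Filter.Eventually.of_forall fun y => hM0 _)
    · refine Measure.integrableOn_of_bounded (M := M1 i) hfin.ne ?_
        (Filter.Eventually.of_forall fun y => ?_)
      · have m1 := ((hcJ i).comp hc).measurable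
        simp only [Function.comp_def] at m1
        exact (by fun_prop : Measurable _).aestronglyMeasurable
      · rw [norm_mul]
        refine (mul_le_mul (hn i y) (hM1 i _) (norm_nonneg _) zero_le_one).trans (one_mul _).le
  · exact Measure.integrableOn_of_bounded (M := M0) hfin.ne
      (hc0.comp (by fun_prop : Continuous fun y : E3 => ((0 : ℝ), x + y))).aestronglyMeasurable
      (Filter.Eventually.of_forall fun y => hM0 _)

theorem exists_cutoff {K U : Set (ℝ × E3)} (hK : IsCompact K) (hU : IsOpen U) (hKU : K ⊆ U) :
    ∃ χ : ℝ × E3 → ℝ, ContDiff ℝ 1 χ ∧ HasCompactSupport χ ∧ tsupport χ ⊆ U ∧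
      ∀ᶠ q in nhdsSet K, χ q = 1 := by
  obtain ⟨L, hL, hKL, hLU⟩ := exists_compact_between hK hU hKU
  obtain ⟨f, h1, h0, -⟩ := exists_contMDiffMap_one_nhds_of_subset_interior
    (modelWithCornersSelf ℝ (ℝ × E3)) (n := 1) hK.isClosed hKL
  have hs : tsupport (f : ℝ × E3 → ℝ) ⊆ L := by
    refine closure_minimal (fun q hq => ?_) hL.isClosed
    by_contra h
    exact hq (h0 q h)
  exact ⟨f, f.contMDiff.contDiff, HasCompactSupport.of_support_subset_isCompact hL
    ((subset_tsupport _).trans hs), hs.trans hLU, h1⟩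

/-- The flux of a dissipative current through a backward light cone is bounded by its initial
value. -/
theorem cone_flux_le {J0 : ℝ × E3 → ℝ} {J : Fin 3 → ℝ × E3 → ℝ} {U : Set (ℝ × E3)}
    (hU : IsOpen U) (h0 : ContDiffOn ℝ 1 J0 U) (hJ : ∀ i, ContDiffOn ℝ 1 (J i) U)
    {T : ℝ} (x : E3) (hKU : ∀ t y, 0 ≤ t → ‖y‖ + t ≤ T → (t, x + y) ∈ U)
    (hdiv : ∀ t y, 0 < t → ‖y‖ + t < T → fderiv ℝ J0 (t, x + y) (1, 0) +
      ∑ i, fderiv ℝ (J i) (t, x + y) (0, bv i) ≤ 0) :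
    ∫ y in Metric.ball (0 : E3) T, (J0 (T - ‖y‖, x + y) +
        ∑ i, (‖y‖⁻¹ * y i) * J i (T - ‖y‖, x + y)) ≤
      ∫ y in Metric.ball (0 : E3) T, J0 (0, x + y) := by
  obtain ⟨K, hKd⟩ : ∃ K : Set (ℝ × E3), K = {q | 0 ≤ q.1 ∧ ‖q.2 - x‖ + q.1 ≤ T} := ⟨_, rfl⟩
  have hKc : IsCompact K := by
    refine (isCompact_Icc.prod (isCompact_closedBall x T)).of_isClosed_subset ?_ ?_
      (s := Set.Icc (0 : ℝ) T ×ˢ Metric.closedBall x T)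
    · rw [hKd]
      have h : Continuous fun q : ℝ × E3 => ‖q.2 - x‖ + q.1 := by fun_prop
      exact (isClosed_le continuous_const continuous_fst).inter (isClosed_le h continuous_const)
    · rintro ⟨t, z⟩ hz
      simp only [hKd, Set.mem_ofPred_eq] at hz
      have := norm_nonneg (z - x)
      simp only [Set.mem_prod, Set.mem_Icc, Metric.mem_closedBall, dist_eq_norm]
      exact ⟨⟨hz.1, by linarith⟩, by linarith⟩
  have hKsub : K ⊆ U := by
    rintro ⟨t, z⟩ hz
    simp only [hKd, Set.mem_ofPred_eq] at hz
    have := hKU t (z - x) hz.1 hz.2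
    simpa using this
  obtain ⟨χ, hχ, hχc, hχU, hχ1⟩ := exists_cutoff hKc hU hKsub
  have hmul : ∀ g : ℝ × E3 → ℝ, ContDiffOn ℝ 1 g U → ContDiff ℝ 1 (fun q => χ q * g q) := by
    intro g hg
    refine contDiff_iff_contDiffAt.2 fun q => ?_
    by_cases hq : q ∈ tsupport χ
    · exact hχ.contDiffAt.mul (hg.contDiffAt (hU.mem_nhds (hχU hq)))
    · refine (contDiffAt_const (c := (0 : ℝ))).congr_of_eventuallyEq ?_
      filter_upwards [(isClosed_tsupport χ).isOpen_compl.mem_nhds hq] with z hz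
      simp [image_eq_zero_of_notMem_tsupport hz]
  have hmulc : ∀ g : ℝ × E3 → ℝ, HasCompactSupport (fun q => χ q * g q) := fun g => hχc.mul_right
  have hχn : ∀ q ∈ K, ∀ g : ℝ × E3 → ℝ, (fun q => χ q * g q) =ᶠ[nhds q] g := by
    intro q hq g
    filter_upwards [eventually_nhdsSet_iff_forall.1 hχ1 q hq] with z hz
    simp [hz]
  have hmem : ∀ t y, 0 ≤ t → ‖y‖ + t ≤ T → (t, x + y) ∈ K := by
    intro t y ht hy
    simp [hKd, ht, hy]
  have key := cone_flux_le_of_hasCompactSupport (T := T) (hmul J0 h0) (fun i => hmul (J i) (hJ i))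
    (hmulc J0) (fun i => hmulc (J i)) x ?_
  · refine (Eq.le ?_).trans (key.trans (Eq.le ?_))
    · refine setIntegral_congr_fun Metric.isOpen_ball.measurableSet fun y hy => ?_
      simp only [Metric.mem_ball, dist_zero_right] at hy
      have h1 := hmem (T - ‖y‖) y (by linarith) (by linarith)
      simp only [fun g => (hχn _ h1 g).self_of_nhds]
    · refine setIntegral_congr_fun Metric.isOpen_ball.measurableSet fun y hy => ?_
      simp only [Metric.mem_ball, dist_zero_right] at hy
      exact (hχn _ (hmem 0 y le_rfl (by linarith)) J0).self_of_nhds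
  · intro t y ht hy
    have h1 := hmem t y ht.le hy.le
    rw [(hχn _ h1 J0).fderiv_eq]
    refine le_trans (Eq.le ?_) (hdiv t y ht hy)
    congr 1
    refine Finset.sum_congr rfl fun i _ => ?_
    rw [(hχn _ h1 (J i)).fderiv_eq]

section

variable {F : ℝ × E3 → ℝ}

/-- Time derivative. -/
def dT (F : ℝ × E3 → ℝ) (q : ℝ × E3) : ℝ := fderiv ℝ F q (1, 0)

/-- Spatial partial derivatives. -/
def dX (F : ℝ × E3 → ℝ) (i : Fin 3) (q : ℝ × E3) : ℝ := fderiv ℝ F q (0, bv i)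

/-- Components of the radial unit vector. -/
def unitv (i : Fin 3) (q : ℝ × E3) : ℝ := ‖q.2‖⁻¹ * q.2 i

/-- Radial derivative. -/
def dR (F : ℝ × E3 → ℝ) (q : ℝ × E3) : ℝ := ∑ i, unitv i q * dX F i q

/-- The outgoing derivative `r⁻¹(∂_t + ∂_r)(rF)`. -/
def outZ (F : ℝ × E3 → ℝ) (q : ℝ × E3) : ℝ := dT F q + dR F q + F q * ‖q.2‖⁻¹

/-- Square of the angular gradient. -/
def angSq (F : ℝ × E3 → ℝ) (q : ℝ × E3) : ℝ := (∑ i, dX F i q ^ 2) - dR F q ^ 2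

/-- Potential energy density. -/
def pot (p : ℝ) (F : ℝ × E3 → ℝ) (q : ℝ × E3) : ℝ := |F q| ^ (p + 1) / (p + 1)

theorem hasLineDerivAt_of_contDiff {g : ℝ × E3 → ℝ} (hg : ContDiff ℝ 1 g) (q v : ℝ × E3) :
    HasLineDerivAt ℝ g (fderiv ℝ g q v) q v :=
  ((hg.differentiable one_ne_zero) q).hasFDerivAt.hasLineDerivAt v

theorem contDiff_dT (hF : ContDiff ℝ 2 F) : ContDiff ℝ 1 (dT F) := by
  have := hF.fderiv_right (m := 1) le_rfl
  unfold dT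
  fun_prop

theorem contDiff_dX (hF : ContDiff ℝ 2 F) (i : Fin 3) : ContDiff ℝ 1 (dX F i) := by
  have := hF.fderiv_right (m := 1) le_rfl
  unfold dX
  fun_prop

theorem fderiv_fderiv_apply (hF : ContDiff ℝ 2 F) (q v w : ℝ × E3) :
    fderiv ℝ (fun q => fderiv ℝ F q w) q v = fderiv ℝ (fderiv ℝ F) q v w := by
  have hF' : ContDiff ℝ 1 (fderiv ℝ F) := hF.fderiv_right (m := 1) le_rfl
  have h := ((hF'.differentiable one_ne_zero) q).hasFDerivAt.clm_apply (hasFDerivAt_const w q)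
  rw [h.fderiv]
  simp

theorem fderiv_dT (hF : ContDiff ℝ 2 F) (q v : ℝ × E3) :
    fderiv ℝ (dT F) q v = fderiv ℝ (fderiv ℝ F) q v (1, 0) := fderiv_fderiv_apply hF q v (1, 0)

theorem fderiv_dX (hF : ContDiff ℝ 2 F) (i : Fin 3) (q v : ℝ × E3) :
    fderiv ℝ (dX F i) q v = fderiv ℝ (fderiv ℝ F) q v (0, bv i) :=
  fderiv_fderiv_apply hF q v (0, bv i)

theorem contDiff_pot {p : ℝ} (hp : 1 < p) (hF : ContDiff ℝ 2 F) : ContDiff ℝ 1 (pot p F) := by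
  have h := (hF.of_le one_le_two).norm_rpow (p := p + 1) (by linarith)
  exact h.div_const _

theorem hasLineDerivAt_pot {p : ℝ} (hp : 1 < p) (hF : ContDiff ℝ 2 F) (q v : ℝ × E3) :
    HasLineDerivAt ℝ (pot p F) (|F q| ^ (p - 1) * F q * fderiv ℝ F q v) q v := by
  have h1 := (hasDerivAt_abs_rpow (F q) (p := p + 1) (by linarith)).comp_hasFDerivAt q
    ((hF.differentiable two_ne_zero) q).hasFDerivAt
  have h2 := (h1.const_mul (p + 1)⁻¹).hasLineDerivAt v
  have h3 : (fun q => (p + 1)⁻¹ * ((fun x => |x| ^ (p + 1)) ∘ F) q) = pot p F := by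
    funext q
    simp only [pot, Function.comp]
    ring
  rw [h3] at h2
  unfold HasLineDerivAt at h2 ⊢
  refine h2.congr_deriv ?_
  have : p + 1 ≠ 0 := by linarith
  have e : p + 1 - 2 = p - 1 := by ring
  change (p + 1)⁻¹ * (((p + 1) * |F q| ^ (p + 1 - 2) * F q) * fderiv ℝ F q v) = _
  rw [e]
  field_simp

/-- The divergence of the energy current vanishes on solutions. -/
theorem energy_div_le {p : ℝ} (hp : 1 < p) (hF : ContDiff ℝ 2 F) (hs : SolvesNLW p F)
    {q : ℝ × E3} (hq : 0 ≤ q.1) :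
    fderiv ℝ (fun q => dT F q ^ 2 / 2 + (∑ i, dX F i q ^ 2) / 2 + pot p F q) q (1, 0) +
      ∑ i, fderiv ℝ (fun q => -(dT F q * dX F i q)) q (0, bv i) ≤ 0 := by
  have hT := contDiff_dT hF
  have hX := contDiff_dX hF
  have hV := contDiff_pot hp hF
  have c0 : ContDiff ℝ 1 (fun q => dT F q ^ 2 / 2 + (∑ i, dX F i q ^ 2) / 2 + pot p F q) := by
    fun_prop
  have cJ : ∀ i, ContDiff ℝ 1 (fun q => -(dT F q * dX F i q)) := fun i => by
    have := hX i
    fun_prop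
  have l0 : ∀ v, fderiv ℝ (fun q => dT F q ^ 2 / 2 + (∑ i, dX F i q ^ 2) / 2 + pot p F q) q v =
      dT F q * fderiv ℝ (fderiv ℝ F) q v (1, 0) +
      ∑ i, dX F i q * fderiv ℝ (fderiv ℝ F) q v (0, bv i) +
        |F q| ^ (p - 1) * F q * fderiv ℝ F q v := by
    intro v
    have h1 := hasLineDerivAt_of_contDiff hT q v
    have h2 := fun i => hasLineDerivAt_of_contDiff (hX i) q v
    have h3 := hasLineDerivAt_pot hp hF q v
    have h4 := hasLineDerivAt_of_contDiff c0 q v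
    unfold HasLineDerivAt at h1 h2 h3 h4
    refine h4.unique ((((h1.fun_pow 2).div_const 2).fun_add ((HasDerivAt.fun_sum
      (u := Finset.univ) fun i _ => (h2 i).fun_pow 2).div_const 2)).fun_add h3 |>.congr_deriv ?_)
    simp only [zero_smul, add_zero, Fin.sum_univ_three, fderiv_dT hF, fderiv_dX hF]
    norm_num
    ring
  have lJ : ∀ i v, fderiv ℝ (fun q => -(dT F q * dX F i q)) q v =
      -(fderiv ℝ (fderiv ℝ F) q v (1, 0) * dX F i q +
        dT F q * fderiv ℝ (fderiv ℝ F) q v (0, bv i)) := by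
    intro i v
    have h1 := hasLineDerivAt_of_contDiff hT q v
    have h2 := hasLineDerivAt_of_contDiff (hX i) q v
    have h4 := hasLineDerivAt_of_contDiff (cJ i) q v
    unfold HasLineDerivAt at h1 h2 h4
    refine h4.unique ((h1.fun_mul h2).fun_neg.congr_deriv ?_)
    simp only [zero_smul, add_zero, fderiv_dT hF, fderiv_dX hF]
  have heq := hs q hq
  have hsymm : ∀ i, fderiv ℝ (fderiv ℝ F) q (1, 0) (0, bv i) =
      fderiv ℝ (fderiv ℝ F) q (0, bv i) (1, 0) := fun i =>
    (hF.contDiffAt.isSymmSndFDerivAt (by simp)) _ _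
  rw [l0]
  simp only [lJ, hsymm, Fin.sum_univ_three] at heq ⊢
  change _ + |F q| ^ (p - 1) * F q * dT F q + _ ≤ 0
  apply le_of_eq
  linear_combination (-dT F q) * heq

end

section

variable {F : ℝ × E3 → ℝ} {p : ℝ}

/-- Derivative of the radius in direction `v`. -/
def radD (q v : ℝ × E3) : ℝ := ∑ i, unitv i q * v.2 i

theorem hasLineDerivAt_radius {q : ℝ × E3} (hq : q.2 ≠ 0) (v : ℝ × E3) :
    HasLineDerivAt ℝ (fun q : ℝ × E3 => ‖q.2‖) (radD q v) q v := by
  have h := (hasFDerivAt_norm_of_ne_zero hq).comp q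
    (hasFDerivAt_snd (𝕜 := ℝ) (E := ℝ) (F := E3) (p := q))
  have h' := h.hasLineDerivAt v
  unfold HasLineDerivAt at h' ⊢
  refine h'.congr_deriv ?_
  simp [radD, unitv, PiLp.inner_apply, Fin.sum_univ_three]
  ring

theorem hasLineDerivAt_radius_inv {q : ℝ × E3} (hq : q.2 ≠ 0) (v : ℝ × E3) :
    HasLineDerivAt ℝ (fun q : ℝ × E3 => ‖q.2‖⁻¹) (-(‖q.2‖⁻¹ ^ 2 * radD q v)) q v := by
  have h := hasLineDerivAt_radius hq v
  unfold HasLineDerivAt at h ⊢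
  have h0 : ‖(q + (0 : ℝ) • v).2‖ ≠ 0 := by simpa using hq
  refine (h.fun_inv h0).congr_deriv ?_
  simp only [zero_smul, add_zero]
  have := norm_ne_zero_iff.2 hq
  field_simp

theorem hasLineDerivAt_radius_rpow {q : ℝ × E3} (hq : q.2 ≠ 0) (γ : ℝ) (v : ℝ × E3) :
    HasLineDerivAt ℝ (fun q : ℝ × E3 => ‖q.2‖ ^ γ) (γ * ‖q.2‖ ^ γ * ‖q.2‖⁻¹ * radD q v) q v := by
  have h := hasLineDerivAt_radius hq v
  unfold HasLineDerivAt at h ⊢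
  have h0 : ‖(q + (0 : ℝ) • v).2‖ ≠ 0 := by simpa using hq
  refine (h.rpow_const (p := γ) (Or.inl h0)).congr_deriv ?_
  simp only [zero_smul, add_zero]
  rw [rpow_sub_one (norm_ne_zero_iff.2 hq)]
  have := norm_ne_zero_iff.2 hq
  field_simp

theorem hasLineDerivAt_unitv {q : ℝ × E3} (hq : q.2 ≠ 0) (i : Fin 3) (v : ℝ × E3) :
    HasLineDerivAt ℝ (unitv i) (‖q.2‖⁻¹ * (v.2 i - unitv i q * radD q v)) q v := by
  have h := hasLineDerivAt_radius_inv hq v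
  have h2 : HasDerivAt (fun t : ℝ => (q + t • v).2 i) (v.2 i) 0 := by
    have := ((hasDerivAt_id (0 : ℝ)).mul_const (v.2 i)).const_add (q.2 i)
    simpa using this
  unfold HasLineDerivAt at h ⊢
  refine (h.fun_mul h2).congr_deriv ?_
  simp only [zero_smul, add_zero, unitv]
  ring

theorem hasLineDerivAt_dR (hF : ContDiff ℝ 2 F) {q : ℝ × E3} (hq : q.2 ≠ 0) (v : ℝ × E3) :
    HasLineDerivAt ℝ (dR F) (∑ i, (‖q.2‖⁻¹ * (v.2 i - unitv i q * radD q v) * dX F i q +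
      unitv i q * fderiv ℝ (fderiv ℝ F) q v (0, bv i))) q v := by
  have h1 := fun i => hasLineDerivAt_unitv hq i v
  have h2 := fun i => hasLineDerivAt_of_contDiff (contDiff_dX hF i) q v
  unfold HasLineDerivAt at h1 h2 ⊢
  refine (HasDerivAt.fun_sum (u := Finset.univ) fun i _ => (h1 i).fun_mul (h2 i)).congr_deriv ?_
  simp only [zero_smul, add_zero, fderiv_dX hF]

theorem hasLineDerivAt_outZ (hF : ContDiff ℝ 2 F) {q : ℝ × E3} (hq : q.2 ≠ 0) (v : ℝ × E3) :
    HasLineDerivAt ℝ (outZ F) (fderiv ℝ (fderiv ℝ F) q v (1, 0) +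
      (∑ i, (‖q.2‖⁻¹ * (v.2 i - unitv i q * radD q v) * dX F i q +
      unitv i q * fderiv ℝ (fderiv ℝ F) q v (0, bv i))) +
      (fderiv ℝ F q v * ‖q.2‖⁻¹ + F q * -(‖q.2‖⁻¹ ^ 2 * radD q v))) q v := by
  have h1 := hasLineDerivAt_of_contDiff (contDiff_dT hF) q v
  have h2 := hasLineDerivAt_dR hF hq v
  have h3 := hasLineDerivAt_of_contDiff (hF.of_le one_le_two) q v
  have h4 := hasLineDerivAt_radius_inv hq v
  unfold HasLineDerivAt at h1 h2 h3 h4 ⊢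
  refine ((h1.fun_add h2).fun_add (h3.fun_mul h4)).congr_deriv ?_
  simp only [zero_smul, add_zero, fderiv_dT hF]

theorem hasLineDerivAt_angSq (hF : ContDiff ℝ 2 F) {q : ℝ × E3} (hq : q.2 ≠ 0) (v : ℝ × E3) :
    HasLineDerivAt ℝ (angSq F) (2 * (∑ i, dX F i q * fderiv ℝ (fderiv ℝ F) q v (0, bv i)) -
      2 * dR F q * (∑ i, (‖q.2‖⁻¹ * (v.2 i - unitv i q * radD q v) * dX F i q +
      unitv i q * fderiv ℝ (fderiv ℝ F) q v (0, bv i)))) q v := by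
  have h1 := fun i => hasLineDerivAt_of_contDiff (contDiff_dX hF i) q v
  have h2 := hasLineDerivAt_dR hF hq v
  unfold HasLineDerivAt at h1 h2 ⊢
  refine ((HasDerivAt.fun_sum (u := Finset.univ) fun i _ => (h1 i).fun_pow 2).fun_sub
    (h2.fun_pow 2)).congr_deriv ?_
  simp only [zero_smul, add_zero, fderiv_dX hF, Fin.sum_univ_three]
  norm_num
  ring

/-- Density of the weighted current. -/
def wJ0 (p γ : ℝ) (F : ℝ × E3 → ℝ) (q : ℝ × E3) : ℝ :=
  ‖q.2‖ ^ γ * (outZ F q ^ 2 / 2 + angSq F q / 2 + pot p F q)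

/-- Spatial components of the weighted current. -/
def wJ (p γ : ℝ) (F : ℝ × E3 → ℝ) (i : Fin 3) (q : ℝ × E3) : ℝ :=
  ‖q.2‖ ^ γ * ((-(outZ F q ^ 2 / 2) + angSq F q / 2 + pot p F q) * unitv i q -
    outZ F q * (dX F i q - dR F q * unitv i q))

theorem isOpen_snd_ne_zero : IsOpen {q : ℝ × E3 | q.2 ≠ 0} :=
  isOpen_ne_fun continuous_snd continuous_const

theorem contDiffOn_radius : ContDiffOn ℝ 1 (fun q : ℝ × E3 => ‖q.2‖) {q : ℝ × E3 | q.2 ≠ 0} :=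
  contDiff_snd.contDiffOn.norm ℝ fun _ h => h

theorem contDiffOn_unitv (i : Fin 3) : ContDiffOn ℝ 1 (unitv i) {q : ℝ × E3 | q.2 ≠ 0} := by
  have h : ContDiff ℝ 1 (fun q : ℝ × E3 => q.2 i) := by fun_prop
  exact (contDiffOn_radius.inv fun _ h => norm_ne_zero_iff.2 h).mul h.contDiffOn

theorem contDiffOn_dR (hF : ContDiff ℝ 2 F) : ContDiffOn ℝ 1 (dR F) {q : ℝ × E3 | q.2 ≠ 0} :=
  ContDiffOn.sum fun i _ => (contDiffOn_unitv i).mul (contDiff_dX hF i).contDiffOn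

theorem contDiffOn_outZ (hF : ContDiff ℝ 2 F) : ContDiffOn ℝ 1 (outZ F) {q : ℝ × E3 | q.2 ≠ 0} :=
  ((contDiff_dT hF).contDiffOn.add (contDiffOn_dR hF)).add ((hF.of_le one_le_two).contDiffOn.mul
    (contDiffOn_radius.inv fun _ h => norm_ne_zero_iff.2 h))

theorem contDiffOn_angSq (hF : ContDiff ℝ 2 F) :
    ContDiffOn ℝ 1 (angSq F) {q : ℝ × E3 | q.2 ≠ 0} :=
  (ContDiffOn.sum fun i _ => (contDiff_dX hF i).contDiffOn.pow 2).sub ((contDiffOn_dR hF).pow 2)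

theorem contDiffOn_wJ0 (hp : 1 < p) (γ : ℝ) (hF : ContDiff ℝ 2 F) :
    ContDiffOn ℝ 1 (wJ0 p γ F) {q : ℝ × E3 | q.2 ≠ 0} :=
  (contDiffOn_radius.rpow_const_of_ne fun _ h => norm_ne_zero_iff.2 h).mul
    (((((contDiffOn_outZ hF).pow 2).div_const 2).add ((contDiffOn_angSq hF).div_const 2)).add
      (contDiff_pot hp hF).contDiffOn)

theorem contDiffOn_wJ (hp : 1 < p) (γ : ℝ) (hF : ContDiff ℝ 2 F) (i : Fin 3) :
    ContDiffOn ℝ 1 (wJ p γ F i) {q : ℝ × E3 | q.2 ≠ 0} :=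
  (contDiffOn_radius.rpow_const_of_ne fun _ h => norm_ne_zero_iff.2 h).mul
    (((((((contDiffOn_outZ hF).pow 2).div_const 2).neg.add ((contDiffOn_angSq hF).div_const 2)).add
      (contDiff_pot hp hF).contDiffOn).mul (contDiffOn_unitv i)).sub
      ((contDiffOn_outZ hF).mul ((contDiff_dX hF i).contDiffOn.sub
        ((contDiffOn_dR hF).mul (contDiffOn_unitv i)))))

theorem sum_unitv_sq {q : ℝ × E3} (hq : q.2 ≠ 0) :
    unitv 0 q ^ 2 + unitv 1 q ^ 2 + unitv 2 q ^ 2 = 1 := by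
  have h := norm_sq_eq q.2
  have := norm_ne_zero_iff.2 hq
  simp only [unitv]
  field_simp
  linarith

theorem angSq_nonneg {q : ℝ × E3} (hq : q.2 ≠ 0) : 0 ≤ angSq F q := by
  have h := sum_unitv_sq hq
  have := Finset.sum_mul_sq_le_sq_mul_sq Finset.univ (fun i => unitv i q) (fun i => dX F i q)
  simp only [angSq, dR]
  simp only [Fin.sum_univ_three, h, one_mul] at this ⊢
  linarith

theorem pot_nonneg (hp : 1 < p) (q : ℝ × E3) : 0 ≤ pot p F q :=
  div_nonneg (rpow_nonneg (abs_nonneg _) _) (by linarith)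

end

section

variable {F : ℝ × E3 → ℝ} {p : ℝ}

theorem fderiv_eq_of_hasLineDerivAt {g : ℝ × E3 → ℝ} {U : Set (ℝ × E3)} (hU : IsOpen U)
    (hg : ContDiffOn ℝ 1 g U) {q : ℝ × E3} (hq : q ∈ U) {v : ℝ × E3} {d : ℝ}
    (h : HasLineDerivAt ℝ g d q v) : fderiv ℝ g q v = d :=
  (((hg.contDiffAt (hU.mem_nhds hq)).differentiableAt one_ne_zero).hasFDerivAt.hasLineDerivAt
    v).unique h

theorem fderiv_wJ0 (hp : 1 < p) (γ : ℝ) (hF : ContDiff ℝ 2 F) {q : ℝ × E3} (hq : q.2 ≠ 0) :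
    fderiv ℝ (wJ0 p γ F) q (1, 0) = ‖q.2‖ ^ γ * (outZ F q * (fderiv ℝ (fderiv ℝ F) q (1, 0) (1, 0) +
      (∑ i, unitv i q * fderiv ℝ (fderiv ℝ F) q (1, 0) (0, bv i)) + dT F q * ‖q.2‖⁻¹) +
      (∑ i, dX F i q * fderiv ℝ (fderiv ℝ F) q (1, 0) (0, bv i)) -
      dR F q * (∑ i, unitv i q * fderiv ℝ (fderiv ℝ F) q (1, 0) (0, bv i)) +
      |F q| ^ (p - 1) * F q * dT F q) := by
  refine fderiv_eq_of_hasLineDerivAt isOpen_snd_ne_zero (contDiffOn_wJ0 hp γ hF) hq ?_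
  have hr : radD q (1, 0) = 0 := by simp [radD]
  have h1 := hasLineDerivAt_radius_rpow hq γ (1, 0)
  have h2 := hasLineDerivAt_outZ hF hq (1, 0)
  have h3 := hasLineDerivAt_angSq hF hq (1, 0)
  have h4 := hasLineDerivAt_pot hp hF q (1, 0)
  unfold HasLineDerivAt at h1 h2 h3 h4 ⊢
  refine (h1.fun_mul ((((h2.fun_pow 2).div_const 2).fun_add (h3.div_const 2)).fun_add
    h4)).congr_deriv ?_
  simp only [zero_smul, add_zero, hr, Fin.sum_univ_three, PiLp.zero_apply]
  rw [show fderiv ℝ F q (1, 0) = dT F q from rfl]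
  simp only [Nat.add_one_sub_one, pow_one, Nat.cast_ofNat]
  ring

theorem fderiv_wJ (hp : 1 < p) (γ : ℝ) (hF : ContDiff ℝ 2 F) {q : ℝ × E3} (hq : q.2 ≠ 0)
    (i : Fin 3) :
    fderiv ℝ (wJ p γ F i) q (0, bv i) =
      γ * ‖q.2‖ ^ γ * ‖q.2‖⁻¹ * unitv i q * ((-(outZ F q ^ 2 / 2) + angSq F q / 2 + pot p F q) *
        unitv i q - outZ F q * (dX F i q - dR F q * unitv i q)) +
      ‖q.2‖ ^ γ * ((-(outZ F q * (fderiv ℝ (fderiv ℝ F) q (0, bv i) (1, 0) +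
      (∑ j, (‖q.2‖⁻¹ * (bv i j - unitv j q * unitv i q) * dX F j q +
      unitv j q * fderiv ℝ (fderiv ℝ F) q (0, bv i) (0, bv j))) +
      (dX F i q * ‖q.2‖⁻¹ + F q * -(‖q.2‖⁻¹ ^ 2 * unitv i q)))) +
      ((∑ j, dX F j q * fderiv ℝ (fderiv ℝ F) q (0, bv i) (0, bv j)) -
      dR F q * (∑ j, (‖q.2‖⁻¹ * (bv i j - unitv j q * unitv i q) * dX F j q +
      unitv j q * fderiv ℝ (fderiv ℝ F) q (0, bv i) (0, bv j)))) +
      |F q| ^ (p - 1) * F q * dX F i q) * unitv i q +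
      (-(outZ F q ^ 2 / 2) + angSq F q / 2 + pot p F q) *
        (‖q.2‖⁻¹ * (1 - unitv i q * unitv i q)) -
      ((fderiv ℝ (fderiv ℝ F) q (0, bv i) (1, 0) +
      (∑ j, (‖q.2‖⁻¹ * (bv i j - unitv j q * unitv i q) * dX F j q +
      unitv j q * fderiv ℝ (fderiv ℝ F) q (0, bv i) (0, bv j))) +
      (dX F i q * ‖q.2‖⁻¹ + F q * -(‖q.2‖⁻¹ ^ 2 * unitv i q))) *
        (dX F i q - dR F q * unitv i q) +
      outZ F q * (fderiv ℝ (fderiv ℝ F) q (0, bv i) (0, bv i) -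
        ((∑ j, (‖q.2‖⁻¹ * (bv i j - unitv j q * unitv i q) * dX F j q +
      unitv j q * fderiv ℝ (fderiv ℝ F) q (0, bv i) (0, bv j))) * unitv i q +
        dR F q * (‖q.2‖⁻¹ * (1 - unitv i q * unitv i q)))))) := by
  refine fderiv_eq_of_hasLineDerivAt isOpen_snd_ne_zero (contDiffOn_wJ hp γ hF i) hq ?_
  have hr : radD q (0, bv i) = unitv i q := by simp [radD, bv]
  have hii : bv i i = 1 := by simp [bv]
  have h1 := hasLineDerivAt_radius_rpow hq γ (0, bv i)
  have h2 := hasLineDerivAt_outZ hF hq (0, bv i)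
  have h3 := hasLineDerivAt_angSq hF hq (0, bv i)
  have h4 := hasLineDerivAt_pot hp hF q (0, bv i)
  have h5 := hasLineDerivAt_unitv hq i (0, bv i)
  have h6 := hasLineDerivAt_of_contDiff (contDiff_dX hF i) q (0, bv i)
  have h7 := hasLineDerivAt_dR hF hq (0, bv i)
  rw [fderiv_dX hF] at h6
  simp only [hr, show fderiv ℝ F q (0, bv i) = dX F i q from rfl, hii] at h1 h2 h3 h4 h5 h6 h7
  generalize (∑ j, (‖q.2‖⁻¹ * (bv i j - unitv j q * unitv i q) * dX F j q +
      unitv j q * fderiv ℝ (fderiv ℝ F) q (0, bv i) (0, bv j))) = Y at *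
  generalize (∑ j, dX F j q * fderiv ℝ (fderiv ℝ F) q (0, bv i) (0, bv j)) = X at *
  unfold HasLineDerivAt at h1 h2 h3 h4 h5 h6 h7 ⊢
  refine (h1.fun_mul ((((((h2.fun_pow 2).div_const 2).fun_neg.fun_add (h3.div_const 2)).fun_add
    h4).fun_mul h5).fun_sub (h2.fun_mul (h6.fun_sub (h7.fun_mul h5))))).congr_deriv ?_
  simp only [zero_smul, add_zero]
  simp only [Nat.add_one_sub_one, pow_one, Nat.cast_ofNat]
  ring

theorem div_wJ_eq (hp : 1 < p) (γ : ℝ) (hF : ContDiff ℝ 2 F) (hs : SolvesNLW p F) {q : ℝ × E3}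
    (h0 : 0 ≤ q.1) (hq : q.2 ≠ 0) :
    fderiv ℝ (wJ0 p γ F) q (1, 0) + ∑ i, fderiv ℝ (wJ p γ F i) q (0, bv i) =
      -(‖q.2‖ ^ γ * ‖q.2‖⁻¹ * (γ / 2 * outZ F q ^ 2 + (2 - γ) / 2 * angSq F q +
        (p - 1 - γ) * pot p F q)) := by
  have heq := hs q h0
  have hsymm : ∀ v w, fderiv ℝ (fderiv ℝ F) q v w = fderiv ℝ (fderiv ℝ F) q w v := fun v w =>
    (hF.contDiffAt.isSymmSndFDerivAt (by simp)) _ _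
  have hw := sum_unitv_sq hq
  have hV : |F q| ^ (p - 1) * F q * F q = (p + 1) * pot p F q := by
    have e : |F q| ^ (p + 1) = |F q| ^ (p - 1) * F q * F q := by
      rcases eq_or_ne (F q) 0 with h | h
      · simp [h, show p + 1 ≠ 0 by linarith]
      · rw [show p + 1 = p - 1 + 2 by ring, rpow_add (abs_pos.2 h), rpow_two, sq_abs]
        ring
    have : p + 1 ≠ 0 := by linarith
    rw [pot, e]
    field_simp
  rw [fderiv_wJ0 hp γ hF hq, Fin.sum_univ_three (f := fun i => fderiv ℝ (wJ p γ F i) q (0, bv i)),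
    fderiv_wJ hp γ hF hq, fderiv_wJ hp γ hF hq,
    fderiv_wJ hp γ hF hq]
  have hb : ∀ i j : Fin 3, bv i j = if j = i then 1 else 0 := fun i j => by
    simp [bv]
  simp only [hb, Fin.sum_univ_three] at heq ⊢
  rw [hsymm (0, bv 0) (1, 0), hsymm (0, bv 1) (1, 0), hsymm (0, bv 2) (1, 0),
    hsymm (0, bv 1) (0, bv 0), hsymm (0, bv 2) (0, bv 0), hsymm (0, bv 2) (0, bv 1)]
  generalize |F q| ^ (p - 1) * F q = G at *
  have hZ : outZ F q = dT F q + dR F q + F q * ‖q.2‖⁻¹ := rfl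
  have hP : dR F q = unitv 0 q * dX F 0 q + unitv 1 q * dX F 1 q + unitv 2 q * dX F 2 q := by
    simp [dR, Fin.sum_univ_three]
  have hS : angSq F q = dX F 0 q ^ 2 + dX F 1 q ^ 2 + dX F 2 q ^ 2 - dR F q ^ 2 := by
    simp [angSq, Fin.sum_univ_three]
  have f01 : (0 : Fin 3) = 1 ↔ False := by decide
  have f02 : (0 : Fin 3) = 2 ↔ False := by decide
  have f12 : (1 : Fin 3) = 2 ↔ False := by decide
  have f10 : (1 : Fin 3) = 0 ↔ False := by decide
  have f20 : (2 : Fin 3) = 0 ↔ False := by decide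
  have f21 : (2 : Fin 3) = 1 ↔ False := by decide
  simp only [f01, f02, f12, f10, f20, f21, if_true, if_false]
  generalize ‖q.2‖ ^ γ = f at *
  generalize ‖q.2‖⁻¹ = R at *
  generalize fderiv ℝ (fderiv ℝ F) q (1, 0) (1, 0) = Btt at *
  generalize fderiv ℝ (fderiv ℝ F) q (1, 0) (0, bv 0) = Bt0 at *
  generalize fderiv ℝ (fderiv ℝ F) q (1, 0) (0, bv 1) = Bt1 at *
  generalize fderiv ℝ (fderiv ℝ F) q (1, 0) (0, bv 2) = Bt2 at *
  generalize fderiv ℝ (fderiv ℝ F) q (0, bv 0) (0, bv 0) = B00 at *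
  generalize fderiv ℝ (fderiv ℝ F) q (0, bv 0) (0, bv 1) = B01 at *
  generalize fderiv ℝ (fderiv ℝ F) q (0, bv 0) (0, bv 2) = B02 at *
  generalize fderiv ℝ (fderiv ℝ F) q (0, bv 1) (0, bv 1) = B11 at *
  generalize fderiv ℝ (fderiv ℝ F) q (0, bv 1) (0, bv 2) = B12 at *
  generalize fderiv ℝ (fderiv ℝ F) q (0, bv 2) (0, bv 2) = B22 at *
  generalize dT F q = a at *
  generalize F q = u at *
  generalize pot p F q = V at *
  generalize outZ F q = Z at *
  generalize angSq F q = S at *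
  generalize dR F q = P at *
  generalize dX F 0 q = b0 at *
  generalize dX F 1 q = b1 at *
  generalize dX F 2 q = b2 at *
  generalize unitv 0 q = w0 at *
  generalize unitv 1 q = w1 at *
  generalize unitv 2 q = w2 at *
  subst hZ hS hP
  linear_combination (γ * f * R * ((-((a + (w0 * b0 + w1 * b1 + w2 * b2) + u * R) ^ 2 / 2) + (b0 ^ 2 + b1 ^ 2 + b2 ^ 2 - (w0 * b0 + w1 * b1 + w2 * b2) ^ 2) / 2 + V) + (a + (w0 * b0 + w1 * b1 + w2 * b2) + u * R) * (w0 * b0 + w1 * b1 + w2 * b2)) + f * ((a + (w0 * b0 + w1 * b1 + w2 * b2) + u * R) * u * R ^ 2 - (a + (w0 * b0 + w1 * b1 + w2 * b2) + u * R) * R * (w0 * b0 + w1 * b1 + w2 * b2) - (-((a + (w0 * b0 + w1 * b1 + w2 * b2) + u * R) ^ 2 / 2) + (b0 ^ 2 + b1 ^ 2 + b2 ^ 2 - (w0 * b0 + w1 * b1 + w2 * b2) ^ 2) / 2 + V) * R - u * R ^ 2 * (w0 * b0 + w1 * b1 + w2 * b2))) * hw - f * (a + (w0 * b0 + w1 *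 b1 + w2 * b2) + u * R) * heq - f * R * hV

end

section

variable {F : ℝ × E3 → ℝ} {p : ℝ}

/-- Components of the unit vector in direction `y`, with value `0` at the origin. -/
def dirv (i : Fin 3) (y : E3) : ℝ := ‖y‖⁻¹ * y i

theorem sum_dirv_sq_le (y : E3) : dirv 0 y ^ 2 + dirv 1 y ^ 2 + dirv 2 y ^ 2 ≤ 1 := by
  rcases eq_or_ne y 0 with rfl | hy
  · simp [dirv]
  · have h := norm_sq_eq y
    have := norm_ne_zero_iff.2 hy
    apply le_of_eq
    simp only [dirv]
    field_simp
    linarith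

theorem abs_dirv_le (i : Fin 3) (y : E3) : |dirv i y| ≤ 1 := by
  have h := sum_dirv_sq_le y
  refine abs_le_of_sq_le_sq ?_ zero_le_one
  rw [← Fin.sum_univ_three (f := fun i => dirv i y ^ 2)] at h
  rw [one_pow]
  exact (Finset.single_le_sum (f := fun i => dirv i y ^ 2) (fun j _ => sq_nonneg _)
    (Finset.mem_univ i)).trans h

theorem measurable_dirv (i : Fin 3) : Measurable (dirv i) :=
  measurable_norm.inv.mul (by fun_prop : Continuous fun y : E3 => y i).measurable

theorem lintegral_cone_flux_le {J0 : ℝ × E3 → ℝ} {J : Fin 3 → ℝ × E3 → ℝ} {U : Set (ℝ × E3)}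
    (hU : IsOpen U) (h0 : ContDiffOn ℝ 1 J0 U) (hJ : ∀ i, ContDiffOn ℝ 1 (J i) U) {T : ℝ} (x : E3)
    (hKU : ∀ t y, 0 ≤ t → ‖y‖ + t ≤ T → (t, x + y) ∈ U)
    (hdiv : ∀ t y, 0 < t → ‖y‖ + t < T →
      fderiv ℝ J0 (t, x + y) (1, 0) + ∑ i, fderiv ℝ (J i) (t, x + y) (0, bv i) ≤ 0)
    {g : E3 → ℝ} (hg0 : ∀ y ∈ Metric.ball (0 : E3) T, 0 ≤ g y)
    (hg : ∀ y ∈ Metric.ball (0 : E3) T, g y ≤ J0 (T - ‖y‖, x + y) +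
      ∑ i, dirv i y * J i (T - ‖y‖, x + y))
    (hpos : ∀ y ∈ Metric.ball (0 : E3) T, 0 ≤ J0 (0, x + y)) :
    ∫⁻ y in Metric.ball (0 : E3) T, ENNReal.ofReal (g y) ≤
      ∫⁻ y in Metric.ball (0 : E3) T, ENNReal.ofReal (J0 (0, x + y)) := by
  have hcone : ∀ Ψ : ℝ × E3 → ℝ, ContDiffOn ℝ 1 Ψ U →
      IntegrableOn (fun y => Ψ (T - ‖y‖, x + y)) (Metric.ball (0 : E3) T) := by
    intro Ψ hΨ
    have hc : ContinuousOn (fun y : E3 => Ψ (T - ‖y‖, x + y)) (Metric.closedBall 0 T) := by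
      refine hΨ.continuousOn.comp (f := fun y : E3 => (T - ‖y‖, x + y)) (by fun_prop) ?_
      intro y hy
      rw [mem_closedBall_zero_iff] at hy
      exact hKU _ _ (by linarith) (by linarith)
    exact (hc.integrableOn_compact (isCompact_closedBall _ _)).mono_set Metric.ball_subset_closedBall
  have hbase : IntegrableOn (fun y => J0 (0, x + y)) (Metric.ball (0 : E3) T) := by
    have hc : ContinuousOn (fun y : E3 => J0 (0, x + y)) (Metric.closedBall 0 T) := by
      refine h0.continuousOn.comp (f := fun y : E3 => ((0 : ℝ), x + y)) (by fun_prop) ?_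
      intro y hy
      rw [mem_closedBall_zero_iff] at hy
      exact hKU _ _ le_rfl (by linarith)
    exact (hc.integrableOn_compact (isCompact_closedBall _ _)).mono_set Metric.ball_subset_closedBall
  have h_integrable : IntegrableOn (fun y => J0 (T - ‖y‖, x + y) + ∑ i, dirv i y * J i (T - ‖y‖, x + y))
      (Metric.ball (0 : E3) T) := by
    refine (hcone J0 h0).add (integrable_finsetSum _ fun i _ => ?_)
    exact (hcone (J i) (hJ i)).bdd_mul (c := 1) (measurable_dirv i).aestronglyMeasurable
      (Filter.Eventually.of_forall fun y => abs_dirv_le i y)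
  calc ∫⁻ y in Metric.ball (0 : E3) T, ENNReal.ofReal (g y)
      ≤ ∫⁻ y in Metric.ball (0 : E3) T, ENNReal.ofReal (J0 (T - ‖y‖, x + y) +
          ∑ i, dirv i y * J i (T - ‖y‖, x + y)) :=
        setLIntegral_mono' measurableSet_ball fun y hy => ENNReal.ofReal_le_ofReal (hg y hy)
    _ = ENNReal.ofReal (∫ y in Metric.ball (0 : E3) T, (J0 (T - ‖y‖, x + y) +
          ∑ i, dirv i y * J i (T - ‖y‖, x + y))) := by
        rw [ofReal_integral_eq_lintegral_ofReal h_integrable]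
        filter_upwards [ae_restrict_mem measurableSet_ball] with y hy
        exact (hg0 y hy).trans (hg y hy)
    _ ≤ ENNReal.ofReal (∫ y in Metric.ball (0 : E3) T, J0 (0, x + y)) :=
        ENNReal.ofReal_le_ofReal (cone_flux_le hU h0 hJ x hKU hdiv)
    _ = _ := by
        rw [ofReal_integral_eq_lintegral_ofReal hbase]
        filter_upwards [ae_restrict_mem measurableSet_ball] with y hy
        exact hpos y hy

/-- Cosine of the angle between `y` and the radial direction at `q`. -/
def cosN (y : E3) (q : ℝ × E3) : ℝ := ∑ i, dirv i y * unitv i q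

theorem two_mul_mul_le_of_sq_le {α β S Z k : ℝ} (hα : 0 ≤ α) (hβ : 0 ≤ β) (hS : 0 ≤ S)
    (hk : k ^ 2 ≤ α * β * S) : Z * k ≤ α * Z ^ 2 / 2 + β * S / 2 := by
  have h1 : (2 * (Z * k)) ^ 2 ≤ (α * Z ^ 2 + β * S) ^ 2 := by
    nlinarith [sq_nonneg (α * Z ^ 2 - β * S), mul_le_mul_of_nonneg_left hk (sq_nonneg Z)]
  have := le_of_abs_le (abs_le_of_sq_le_sq' h1 (by positivity) |> abs_le.2)
  linarith

theorem cauchy_three (c0 c1 c2 d0 d1 d2 : ℝ) : (c0 * d0 + c1 * d1 + c2 * d2) ^ 2 ≤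
    (c0 ^ 2 + c1 ^ 2 + c2 ^ 2) * (d0 ^ 2 + d1 ^ 2 + d2 ^ 2) := by
  nlinarith [sq_nonneg (c0 * d1 - c1 * d0), sq_nonneg (c0 * d2 - c2 * d0),
    sq_nonneg (c1 * d2 - c2 * d1)]

theorem abs_cosN_le (y : E3) {q : ℝ × E3} (hq : q.2 ≠ 0) : |cosN y q| ≤ 1 := by
  have h1 := sum_dirv_sq_le y
  have h2 := sum_unitv_sq hq
  have h3 := cauchy_three (dirv 0 y) (dirv 1 y) (dirv 2 y) (unitv 0 q) (unitv 1 q) (unitv 2 q)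
  rw [h2] at h3
  have : cosN y q ^ 2 ≤ 1 ^ 2 := by
    simp only [cosN, Fin.sum_univ_three]
    linarith
  exact abs_le_of_sq_le_sq' this zero_le_one |> abs_le.2

theorem le_weighted_flux (hp : 1 < p) (γ : ℝ) (y : E3) {q : ℝ × E3} (hq : q.2 ≠ 0) :
    (1 + cosN y q) * ‖q.2‖ ^ γ * pot p F q ≤ wJ0 p γ F q + ∑ i, dirv i y * wJ p γ F i q := by
  have hw := sum_unitv_sq hq
  have hn := sum_dirv_sq_le y
  have hc := abs_le.1 (abs_cosN_le y hq)
  have hS := angSq_nonneg (F := F) hq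
  have hP : dR F q = unitv 0 q * dX F 0 q + unitv 1 q * dX F 1 q + unitv 2 q * dX F 2 q := by
    simp [dR, Fin.sum_univ_three]
  have hSe : angSq F q = dX F 0 q ^ 2 + dX F 1 q ^ 2 + dX F 2 q ^ 2 - dR F q ^ 2 := by
    simp [angSq, Fin.sum_univ_three]
  have hce : cosN y q = dirv 0 y * unitv 0 q + dirv 1 y * unitv 1 q + dirv 2 y * unitv 2 q := by
    simp [cosN, Fin.sum_univ_three]
  have hk := cauchy_three (dirv 0 y - cosN y q * unitv 0 q) (dirv 1 y - cosN y q * unitv 1 q)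
    (dirv 2 y - cosN y q * unitv 2 q) (dX F 0 q - dR F q * unitv 0 q)
    (dX F 1 q - dR F q * unitv 1 q) (dX F 2 q - dR F q * unitv 2 q)
  have e1 : (dX F 0 q - dR F q * unitv 0 q) ^ 2 + (dX F 1 q - dR F q * unitv 1 q) ^ 2 +
      (dX F 2 q - dR F q * unitv 2 q) ^ 2 = angSq F q := by
    rw [hSe]
    linear_combination (dR F q) ^ 2 * hw + 2 * dR F q * hP
  have e2 : (dirv 0 y - cosN y q * unitv 0 q) ^ 2 + (dirv 1 y - cosN y q * unitv 1 q) ^ 2 +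
      (dirv 2 y - cosN y q * unitv 2 q) ^ 2 ≤ (1 - cosN y q) * (1 + cosN y q) := by
    have : (dirv 0 y - cosN y q * unitv 0 q) ^ 2 + (dirv 1 y - cosN y q * unitv 1 q) ^ 2 +
      (dirv 2 y - cosN y q * unitv 2 q) ^ 2 =
      dirv 0 y ^ 2 + dirv 1 y ^ 2 + dirv 2 y ^ 2 - cosN y q ^ 2 := by
      linear_combination (cosN y q) ^ 2 * hw + 2 * cosN y q * hce
    rw [this]
    linarith
  rw [e1] at hk
  have hk' := two_mul_mul_le_of_sq_le (Z := outZ F q) (by linarith) (by linarith) hS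
    (hk.trans (mul_le_mul_of_nonneg_right e2 hS))
  have key : (1 + cosN y q) * pot p F q ≤ (outZ F q ^ 2 / 2 + angSq F q / 2 + pot p F q) +
      ((-(outZ F q ^ 2 / 2) + angSq F q / 2 + pot p F q) * cosN y q -
      outZ F q * ((dirv 0 y - cosN y q * unitv 0 q) * (dX F 0 q - dR F q * unitv 0 q) +
        (dirv 1 y - cosN y q * unitv 1 q) * (dX F 1 q - dR F q * unitv 1 q) +
        (dirv 2 y - cosN y q * unitv 2 q) * (dX F 2 q - dR F q * unitv 2 q))) := by
    nlinarith
  have hr : 0 ≤ ‖q.2‖ ^ γ := rpow_nonneg (norm_nonneg _) _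
  have := mul_le_mul_of_nonneg_left key hr
  rw [show (1 + cosN y q) * ‖q.2‖ ^ γ * pot p F q = ‖q.2‖ ^ γ * ((1 + cosN y q) * pot p F q) by ring]
  refine this.trans_eq ?_
  simp only [wJ0, wJ, Fin.sum_univ_three]
  generalize ‖q.2‖ ^ γ = f at *
  linear_combination (f * (-(outZ F q ^ 2 / 2) + angSq F q / 2 + pot p F q)) * hce -
    f * outZ F q * cosN y q * hP - f * outZ F q * cosN y q * dR F q * hw

theorem wJ0_nonneg (hp : 1 < p) (γ : ℝ) {q : ℝ × E3} (hq : q.2 ≠ 0) : 0 ≤ wJ0 p γ F q := by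
  have := angSq_nonneg (F := F) hq
  have := pot_nonneg (F := F) hp q
  unfold wJ0
  positivity

theorem wJ0_le (hp : 1 < p) (γ : ℝ) {q : ℝ × E3} (hq : q.2 ≠ 0) :
    wJ0 p γ F q ≤ ‖q.2‖ ^ γ * (2 * (dT F q ^ 2 + ∑ i, dX F i q ^ 2) + pot p F q +
      2 * (F q * ‖q.2‖⁻¹) ^ 2) := by
  have hS := angSq_nonneg (F := F) hq
  refine mul_le_mul_of_nonneg_left ?_ (rpow_nonneg (norm_nonneg _) _)
  unfold outZ
  unfold angSq at hS ⊢
  nlinarith [sq_nonneg (dT F q - dR F q), sq_nonneg (dT F q - F q * ‖q.2‖⁻¹),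
    sq_nonneg (dR F q - F q * ‖q.2‖⁻¹), sq_nonneg (dT F q), sq_nonneg (dR F q)]

/-- Weighted flux of the potential energy through a backward light cone in the exterior region. -/
theorem lintegral_weighted_pot_le {γ : ℝ} (hp : 1 < p) (hγ0 : 0 ≤ γ) (hγ2 : γ ≤ 2) (hγp : γ ≤ p - 1)
    (hF : ContDiff ℝ 2 F) (hs : SolvesNLW p F) {T : ℝ} {x : E3} (hx : T < ‖x‖) :
    ∫⁻ y in Metric.ball (0 : E3) T, ENNReal.ofReal ((1 + cosN y (T - ‖y‖, x + y)) *
      ‖x + y‖ ^ γ * pot p F (T - ‖y‖, x + y)) ≤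
      ∫⁻ y in Metric.ball (0 : E3) T, ENNReal.ofReal (wJ0 p γ F (0, x + y)) := by
  have hne : ∀ y : E3, ‖y‖ ≤ T → x + y ≠ 0 := by
    intro y hy h0
    have : x = -y := eq_neg_of_add_eq_zero_left h0
    rw [this, norm_neg] at hx
    linarith
  refine lintegral_cone_flux_le isOpen_snd_ne_zero (contDiffOn_wJ0 hp γ hF)
    (contDiffOn_wJ hp γ hF) x (fun t y ht hy => hne y (by linarith)) ?_ ?_ ?_ ?_
  · intro t y ht hy
    have hq : ((t, x + y) : ℝ × E3).2 ≠ 0 := hne y (by linarith)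
    rw [div_wJ_eq hp γ hF hs ht.le hq, neg_nonpos]
    have h1 := angSq_nonneg (F := F) hq
    have h2 := pot_nonneg (F := F) hp (t, x + y)
    have h3 : 0 ≤ 2 - γ := by linarith
    have h4 : 0 ≤ p - 1 - γ := by linarith
    positivity
  · intro y hy
    rw [mem_ball_zero_iff] at hy
    have h := abs_le.1 (abs_cosN_le y (q := (T - ‖y‖, x + y)) (hne y hy.le))
    have h1 : 0 ≤ 1 + cosN y (T - ‖y‖, x + y) := by linarith
    exact mul_nonneg (mul_nonneg h1 (rpow_nonneg (norm_nonneg _) _)) (pot_nonneg hp _)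
  · intro y hy
    rw [mem_ball_zero_iff] at hy
    exact le_weighted_flux hp γ y (q := (T - ‖y‖, x + y)) (hne y hy.le)
  · intro y hy
    rw [mem_ball_zero_iff] at hy
    exact wJ0_nonneg hp γ (hne y hy.le)

/-- Flux of the potential energy through a backward light cone. -/
theorem lintegral_pot_le (hp : 1 < p) (hF : ContDiff ℝ 2 F) (hs : SolvesNLW p F) {T : ℝ} (x : E3) :
    ∫⁻ y in Metric.ball (0 : E3) T, ENNReal.ofReal (pot p F (T - ‖y‖, x + y)) ≤
      ∫⁻ y in Metric.ball (0 : E3) T, ENNReal.ofReal (dT F (0, x + y) ^ 2 / 2 +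
        (∑ i, dX F i (0, x + y) ^ 2) / 2 + pot p F (0, x + y)) := by
  have hT := contDiff_dT hF
  have hX := contDiff_dX hF
  have hV := contDiff_pot hp hF
  have c0 : ContDiff ℝ 1 (fun q => dT F q ^ 2 / 2 + (∑ i, dX F i q ^ 2) / 2 + pot p F q) := by
    fun_prop
  have cJ : ∀ i, ContDiff ℝ 1 (fun q => -(dT F q * dX F i q)) := fun i => by
    have := hX i
    fun_prop
  refine lintegral_cone_flux_le
    (J0 := fun q => dT F q ^ 2 / 2 + (∑ i, dX F i q ^ 2) / 2 + pot p F q)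
    (J := fun i q => -(dT F q * dX F i q)) isOpen_univ c0.contDiffOn
    (fun i => (cJ i).contDiffOn) x (fun _ _ _ _ => Set.mem_univ _) (fun t y ht hy =>
      energy_div_le hp hF hs ht.le) (fun y _ => pot_nonneg hp _) ?_ ?_
  · intro y _
    generalize ((T - ‖y‖, x + y) : ℝ × E3) = q
    have h1 := cauchy_three (dirv 0 y) (dirv 1 y) (dirv 2 y) (dX F 0 q) (dX F 1 q) (dX F 2 q)
    have h2 := h1.trans (mul_le_mul_of_nonneg_right (sum_dirv_sq_le y) (by positivity))
    have := two_mul_mul_le_of_sq_le (Z := dT F q) (α := 1) (β := 1)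
      (S := dX F 0 q ^ 2 + dX F 1 q ^ 2 + dX F 2 q ^ 2) (by norm_num) (by norm_num)
      (by positivity) (h2.trans_eq (by ring))
    simp only [Fin.sum_univ_three]
    linarith
  · intro y _
    have := pot_nonneg (F := F) hp (0, x + y)
    positivity

end

theorem lintegral_mul_sq_le {α : Type*} [MeasurableSpace α] {μ : Measure α} {f g : α → ℝ≥0∞}
    (hf : AEMeasurable f μ) (hg : AEMeasurable g μ) :
    (∫⁻ x, f x * g x ∂μ) ^ 2 ≤ (∫⁻ x, f x ^ 2 ∂μ) * ∫⁻ x, g x ^ 2 ∂μ := by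
  have h := ENNReal.lintegral_mul_le_Lp_mul_Lq μ Real.HolderConjugate.two_two hf hg
  have h2 := pow_le_pow_left₀ (zero_le) h 2
  refine h2.trans_eq ?_
  rw [mul_pow]
  simp only [← ENNReal.rpow_natCast, ← ENNReal.rpow_mul]
  norm_num

theorem ofReal_abs_sub_le_lintegral {g : ℝ → ℝ} (hg : ContDiff ℝ 1 g) {a b : ℝ} (hab : a ≤ b) :
    ENNReal.ofReal |g b - g a| ≤ ∫⁻ s in Set.Ioc a b, ENNReal.ofReal |deriv g s| := by
  have hc : Continuous (deriv g) := hg.continuous_deriv le_rfl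
  rw [← intervalIntegral.integral_deriv_eq_sub
    (fun x _ => (hg.differentiable one_ne_zero) x) (hc.intervalIntegrable a b)]
  have h1 := intervalIntegral.abs_integral_le_integral_abs (f := deriv g) (μ := volume) hab
  refine (ENNReal.ofReal_le_ofReal h1).trans_eq ?_
  rw [intervalIntegral.integral_of_le hab, ofReal_integral_eq_lintegral_ofReal]
  · exact hc.abs.integrableOn_Ioc
  · exact Filter.Eventually.of_forall fun _ => abs_nonneg _

theorem lintegral_polar_norm (f : E3 → ℝ≥0∞) (hf : Measurable f) {S : Set ℝ}
    (hS : MeasurableSet S) (hS0 : S ⊆ Set.Ioi 0) :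
    ∫⁻ x in {x : E3 | ‖x‖ ∈ S}, f x =
      ∫⁻ ω, (∫⁻ s in S, ENNReal.ofReal (s ^ 2) * f (s • (ω : E3))) ∂sphereMeasure := by
  have hS' : MeasurableSet {x : E3 | ‖x‖ ∈ S} := measurable_norm hS
  rw [← lintegral_indicator hS', lintegral_polar _ (hf.indicator hS')]
  refine lintegral_congr fun ω => ?_
  have e : (volume : Measure ℝ).restrict S = (volume.restrict (Set.Ioi 0)).restrict S := by
    rw [Measure.restrict_restrict hS, Set.inter_eq_self_of_subset_left hS0]
  rw [e, ← lintegral_indicator hS]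
  refine setLIntegral_congr_fun measurableSet_Ioi fun s hs => ?_
  have : ‖s • (ω : E3)‖ = s := by
    rw [norm_smul, norm_eq_of_mem_sphere, mul_one, norm_of_nonneg (le_of_lt hs)]
  by_cases h : s ∈ S
  · simp [Set.indicator, this, h]
  · simp [Set.indicator, this, h]

theorem lintegral_polar_radial_norm (f : E3 → ℝ≥0∞) (hf : Measurable f) {S : Set ℝ}
    (hS : MeasurableSet S) (hS0 : S ⊆ Set.Ioi 0) :
    ∫⁻ x in {x : E3 | ‖x‖ ∈ S}, f x =
      ∫⁻ s in S, ENNReal.ofReal (s ^ 2) *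
        ∫⁻ ω : Metric.sphere (0 : E3) 1, f (s • (ω : E3)) ∂sphereMeasure := by
  have hS' : MeasurableSet {x : E3 | ‖x‖ ∈ S} := measurable_norm hS
  have e : (volume : Measure ℝ).restrict S = (volume.restrict (Set.Ioi 0)).restrict S := by
    rw [Measure.restrict_restrict hS, Set.inter_eq_self_of_subset_left hS0]
  rw [e, ← lintegral_indicator hS', lintegral_polar_radial _ (hf.indicator hS'),
    ← lintegral_indicator hS]
  refine setLIntegral_congr_fun measurableSet_Ioi fun s hs => ?_
  have : ∀ ω : Metric.sphere (0 : E3) 1, ‖s • (ω : E3)‖ = s := fun ω => by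
    rw [norm_smul, norm_eq_of_mem_sphere, mul_one, norm_of_nonneg (le_of_lt hs)]
  by_cases h : s ∈ S
  · simp [Set.indicator, this, h]
  · simp [Set.indicator, this, h]

theorem not_lintegral_ne_top_of_le {γ p r δ : ℝ} (hγ : 0 ≤ γ + 2) (hp : 0 < p) (hr : 1 ≤ r)
    (hδ : 0 < δ) {g : ℝ → ℝ} (h : ∀ s, r < s → δ ≤ |g s|) :
    ∫⁻ s in Set.Ioi (1 : ℝ), ENNReal.ofReal (s ^ (γ + 2) * |g s| ^ p) = ⊤ := by
  rw [eq_top_iff]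
  calc (⊤ : ℝ≥0∞) = ∫⁻ s in Set.Ioi r, ENNReal.ofReal (δ ^ p) := by
        rw [setLIntegral_const, volume_Ioi, ENNReal.mul_top]
        simpa using rpow_pos_of_pos hδ p
    _ ≤ ∫⁻ s in Set.Ioi r, ENNReal.ofReal (s ^ (γ + 2) * |g s| ^ p) := by
        refine setLIntegral_mono' measurableSet_Ioi fun s hs => ENNReal.ofReal_le_ofReal ?_
        have hs1 : (1 : ℝ) ≤ s := hr.trans (le_of_lt hs)
        have h1 : 1 ≤ s ^ (γ + 2) := one_le_rpow hs1 hγ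
        have h2 : δ ^ p ≤ |g s| ^ p := rpow_le_rpow hδ.le (h s hs) hp.le
        nlinarith [rpow_nonneg hδ.le p]
    _ ≤ _ := lintegral_mono_set (Set.Ioi_subset_Ioi hr)

theorem lintegral_Ioi_sq_inv_le {r : ℝ} (hr : 0 < r) :
    ∫⁻ s in Set.Ioi r, ENNReal.ofReal s⁻¹ ^ 2 = ENNReal.ofReal r⁻¹ := by
  have h := integrableOn_Ioi_rpow_of_lt (a := -2) (by norm_num) hr
  have h2 := integral_Ioi_rpow_of_lt (a := -2) (by norm_num) hr
  have e : r⁻¹ = ∫ s in Set.Ioi r, s ^ (-2 : ℝ) := by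
    rw [h2]
    norm_num
    rw [rpow_neg_one]
  rw [e, ofReal_integral_eq_lintegral_ofReal h]
  · refine setLIntegral_congr_fun measurableSet_Ioi fun s hs => ?_
    have hs0 : 0 < s := hr.trans hs
    rw [← ENNReal.ofReal_pow (inv_nonneg.2 hs0.le), rpow_neg hs0.le, rpow_two, inv_pow]
  · filter_upwards [ae_restrict_mem measurableSet_Ioi] with s hs
    exact rpow_nonneg (hr.trans hs).le _

/-- Pointwise decay along a ray from a weighted gradient bound. -/
theorem ofReal_sq_le_of_ray {γ p : ℝ} (hγ : 0 ≤ γ + 2) (hp : 0 < p) {g : ℝ → ℝ}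
    (hg : ContDiff ℝ 1 g)
    (hfin : ∫⁻ s in Set.Ioi (1 : ℝ), ENNReal.ofReal (s ^ (γ + 2) * |g s| ^ p) ≠ ⊤) {r : ℝ}
    (hr : 1 ≤ r) :
    ENNReal.ofReal (g r ^ 2) ≤
      ENNReal.ofReal r⁻¹ * ∫⁻ s in Set.Ioi r, ENNReal.ofReal (s ^ 2 * deriv g s ^ 2) := by
  have hr0 : 0 < r := by linarith
  have hc : Continuous (deriv g) := hg.continuous_deriv le_rfl
  set A := ∫⁻ s in Set.Ioi r, ENNReal.ofReal (s ^ 2 * deriv g s ^ 2) with hA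
  by_contra! hlt
  have htop : ENNReal.ofReal r⁻¹ * A ≠ ⊤ := hlt.ne_top
  set B := (ENNReal.ofReal r⁻¹ * A).toReal with hB
  have hBe : ENNReal.ofReal r⁻¹ * A = ENNReal.ofReal B := (ENNReal.ofReal_toReal htop).symm
  have hB0 : 0 ≤ B := ENNReal.toReal_nonneg
  have hlt' : B < g r ^ 2 := by
    rw [hBe] at hlt
    exact (ENNReal.ofReal_lt_ofReal_iff_of_nonneg hB0).1 hlt
  have hlt2 : √B < |g r| := by
    rw [← sqrt_sq_eq_abs]
    exact sqrt_lt_sqrt hB0 hlt'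
  refine hfin (not_lintegral_ne_top_of_le hγ hp hr (sub_pos.2 hlt2) fun R hR => ?_)
  have h1 := ofReal_abs_sub_le_lintegral hg hR.le
  have h2 : (∫⁻ s in Set.Ioc r R, ENNReal.ofReal |deriv g s|) ^ 2 ≤ ENNReal.ofReal B := by
    calc (∫⁻ s in Set.Ioc r R, ENNReal.ofReal |deriv g s|) ^ 2
        ≤ (∫⁻ s in Set.Ioi r, ENNReal.ofReal |deriv g s|) ^ 2 := by
          gcongr
          exact Set.Ioc_subset_Ioi_self
      _ = (∫⁻ s in Set.Ioi r, ENNReal.ofReal s⁻¹ * ENNReal.ofReal (s * |deriv g s|)) ^ 2 := by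
          congr 1
          refine setLIntegral_congr_fun measurableSet_Ioi fun s hs => ?_
          have hs0 : 0 < s := hr0.trans hs
          rw [← ENNReal.ofReal_mul (inv_nonneg.2 hs0.le), inv_mul_cancel_left₀ hs0.ne']
      _ ≤ (∫⁻ s in Set.Ioi r, ENNReal.ofReal s⁻¹ ^ 2) *
            ∫⁻ s in Set.Ioi r, ENNReal.ofReal (s * |deriv g s|) ^ 2 := by
          refine lintegral_mul_sq_le ?_ ?_
          · exact measurable_inv.ennreal_ofReal.aemeasurable
          · exact (continuous_id.mul hc.abs).measurable.ennreal_ofReal.aemeasurable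
      _ = ENNReal.ofReal B := by
          rw [lintegral_Ioi_sq_inv_le hr0, ← hBe]
          congr 1
          refine setLIntegral_congr_fun measurableSet_Ioi fun s hs => ?_
          have hs0 : 0 < s := hr0.trans hs
          rw [← ENNReal.ofReal_pow (by positivity), mul_pow, sq_abs]
  have h3 : |g R - g r| ^ 2 ≤ B := by
    have := (pow_le_pow_left₀ (zero_le) h1 2).trans h2
    rw [← ENNReal.ofReal_pow (abs_nonneg _)] at this
    exact (ENNReal.ofReal_le_ofReal_iff hB0).1 this
  have h4 : |g R - g r| ≤ √B := le_sqrt_of_sq_le h3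
  have h5 := abs_sub_abs_le_abs_sub (g r) (g R)
  rw [abs_sub_comm] at h5
  linarith

/-- Hardy's inequality on a ray. -/
theorem lintegral_ray_hardy {γ p : ℝ} (hγ : 1 ≤ γ) (hp : 0 < p) {g : ℝ → ℝ}
    (hg : ContDiff ℝ 1 g)
    (hfin : ∫⁻ s in Set.Ioi (1 : ℝ), ENNReal.ofReal (s ^ (γ + 2) * |g s| ^ p) ≠ ⊤) :
    ∫⁻ s in Set.Ioi (1 : ℝ), ENNReal.ofReal (s ^ γ * g s ^ 2) ≤
      ∫⁻ s in Set.Ioi (1 : ℝ), ENNReal.ofReal (s ^ (γ + 2) * deriv g s ^ 2) := by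
  have hc : Continuous (deriv g) := hg.continuous_deriv le_rfl
  have hm : Measurable (Function.uncurry fun r s : ℝ => (Set.Ioi r).indicator
      (fun s => ENNReal.ofReal (r ^ (γ - 1)) * ENNReal.ofReal (s ^ 2 * deriv g s ^ 2)) s) := by
    have : (Function.uncurry fun r s : ℝ => (Set.Ioi r).indicator
        (fun s => ENNReal.ofReal (r ^ (γ - 1)) * ENNReal.ofReal (s ^ 2 * deriv g s ^ 2)) s) =
        {q : ℝ × ℝ | q.1 < q.2}.indicator (fun q => ENNReal.ofReal (q.1 ^ (γ - 1)) *
          ENNReal.ofReal (q.2 ^ 2 * deriv g q.2 ^ 2)) := by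
      funext ⟨r, s⟩
      simp [Set.indicator, Function.uncurry]
    rw [this]
    refine Measurable.indicator ?_ (measurableSet_lt measurable_fst measurable_snd)
    have h1 : Measurable (deriv g) := hc.measurable
    fun_prop
  calc ∫⁻ r in Set.Ioi (1 : ℝ), ENNReal.ofReal (r ^ γ * g r ^ 2)
      ≤ ∫⁻ r in Set.Ioi (1 : ℝ), ∫⁻ s in Set.Ioi (1 : ℝ), (Set.Ioi r).indicator
          (fun s => ENNReal.ofReal (r ^ (γ - 1)) * ENNReal.ofReal (s ^ 2 * deriv g s ^ 2)) s := by
        refine setLIntegral_mono' measurableSet_Ioi fun r hr => ?_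
        have hr' : 1 < r := hr
        have hr0 : 0 < r := by linarith
        have h := ofReal_sq_le_of_ray (by linarith) hp hg hfin hr'.le
        rw [lintegral_indicator measurableSet_Ioi, Measure.restrict_restrict measurableSet_Ioi,
          Set.inter_eq_self_of_subset_left (Set.Ioi_subset_Ioi hr'.le),
          lintegral_const_mul _ (by have := hc.measurable; fun_prop),
          ENNReal.ofReal_mul (rpow_nonneg hr0.le _)]
        refine (mul_le_mul_right h _).trans_eq ?_
        rw [← mul_assoc, ← ENNReal.ofReal_mul (rpow_nonneg hr0.le _), rpow_sub_one hr0.ne',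
          div_eq_mul_inv]
    _ = ∫⁻ s in Set.Ioi (1 : ℝ), ∫⁻ r in Set.Ioi (1 : ℝ), (Set.Ioi r).indicator
          (fun s => ENNReal.ofReal (r ^ (γ - 1)) * ENNReal.ofReal (s ^ 2 * deriv g s ^ 2)) s :=
        lintegral_lintegral_swap hm.aemeasurable
    _ ≤ _ := by
        refine setLIntegral_mono' measurableSet_Ioi fun s hs => ?_
        have hs' : 1 < s := hs
        have hs0 : 0 < s := by linarith
        calc ∫⁻ r in Set.Ioi (1 : ℝ), (Set.Ioi r).indicator
              (fun s => ENNReal.ofReal (r ^ (γ - 1)) * ENNReal.ofReal (s ^ 2 * deriv g s ^ 2)) s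
            ≤ ∫⁻ r in Set.Ioi (1 : ℝ), (Set.Ioc 0 s).indicator (fun _ =>
                ENNReal.ofReal (s ^ (γ - 1)) * ENNReal.ofReal (s ^ 2 * deriv g s ^ 2)) r := by
              refine setLIntegral_mono' measurableSet_Ioi fun r hr => ?_
              have hr0 : 0 < r := lt_trans one_pos hr
              by_cases hrs : r < s
              · simp only [Set.indicator, Set.mem_Ioi, hrs, Set.mem_Ioc, hr0, hrs.le, and_self,
                  if_true]
                gcongr
              · simp [Set.indicator, hrs]
          _ ≤ ∫⁻ r, (Set.Ioc 0 s).indicator (fun _ =>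
                ENNReal.ofReal (s ^ (γ - 1)) * ENNReal.ofReal (s ^ 2 * deriv g s ^ 2)) r :=
              setLIntegral_le_lintegral _ _
          _ = ENNReal.ofReal (s ^ (γ + 2) * deriv g s ^ 2) := by
              rw [lintegral_indicator measurableSet_Ioc, setLIntegral_const, volume_Ioc, sub_zero,
                ← ENNReal.ofReal_mul (rpow_nonneg hs0.le _), ← ENNReal.ofReal_mul (by positivity)]
              congr 1
              rw [rpow_sub_one hs0.ne', rpow_add hs0, rpow_two]
              field_simp

theorem hasDerivAt_ray {f : E3 → ℝ} (hf : ContDiff ℝ 1 f) (x v : E3) (s : ℝ) :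
    HasDerivAt (fun s : ℝ => f (x + s • v)) (fderiv ℝ f (x + s • v) v) s := by
  have h1 : HasDerivAt (fun s : ℝ => x + s • v) v s := by
    simpa using ((hasDerivAt_id s).smul_const v).const_add x
  exact ((hf.differentiable one_ne_zero) _).hasFDerivAt.comp_hasDerivAt s h1

theorem contDiff_ray {f : E3 → ℝ} (hf : ContDiff ℝ 1 f) (x v : E3) :
    ContDiff ℝ 1 (fun s : ℝ => f (x + s • v)) :=
  hf.comp (by fun_prop)

/-- Weighted Hardy inequality in the exterior of the unit ball. -/
theorem lintegral_hardy {γ p : ℝ} (hγ : 1 ≤ γ) (hp : 0 < p) {f : E3 → ℝ} (hf : ContDiff ℝ 1 f)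
    (hfin : ∫⁻ x in {x : E3 | ‖x‖ ∈ Set.Ioi 1}, ENNReal.ofReal (‖x‖ ^ γ * |f x| ^ p) ≠ ⊤) :
    ∫⁻ x in {x : E3 | ‖x‖ ∈ Set.Ioi 1}, ENNReal.ofReal (‖x‖ ^ (γ - 2) * f x ^ 2) ≤
      ∫⁻ x in {x : E3 | ‖x‖ ∈ Set.Ioi 1}, ENNReal.ofReal (‖x‖ ^ γ * ‖fderiv ℝ f x‖ ^ 2) := by
  have hcf := hf.continuous.measurable
  have hcd := (hf.continuous_fderiv one_ne_zero).measurable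
  have h01 : Set.Ioi (1 : ℝ) ⊆ Set.Ioi 0 := Set.Ioi_subset_Ioi zero_le_one
  have hnorm : ∀ (ω : Metric.sphere (0 : E3) 1) (s : ℝ), s ∈ Set.Ioi (1 : ℝ) →
      ‖s • (ω : E3)‖ = s := fun ω s hs => by
    rw [norm_smul, norm_eq_of_mem_sphere, mul_one, norm_of_nonneg (le_of_lt (h01 hs))]
  have hm : Measurable fun x : E3 => ENNReal.ofReal (‖x‖ ^ γ * |f x| ^ p) := by fun_prop
  rw [lintegral_polar_norm _ hm measurableSet_Ioi h01] at hfin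
  rw [lintegral_polar_norm _ (by fun_prop) measurableSet_Ioi h01,
    lintegral_polar_norm _ (by fun_prop) measurableSet_Ioi h01]
  have hae := ae_lt_top (by
    have : Measurable fun q : Metric.sphere (0 : E3) 1 × ℝ => ENNReal.ofReal (q.2 ^ 2) *
      ENNReal.ofReal (‖q.2 • (q.1 : E3)‖ ^ γ * |f (q.2 • (q.1 : E3))| ^ p) := by fun_prop
    exact this.lintegral_prod_right') hfin
  refine lintegral_mono_ae ?_
  filter_upwards [hae] with ω hω
  have hg := contDiff_ray hf 0 (ω : E3)
  have hd := hasDerivAt_ray hf 0 (ω : E3)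
  simp only [zero_add] at hg hd
  have h := lintegral_ray_hardy hγ hp hg ?_
  · calc _ = ∫⁻ s in Set.Ioi (1 : ℝ), ENNReal.ofReal (s ^ γ * f (s • (ω : E3)) ^ 2) := by
          refine setLIntegral_congr_fun measurableSet_Ioi fun s hs => ?_
          have hs0 : 0 < s := h01 hs
          beta_reduce
          have e : s ^ 2 * s ^ (γ - 2) = s ^ γ := by
            rw [rpow_sub hs0, rpow_two]
            field_simp
          rw [hnorm ω s hs, ← ENNReal.ofReal_mul (sq_nonneg _), ← mul_assoc, e]
      _ ≤ _ := h
      _ ≤ _ := by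
          refine setLIntegral_mono' measurableSet_Ioi fun s hs => ?_
          have hs0 : 0 < s := h01 hs
          have e : s ^ 2 * s ^ γ = s ^ (γ + 2) := by rw [rpow_add hs0, rpow_two, mul_comm]
          rw [hnorm ω s hs, ← ENNReal.ofReal_mul (sq_nonneg _), ← mul_assoc, e, (hd s).deriv]
          refine ENNReal.ofReal_le_ofReal (mul_le_mul_of_nonneg_left ?_ (rpow_nonneg hs0.le _))
          have := (fderiv ℝ f (s • (ω : E3))).le_opNorm ω
          rw [norm_eq_of_mem_sphere, mul_one] at this
          rw [← sq_abs]
          exact pow_le_pow_left₀ (abs_nonneg _) this 2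
  · refine ne_of_eq_of_ne ?_ hω.ne
    refine setLIntegral_congr_fun measurableSet_Ioi fun s hs => ?_
    have hs0 : 0 < s := h01 hs
    beta_reduce
    have e : s ^ 2 * s ^ γ = s ^ (γ + 2) := by rw [rpow_add hs0, rpow_two, mul_comm]
    rw [hnorm ω s hs, ← ENNReal.ofReal_mul (sq_nonneg _), ← mul_assoc, e]

section

theorem sum_sq_apply_bv_le (L : E3 →L[ℝ] ℝ) : ∑ i, L (bv i) ^ 2 ≤ ‖L‖ ^ 2 := by
  set v : E3 := WithLp.toLp 2 fun i => L (bv i) with hv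
  have hvi : ∀ i, v i = L (bv i) := fun i => rfl
  have h1 : L v = ‖v‖ ^ 2 := by
    rw [fderiv_apply_eq_sum, norm_sq_eq, Fin.sum_univ_three]
    simp only [hvi]
    ring_nf
  have h2 : ∑ i, L (bv i) ^ 2 = ‖v‖ ^ 2 := by
    rw [norm_sq_eq, Fin.sum_univ_three]
  rw [h2]
  have h3 : ‖v‖ ^ 2 ≤ ‖L‖ * ‖v‖ := h1 ▸ (le_abs_self _).trans (L.le_opNorm v)
  rcases eq_or_lt_of_le (norm_nonneg v) with h | h
  · rw [← h]
    simp [sq_nonneg]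
  · have : ‖v‖ ≤ ‖L‖ := by nlinarith
    gcongr

variable {p γ : ℝ} {φ : ℝ → E3 → ℝ}

theorem wEnergy_mono : wEnergy p 0 γ φ ≤ wEnergy p 1 γ φ := by
  unfold wEnergy
  gcongr
  simp

theorem setLIntegral_gradient_le_wEnergy (hγ : 0 ≤ γ) (S : Set E3) :
    ∫⁻ x in S, ENNReal.ofReal (‖x‖ ^ γ * (‖fderiv ℝ (φ 0) x‖ ^ 2 + dt1 φ 0 x ^ 2)) ≤
      wEnergy p 0 γ φ := by
  unfold wEnergy
  refine le_trans ((setLIntegral_le_lintegral _ _).trans ?_) le_self_add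
  rw [zero_add, Finset.sum_range_one]
  refine lintegral_mono fun x => ENNReal.ofReal_le_ofReal ?_
  rw [← norm_iteratedFDeriv_fderiv, norm_iteratedFDeriv_zero, norm_iteratedFDeriv_zero, norm_eq_abs,
    sq_abs]
  simp only [Nat.cast_zero, mul_zero, add_zero]
  gcongr
  linarith [norm_nonneg x]

theorem setLIntegral_hessian_le_wEnergy (hγ : 0 ≤ γ) (S : Set E3) :
    ∫⁻ x in S, ENNReal.ofReal (‖x‖ ^ (γ + 2) * (‖fderiv ℝ (fderiv ℝ (φ 0)) x‖ ^ 2 +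
      ‖fderiv ℝ (dt1 φ 0) x‖ ^ 2)) ≤ wEnergy p 1 γ φ := by
  unfold wEnergy
  refine le_trans ((setLIntegral_le_lintegral _ _).trans ?_) le_self_add
  rw [Finset.sum_range_succ]
  refine le_trans ?_ le_add_self
  refine lintegral_mono fun x => ENNReal.ofReal_le_ofReal ?_
  have h1 : ‖iteratedFDeriv ℝ (1 + 1) (φ 0) x‖ = ‖fderiv ℝ (fderiv ℝ (φ 0)) x‖ := by
    rw [← norm_iteratedFDeriv_fderiv, ← zero_add 1, ← norm_iteratedFDeriv_fderiv,
      norm_iteratedFDeriv_zero]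
  have h2 : ‖iteratedFDeriv ℝ 1 (dt1 φ 0) x‖ = ‖fderiv ℝ (dt1 φ 0) x‖ := by
    rw [← zero_add 1, ← norm_iteratedFDeriv_fderiv, norm_iteratedFDeriv_zero]
  rw [h1, h2]
  simp only [Nat.cast_one, mul_one]
  gcongr
  linarith [norm_nonneg x]

theorem setLIntegral_potential_le_wEnergy (hγ : 0 ≤ γ) (S : Set E3) :
    ∫⁻ x in S, ENNReal.ofReal (‖x‖ ^ γ * |φ 0 x| ^ (p + 1)) ≤ wEnergy p 0 γ φ := by
  unfold wEnergy
  refine le_trans ((setLIntegral_le_lintegral _ _).trans ?_) le_add_self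
  refine lintegral_mono fun x => ENNReal.ofReal_le_ofReal ?_
  gcongr
  linarith [norm_nonneg x]

/-- The exterior of the unit ball. -/
def extDom : Set E3 := {x : E3 | ‖x‖ ∈ Set.Ioi (1 : ℝ)}

theorem measurableSet_extDom : MeasurableSet extDom := measurable_norm measurableSet_Ioi

theorem setLIntegral_sq_le_wEnergy (hγ : 1 ≤ γ) (hp : 1 < p) (hφ : ContDiff ℝ 1 (φ 0))
    (hfin : wEnergy p 0 γ φ ≠ ⊤) :
    ∫⁻ x in extDom, ENNReal.ofReal (‖x‖ ^ (γ - 2) * φ 0 x ^ 2) ≤ wEnergy p 0 γ φ := by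
  refine (lintegral_hardy hγ (p := p + 1) (by linarith) hφ (ne_top_of_le_ne_top hfin
    (setLIntegral_potential_le_wEnergy (by linarith) _))).trans
    (le_trans ?_ (setLIntegral_gradient_le_wEnergy (p := p) (by linarith) extDom))
  refine lintegral_mono fun x => ENNReal.ofReal_le_ofReal ?_
  gcongr
  linarith [sq_nonneg (dt1 φ 0 x)]

theorem setLIntegral_ball_le_extDom {T : ℝ} {x : E3} (hx : T + 1 ≤ ‖x‖) (h : E3 → ℝ≥0∞) :
    ∫⁻ y in Metric.ball (0 : E3) T, h (x + y) ≤ ∫⁻ z in extDom, h z := by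
  rw [← lintegral_indicator measurableSet_ball, ← lintegral_indicator measurableSet_extDom,
    ← lintegral_add_left_eq_self (extDom.indicator h) x]
  refine lintegral_mono fun y => ?_
  by_cases hy : y ∈ Metric.ball (0 : E3) T
  · have h1 : x + y ∈ extDom := by
      rw [mem_ball_zero_iff] at hy
      have := norm_sub_norm_le x (-y)
      rw [norm_neg, sub_neg_eq_add] at this
      change 1 < ‖x + y‖
      linarith
    simp [Set.indicator, hy, h1]
  · simp [Set.indicator, hy]

/-- The weight appearing in the flux through a backward cone. -/
def coneWeight (γ : ℝ) (y : E3) (q : ℝ × E3) : ℝ := (1 + cosN y q) * ‖q.2‖ ^ γ + 1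

theorem lintegral_coneWeight_le (hp : 1 < p) (hγ1 : 1 ≤ γ) (hγ2 : γ ≤ 2) (hγp : γ ≤ p - 1)
    (hφ : IsNLWSolution p φ) (hfin : wEnergy p 0 γ φ ≠ ⊤) {T : ℝ} {x : E3}
    (hx : T + 2 ≤ ‖x‖) :
    ∫⁻ y in Metric.ball (0 : E3) T, ENNReal.ofReal (coneWeight γ y (T - ‖y‖, x + y) *
      |φ (T - ‖y‖) (x + y)| ^ (p + 1)) ≤ ENNReal.ofReal (7 * (p + 1)) * wEnergy p 0 γ φ := by
  set F : ℝ × E3 → ℝ := fun q => φ q.1 q.2 with hFdef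
  have hF : ContDiff ℝ 2 F := hφ.1.of_le (WithTop.coe_le_coe.2 (le_top : (2 : ℕ∞) ≤ ⊤))
  have hs : SolvesNLW p F := solvesNLW_of_isNLWSolution hφ
  have hp1 : 0 < p + 1 := by linarith
  set E := wEnergy p 0 γ φ with hE
  have hφ0 : ContDiff ℝ 1 (φ 0) :=
    (hF.comp (g := F) (f := fun x : E3 => ((0 : ℝ), x)) (by fun_prop)).of_le one_le_two
  have hX : ∀ z, ∑ i, dX F i (0, z) ^ 2 ≤ ‖fderiv ℝ (φ 0) z‖ ^ 2 := fun z => by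
    have e : ∀ i, dX F i (0, z) = fderiv ℝ (φ 0) z (bv i) := fun i => by
      have h1 : HasFDerivAt (fun x : E3 => F ((0 : ℝ), x)) _ z :=
        ((hF.differentiable two_ne_zero) (0, z)).hasFDerivAt.comp z
          (hasFDerivAt_prodMk_right (𝕜 := ℝ) (0 : ℝ) z)
      have h2 : fderiv ℝ (φ 0) z = _ := h1.fderiv
      rw [h2]
      rfl
    simp only [e]
    exact sum_sq_apply_bv_le _
  have hTd : ∀ z, dT F (0, z) = dt1 φ 0 z := fun z =>
    ((hasDerivAt_time_slice hF 0 z).deriv).symm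
  have hA := setLIntegral_gradient_le_wEnergy (p := p) (φ := φ) (by linarith : 0 ≤ γ) extDom
  have hB := setLIntegral_potential_le_wEnergy (p := p) (φ := φ) (by linarith : 0 ≤ γ) extDom
  have hC := setLIntegral_sq_le_wEnergy hγ1 hp hφ0 hfin
  rw [← hE] at hA hB hC
  have hne : ∀ z ∈ extDom, (1 : ℝ) < ‖z‖ := fun z hz => hz
  have hpot : ∀ q, pot p F q ≤ |F q| ^ (p + 1) := fun q =>
    div_le_self (rpow_nonneg (abs_nonneg _) _) (by linarith)
  have hcφ := hφ0.continuous.measurable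
  have hcd := (hφ0.continuous_fderiv one_ne_zero).measurable
  have hct : Measurable (dt1 φ 0) := by
    have : dt1 φ 0 = fun z => dT F (0, z) := by
      funext z
      exact (hTd z).symm
    rw [this]
    exact ((contDiff_dT hF).continuous.comp (by fun_prop)).measurable
  have hm1 : Measurable fun z => ENNReal.ofReal (‖z‖ ^ γ * (‖fderiv ℝ (φ 0) z‖ ^ 2 +
    dt1 φ 0 z ^ 2)) := by fun_prop
  have hm2 : Measurable fun z => ENNReal.ofReal (‖z‖ ^ γ * |φ 0 z| ^ (p + 1)) := by fun_prop
  have h1 : ∫⁻ z in extDom, ENNReal.ofReal (wJ0 p γ F (0, z)) ≤ ENNReal.ofReal 2 * E + E + ENNReal.ofReal 2 * E := by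
    calc ∫⁻ z in extDom, ENNReal.ofReal (wJ0 p γ F (0, z))
        ≤ ∫⁻ z in extDom, (ENNReal.ofReal 2 * ENNReal.ofReal (‖z‖ ^ γ * (‖fderiv ℝ (φ 0) z‖ ^ 2 +
            dt1 φ 0 z ^ 2)) + ENNReal.ofReal (‖z‖ ^ γ * |φ 0 z| ^ (p + 1)) +
            ENNReal.ofReal 2 * ENNReal.ofReal (‖z‖ ^ (γ - 2) * φ 0 z ^ 2)) := by
          refine setLIntegral_mono' measurableSet_extDom fun z hz => ?_
          have hz1 := hne z hz
          have hz0 : z ≠ 0 := norm_pos_iff.1 (by linarith)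
          rw [← ENNReal.ofReal_mul (by norm_num),
            ← ENNReal.ofReal_mul (by norm_num), ← ENNReal.ofReal_add (by positivity) (by positivity),
            ← ENNReal.ofReal_add (by positivity) (by positivity)]
          refine ENNReal.ofReal_le_ofReal ((wJ0_le hp γ (q := (0, z)) hz0).trans ?_)
          have e : ‖z‖ ^ (γ - 2) = ‖z‖ ^ γ * ‖z‖⁻¹ ^ 2 := by
            rw [rpow_sub (by linarith), rpow_two, inv_pow, div_eq_mul_inv]
          rw [e, hTd]
          have hF0 : F (0, z) = φ 0 z := rfl
          have h1 := hX z
          have h2 := hpot (0, z)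
          rw [hF0] at h2 ⊢
          have h3 : 0 ≤ ‖z‖ ^ γ := by positivity
          calc _ ≤ ‖z‖ ^ γ * (2 * (dt1 φ 0 z ^ 2 + ‖fderiv ℝ (φ 0) z‖ ^ 2) +
                |φ 0 z| ^ (p + 1) + 2 * (φ 0 z * ‖z‖⁻¹) ^ 2) := by gcongr
            _ = _ := by ring
      _ ≤ _ := by
          rw [lintegral_add_left (by fun_prop), lintegral_add_left (by fun_prop),
            lintegral_const_mul _ (by fun_prop), lintegral_const_mul _ (by fun_prop)]
          gcongr
  have h2 : ∫⁻ z in extDom, ENNReal.ofReal (dT F (0, z) ^ 2 / 2 +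
        (∑ i, dX F i (0, z) ^ 2) / 2 + pot p F (0, z)) ≤ E + E := by
    calc _ ≤ ∫⁻ z in extDom, (ENNReal.ofReal (‖z‖ ^ γ * (‖fderiv ℝ (φ 0) z‖ ^ 2 +
            dt1 φ 0 z ^ 2)) + ENNReal.ofReal (‖z‖ ^ γ * |φ 0 z| ^ (p + 1))) := by
          refine setLIntegral_mono' measurableSet_extDom fun z hz => ?_
          have hz1 := hne z hz
          rw [← ENNReal.ofReal_add (by positivity) (by positivity)]
          refine ENNReal.ofReal_le_ofReal ?_
          have h0 : 1 ≤ ‖z‖ ^ γ := one_le_rpow hz1.le (by linarith)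
          have h1 := hX z
          have h2 : pot p F (0, z) ≤ |φ 0 z| ^ (p + 1) := hpot (0, z)
          rw [hTd]
          have h3 : 0 ≤ |φ 0 z| ^ (p + 1) := rpow_nonneg (abs_nonneg _) _
          nlinarith [mul_le_mul_of_nonneg_right h0 h3, mul_le_mul_of_nonneg_right h0
            (add_nonneg (sq_nonneg ‖fderiv ℝ (φ 0) z‖) (sq_nonneg (dt1 φ 0 z))),
            sq_nonneg ‖fderiv ℝ (φ 0) z‖, sq_nonneg (dt1 φ 0 z)]
      _ ≤ _ := by
          rw [lintegral_add_left (by fun_prop)]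
          gcongr
  have g1 := (lintegral_weighted_pot_le hp (by linarith) hγ2 hγp hF hs
    (by linarith : T < ‖x‖)).trans ((setLIntegral_ball_le_extDom (by linarith) fun z =>
      ENNReal.ofReal (wJ0 p γ F (0, z))).trans h1)
  have g2 := (lintegral_pot_le hp hF hs (T := T) x).trans ((setLIntegral_ball_le_extDom
    (by linarith) fun z => ENNReal.ofReal (dT F (0, z) ^ 2 / 2 +
        (∑ i, dX F i (0, z) ^ 2) / 2 + pot p F (0, z))).trans h2)
  have hmp : Measurable fun y => ENNReal.ofReal (pot p F (T - ‖y‖, x + y)) :=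
    ((contDiff_pot hp hF).continuous.comp (by fun_prop)).measurable.ennreal_ofReal
  calc _ ≤ ∫⁻ y in Metric.ball (0 : E3) T, ENNReal.ofReal (p + 1) *
        (ENNReal.ofReal ((1 + cosN y (T - ‖y‖, x + y)) *
      ‖x + y‖ ^ γ * pot p F (T - ‖y‖, x + y)) + ENNReal.ofReal (pot p F (T - ‖y‖, x + y))) := by
        refine lintegral_mono fun y => ?_
        have hq := pot_nonneg (F := F) hp (T - ‖y‖, x + y)
        refine le_trans ?_ (mul_le_mul_right ENNReal.ofReal_add_le _)
        rw [← ENNReal.ofReal_mul hp1.le]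
        refine ENNReal.ofReal_le_ofReal (le_of_eq ?_)
        have e : (p + 1) * pot p F (T - ‖y‖, x + y) = |φ (T - ‖y‖) (x + y)| ^ (p + 1) := by
          unfold pot
          field_simp
          rfl
        rw [← e]
        unfold coneWeight
        ring
    _ = ENNReal.ofReal (p + 1) * (_ + _) := by
        rw [lintegral_const_mul' _ _ ENNReal.ofReal_ne_top, lintegral_add_right _ hmp]
    _ ≤ ENNReal.ofReal (p + 1) * ((ENNReal.ofReal 2 * E + E + ENNReal.ofReal 2 * E) + (E + E)) := by gcongr
    _ = _ := by
        rw [ENNReal.ofReal_mul (by norm_num), ENNReal.ofReal_ofNat, ENNReal.ofReal_ofNat]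
        ring

end

section

theorem lintegral_norm_radial {h : ℝ → ℝ≥0∞} (hh : Measurable h) {S : Set ℝ}
    (hS : MeasurableSet S) (hS0 : S ⊆ Set.Ioi 0) :
    ∫⁻ x in {x : E3 | ‖x‖ ∈ S}, h ‖x‖ =
      (∫⁻ s in S, ENNReal.ofReal (s ^ 2) * h s) * sphereMeasure Set.univ := by
  rw [lintegral_polar_radial_norm (fun x => h ‖x‖) (hh.comp measurable_norm) hS hS0,
    ← lintegral_mul_const _ (by fun_prop : Measurable fun s : ℝ => ENNReal.ofReal (s ^ 2) * h s)]
  refine setLIntegral_congr_fun hS fun s hs => ?_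
  have : ∀ ω : Metric.sphere (0 : E3) 1, ‖s • (ω : E3)‖ = s := fun ω => by
    rw [norm_smul, norm_eq_of_mem_sphere, mul_one, norm_of_nonneg (le_of_lt (hS0 hs))]
  simp only [this]
  rw [lintegral_const, mul_assoc]

section Trace

variable {V : Type*} [NormedAddCommGroup V] [NormedSpace ℝ V]

theorem norm_deriv_ray_le {G : E3 → V} (hG : ContDiff ℝ 1 G) (x : E3)
    (ω : Metric.sphere (0 : E3) 1) (s : ℝ) :
    ‖deriv (fun s : ℝ => G (x + s • (ω : E3))) s‖ ≤ ‖fderiv ℝ G (x + s • (ω : E3))‖ := by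
  have h1 : HasDerivAt (fun s : ℝ => x + s • (ω : E3)) (ω : E3) s := by
    simpa using ((hasDerivAt_id s).smul_const (ω : E3)).const_add x
  have h2 := ((hG.differentiable one_ne_zero) (x + s • (ω : E3))).hasFDerivAt.comp_hasDerivAt s h1
  have h3 : deriv (fun s : ℝ => G (x + s • (ω : E3))) s = fderiv ℝ G (x + s • (ω : E3)) ω := h2.deriv
  rw [h3]
  have := (fderiv ℝ G (x + s • (ω : E3))).le_opNorm ω
  rwa [norm_eq_of_mem_sphere, mul_one] at this

theorem contDiff_comp_ray {G : E3 → V} (hG : ContDiff ℝ 1 G) (x v : E3) :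
    ContDiff ℝ 1 fun s : ℝ => G (x + s • v) :=
  hG.comp (contDiff_const.add (contDiff_id.smul contDiff_const))

variable [CompleteSpace V]

theorem ofReal_norm_sub_le_lintegral {g : ℝ → V} (hg : ContDiff ℝ 1 g) {a b : ℝ} (hab : a ≤ b) :
    ENNReal.ofReal ‖g b - g a‖ ≤ ∫⁻ s in Set.Ioc a b, ENNReal.ofReal ‖deriv g s‖ := by
  have hc : Continuous (deriv g) := hg.continuous_deriv le_rfl
  rw [← intervalIntegral.integral_deriv_eq_sub
    (fun x _ => (hg.differentiable one_ne_zero) x) (hc.intervalIntegrable a b)]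
  have h1 := intervalIntegral.norm_integral_le_integral_norm (f := deriv g) (μ := volume) hab
  refine (ENNReal.ofReal_le_ofReal h1).trans_eq ?_
  rw [intervalIntegral.integral_of_le hab, ofReal_integral_eq_lintegral_ofReal]
  · exact hc.norm.integrableOn_Ioc
  · exact Filter.Eventually.of_forall fun _ => norm_nonneg _

theorem ofReal_norm_le_lintegral {g : ℝ → V} (hg : ContDiff ℝ 1 g) {a b s₀ : ℝ} (hab : a < b)
    (hs : s₀ ∈ Set.Icc a b) :
    ENNReal.ofReal ‖g s₀‖ ≤
      ∫⁻ s in Set.Ioc a b, ENNReal.ofReal ((b - a)⁻¹ * ‖g s‖ + ‖deriv g s‖) := by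
  have hc : Continuous (deriv g) := hg.continuous_deriv le_rfl
  set D := ∫⁻ s in Set.Ioc a b, ENNReal.ofReal ‖deriv g s‖ with hD
  have hba : 0 < b - a := sub_pos.2 hab
  have hpt : ∀ s ∈ Set.Ioc a b, ENNReal.ofReal ‖g s₀‖ ≤ ENNReal.ofReal ‖g s‖ + D := by
    intro s hsI
    have key : ENNReal.ofReal ‖g s₀ - g s‖ ≤ D := by
      rcases le_total s s₀ with h | h
      · exact (ofReal_norm_sub_le_lintegral hg h).trans
          (lintegral_mono_set (Set.Ioc_subset_Ioc hsI.1.le hs.2))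
      · rw [norm_sub_rev]
        exact (ofReal_norm_sub_le_lintegral hg h).trans
          (lintegral_mono_set (Set.Ioc_subset_Ioc hs.1 hsI.2))
    calc ENNReal.ofReal ‖g s₀‖ ≤ ENNReal.ofReal (‖g s‖ + ‖g s₀ - g s‖) := by
          refine ENNReal.ofReal_le_ofReal ?_
          have := norm_add_le (g s) (g s₀ - g s)
          rwa [add_sub_cancel] at this
      _ ≤ _ := ENNReal.ofReal_add_le.trans (by gcongr)
  have hb0 : ENNReal.ofReal (b - a)⁻¹ * ENNReal.ofReal (b - a) = 1 := by
    rw [← ENNReal.ofReal_mul (by positivity), inv_mul_cancel₀ hba.ne', ENNReal.ofReal_one]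
  calc ENNReal.ofReal ‖g s₀‖
      = ENNReal.ofReal (b - a)⁻¹ * ∫⁻ _ in Set.Ioc a b, ENNReal.ofReal ‖g s₀‖ := by
        rw [setLIntegral_const, Real.volume_Ioc, mul_comm (ENNReal.ofReal ‖g s₀‖), ← mul_assoc, hb0,
          one_mul]
    _ ≤ ENNReal.ofReal (b - a)⁻¹ * ∫⁻ s in Set.Ioc a b, (ENNReal.ofReal ‖g s‖ + D) := by
        gcongr 1
        exact setLIntegral_mono' measurableSet_Ioc hpt
    _ = ENNReal.ofReal (b - a)⁻¹ * (∫⁻ s in Set.Ioc a b, ENNReal.ofReal ‖g s‖) + D := by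
        rw [lintegral_add_right _ measurable_const, setLIntegral_const, Real.volume_Ioc, mul_add,
          mul_comm D, ← mul_assoc, hb0, one_mul]
    _ = _ := by
        rw [← lintegral_const_mul' _ _ ENNReal.ofReal_ne_top,
          ← lintegral_add_right _ (hc.norm.measurable.ennreal_ofReal)]
        refine lintegral_congr fun s => ?_
        rw [← ENNReal.ofReal_mul (by positivity), ENNReal.ofReal_add (by positivity) (by positivity)]

/-- The integral of the norm of `G` over the sphere of radius `s` about `x`, in the normalised
measure. -/
def sphInt (G : E3 → V) (x : E3) (s : ℝ) : ℝ≥0∞ :=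
  ∫⁻ ω : Metric.sphere (0 : E3) 1, ENNReal.ofReal ‖G (x + s • (ω : E3))‖ ∂sphereMeasure

theorem sphInt_le_lintegral {G : E3 → V} (hG : ContDiff ℝ 1 G) (x : E3) {a b s₀ : ℝ} (ha : 0 ≤ a)
    (hab : a < b) (hs : s₀ ∈ Set.Icc a b) :
    sphInt G x s₀ ≤ ∫⁻ y in {y : E3 | ‖y‖ ∈ Set.Ioc a b}, ENNReal.ofReal
      ((‖y‖ ^ 2)⁻¹ * ((b - a)⁻¹ * ‖G (x + y)‖ + ‖fderiv ℝ G (x + y)‖)) := by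
  have hc := hG.continuous_fderiv one_ne_zero
  have hm : Measurable fun y : E3 => ENNReal.ofReal
      ((‖y‖ ^ 2)⁻¹ * ((b - a)⁻¹ * ‖G (x + y)‖ + ‖fderiv ℝ G (x + y)‖)) := by
    have h1 : Measurable fun y => ‖G (x + y)‖ :=
      (hG.continuous.comp (by fun_prop : Continuous fun y : E3 => x + y)).norm.measurable
    have h2 : Measurable fun y => ‖fderiv ℝ G (x + y)‖ :=
      (hc.comp (by fun_prop : Continuous fun y : E3 => x + y)).norm.measurable
    fun_prop
  rw [lintegral_polar_norm _ hm measurableSet_Ioc fun s hs => ha.trans_lt hs.1]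
  refine lintegral_mono fun ω => ?_
  refine (ofReal_norm_le_lintegral (contDiff_comp_ray hG x ω) hab hs).trans ?_
  refine setLIntegral_mono' measurableSet_Ioc fun s hsI => ?_
  have hs0 : 0 < s := ha.trans_lt hsI.1
  have hba : 0 < b - a := sub_pos.2 hab
  rw [← ENNReal.ofReal_mul (by positivity)]
  refine ENNReal.ofReal_le_ofReal ?_
  rw [norm_smul, norm_eq_of_mem_sphere, mul_one, norm_of_nonneg hs0.le, ← mul_assoc,
    mul_inv_cancel₀ (by positivity), one_mul]
  gcongr
  exact norm_deriv_ray_le hG x ω s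

theorem sphInt_le_add {G : E3 → V} (hG : ContDiff ℝ 1 G) (x : E3) {a b : ℝ} (hab : a ≤ b) :
    sphInt G x a ≤ sphInt G x b + ∫⁻ s in Set.Ioc a b, sphInt (fderiv ℝ G) x s := by
  have hc := hG.continuous_fderiv one_ne_zero
  have hm : Measurable fun z : ℝ × Metric.sphere (0 : E3) 1 =>
      ENNReal.ofReal ‖fderiv ℝ G (x + z.1 • (z.2 : E3))‖ :=
    (hc.comp (by fun_prop :
      Continuous fun z : ℝ × Metric.sphere (0 : E3) 1 => x + z.1 • (z.2 : E3))).norm.measurable.ennreal_ofReal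
  have hsw : ∫⁻ s in Set.Ioc a b, sphInt (fderiv ℝ G) x s =
      ∫⁻ ω : Metric.sphere (0 : E3) 1, (∫⁻ s in Set.Ioc a b,
        ENNReal.ofReal ‖fderiv ℝ G (x + s • (ω : E3))‖) ∂sphereMeasure :=
    lintegral_lintegral_swap hm.aemeasurable
  have hmb : Measurable fun ω : Metric.sphere (0 : E3) 1 =>
      ENNReal.ofReal ‖G (x + b • (ω : E3))‖ :=
    (hG.continuous.comp (by fun_prop :
      Continuous fun ω : Metric.sphere (0 : E3) 1 => x + b • (ω : E3))).norm.measurable.ennreal_ofReal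
  rw [hsw]
  unfold sphInt
  rw [← lintegral_add_left hmb]
  refine lintegral_mono fun ω => ?_
  have h1 := ofReal_norm_sub_le_lintegral (contDiff_comp_ray hG x ω) hab
  calc ENNReal.ofReal ‖G (x + a • (ω : E3))‖ ≤ ENNReal.ofReal (‖G (x + b • (ω : E3))‖ +
        ‖G (x + b • (ω : E3)) - G (x + a • (ω : E3))‖) := by
        refine ENNReal.ofReal_le_ofReal ?_
        have := norm_sub_le (G (x + b • (ω : E3))) (G (x + b • (ω : E3)) - G (x + a • (ω : E3)))
        rwa [sub_sub_cancel] at this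
    _ ≤ _ := ENNReal.ofReal_add_le
    _ ≤ _ := by
        refine add_le_add le_rfl (h1.trans (lintegral_mono fun s => ?_))
        exact ENNReal.ofReal_le_ofReal (norm_deriv_ray_le hG x ω s)

/-- Trace estimate on a sphere, with the data measured in a weighted norm. -/
theorem sphInt_sq_le {G : E3 → V} (hG : ContDiff ℝ 1 G) (x : E3) {a b s₀ α : ℝ} (ha : 0 ≤ a)
    (hab : a < b) (hs : s₀ ∈ Set.Icc a b) (hbx : b < ‖x‖ - 1) (hk : ‖x‖ + b ≤ 10 * (b - a)) :
    sphInt G x s₀ ^ 2 ≤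
      (∫⁻ y in {y : E3 | ‖y‖ ∈ Set.Ioc a b}, ENNReal.ofReal ((‖y‖ ^ 4)⁻¹ * ‖x + y‖ ^ (-α))) *
      (ENNReal.ofReal 200 * ∫⁻ z in extDom, ENNReal.ofReal (‖z‖ ^ α * ‖fderiv ℝ G z‖ ^ 2 +
        ‖z‖ ^ (α - 2) * ‖G z‖ ^ 2)) := by
  have hc := hG.continuous_fderiv one_ne_zero
  have hba : 0 < b - a := sub_pos.2 hab
  set S := {y : E3 | ‖y‖ ∈ Set.Ioc a b} with hS
  have hSm : MeasurableSet S := measurable_norm measurableSet_Ioc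
  have hlow : ∀ y ∈ S, 1 < ‖x + y‖ := fun y hy => by
    have h1 := norm_sub_norm_le x (-y)
    rw [norm_neg, sub_neg_eq_add] at h1
    have h2 : ‖y‖ ≤ b := hy.2
    linarith
  have h1 : Measurable fun y => ‖G (x + y)‖ :=
    (hG.continuous.comp (by fun_prop : Continuous fun y : E3 => x + y)).norm.measurable
  have h2 : Measurable fun y => ‖fderiv ℝ G (x + y)‖ :=
    (hc.comp (by fun_prop : Continuous fun y : E3 => x + y)).norm.measurable
  set f : E3 → ℝ≥0∞ := fun y => ENNReal.ofReal ((‖y‖ ^ 2)⁻¹ * ‖x + y‖ ^ (-α / 2)) with hf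
  set g : E3 → ℝ≥0∞ := fun y => ENNReal.ofReal (‖x + y‖ ^ (α / 2) *
    ((b - a)⁻¹ * ‖G (x + y)‖ + ‖fderiv ℝ G (x + y)‖)) with hg
  have hfm : Measurable f := by fun_prop
  have hgm : Measurable g := by fun_prop
  have e1 : sphInt G x s₀ ≤ ∫⁻ y in S, f y * g y := by
    refine (sphInt_le_lintegral hG x ha hab hs).trans ?_
    refine setLIntegral_mono' hSm fun y hy => le_of_eq ?_
    have hp := hlow y hy
    have hp0 : 0 < ‖x + y‖ := by linarith
    simp only [hf, hg]
    rw [← ENNReal.ofReal_mul (by positivity)]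
    congr 1
    have : ‖x + y‖ ^ (-α / 2) * ‖x + y‖ ^ (α / 2) = 1 := by
      rw [← rpow_add hp0, show -α / 2 + α / 2 = 0 by ring, rpow_zero]
    linear_combination -((‖y‖ ^ 2)⁻¹ * ((b - a)⁻¹ * ‖G (x + y)‖ + ‖fderiv ℝ G (x + y)‖)) * this
  refine (pow_le_pow_left₀ zero_le e1 2).trans
    ((lintegral_mul_sq_le hfm.aemeasurable hgm.aemeasurable).trans ?_)
  refine mul_le_mul' (le_of_eq ?_) ?_
  · refine setLIntegral_congr_fun hSm fun y hy => ?_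
    have hp0 : 0 < ‖x + y‖ := by linarith [hlow y hy]
    simp only [hf]
    rw [← ENNReal.ofReal_pow (by positivity), mul_pow, ← rpow_natCast (‖x + y‖ ^ _), ← rpow_mul hp0.le,
      inv_pow, ← pow_mul]
    norm_num
  · rw [← lintegral_const_mul' _ _ ENNReal.ofReal_ne_top]
    refine le_trans ?_ (setLIntegral_ball_le_extDom (T := ‖x‖ - 1) (x := x) (by linarith) _)
    refine le_trans (setLIntegral_mono' hSm (g := fun y => ENNReal.ofReal 200 * ENNReal.ofReal
      (‖x + y‖ ^ α * ‖fderiv ℝ G (x + y)‖ ^ 2 + ‖x + y‖ ^ (α - 2) * ‖G (x + y)‖ ^ 2))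
      fun y hy => ?_) (lintegral_mono_set fun y hy => ?_)
    · have hp0 : 0 < ‖x + y‖ := by linarith [hlow y hy]
      have hup : ‖x + y‖ ≤ 10 * (b - a) := (norm_add_le _ _).trans (by linarith [show ‖y‖ ≤ b from hy.2])
      simp only [hg]
      rw [← ENNReal.ofReal_pow (by positivity), ← ENNReal.ofReal_mul (by norm_num)]
      refine ENNReal.ofReal_le_ofReal ?_
      have e2 : (‖x + y‖ ^ (α / 2)) ^ 2 = ‖x + y‖ ^ α := by
        rw [← rpow_natCast, ← rpow_mul hp0.le]
        norm_num
      have e3 : ‖x + y‖ ^ (α - 2) = ‖x + y‖ ^ α * (‖x + y‖⁻¹) ^ 2 := by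
        rw [rpow_sub hp0, rpow_two, inv_pow, div_eq_mul_inv]
      have e4 : (b - a)⁻¹ ≤ 10 * ‖x + y‖⁻¹ := by
        rw [← div_eq_mul_inv, le_div_iff₀ hp0, inv_mul_le_iff₀ hba]
        linarith
      have e5 : (b - a)⁻¹ * ‖G (x + y)‖ + ‖fderiv ℝ G (x + y)‖ ≤
          10 * (‖x + y‖⁻¹ * ‖G (x + y)‖) + ‖fderiv ℝ G (x + y)‖ := by
        have := mul_le_mul_of_nonneg_right e4 (norm_nonneg (G (x + y)))
        linarith
      have e6 : ((b - a)⁻¹ * ‖G (x + y)‖ + ‖fderiv ℝ G (x + y)‖) ^ 2 ≤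
          200 * (‖fderiv ℝ G (x + y)‖ ^ 2 + (‖x + y‖⁻¹ * ‖G (x + y)‖) ^ 2) := by
        refine (pow_le_pow_left₀ (by positivity) e5 2).trans ?_
        nlinarith [sq_nonneg (10 * (‖x + y‖⁻¹ * ‖G (x + y)‖) - ‖fderiv ℝ G (x + y)‖),
          sq_nonneg ‖fderiv ℝ G (x + y)‖]
      rw [mul_pow, e2, e3]
      have := mul_le_mul_of_nonneg_left e6 (rpow_nonneg hp0.le α)
      nlinarith
    · rw [mem_ball_zero_iff]
      exact lt_of_le_of_lt hy.2 hbx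

end Trace

end

section

theorem lintegral_Ioi_rpow {c r : ℝ} (hc : c < -1) (hr : 0 < r) :
    ∫⁻ s in Set.Ioi r, ENNReal.ofReal (s ^ c) = ENNReal.ofReal (r ^ (c + 1) / (-(c + 1))) := by
  have h := integrableOn_Ioi_rpow_of_lt hc hr
  have e : r ^ (c + 1) / (-(c + 1)) = ∫ s in Set.Ioi r, s ^ c := by
    rw [integral_Ioi_rpow_of_lt hc hr, div_neg, neg_div]
  rw [e, ofReal_integral_eq_lintegral_ofReal h]
  filter_upwards [ae_restrict_mem measurableSet_Ioi] with s hs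
  exact rpow_nonneg (hr.trans hs).le _

theorem lintegral_Ioc_rpow {c r : ℝ} (hc : -1 < c) (hr : 0 ≤ r) :
    ∫⁻ s in Set.Ioc 0 r, ENNReal.ofReal (s ^ c) = ENNReal.ofReal (r ^ (c + 1) / (c + 1)) := by
  have h : IntegrableOn (fun s : ℝ => s ^ c) (Set.Ioc 0 r) :=
    (intervalIntegrable_iff_integrableOn_Ioc_of_le hr).1 (intervalIntegral.intervalIntegrable_rpow' hc)
  have e : r ^ (c + 1) / (c + 1) = ∫ s in Set.Ioc 0 r, s ^ c := by
    rw [← intervalIntegral.integral_of_le hr, integral_rpow (Or.inl hc),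
      zero_rpow (by linarith), sub_zero]
  rw [e, ofReal_integral_eq_lintegral_ofReal h]
  filter_upwards [ae_restrict_mem measurableSet_Ioc] with s hs
  exact rpow_nonneg hs.1.le _

/-- Total mass of the unit sphere. -/
def sphMass : ℝ := sphereMeasure.real Set.univ

theorem ofReal_sphMass : ENNReal.ofReal sphMass = sphereMeasure Set.univ :=
  ofReal_measureReal

theorem sphMass_nonneg : 0 ≤ sphMass := measureReal_nonneg

theorem lintegral_translate_annulus_le {T b : ℝ} (x : E3) (hb : b < ‖x‖) (f : E3 → ℝ≥0∞) :
    ∫⁻ y in {y : E3 | ‖y‖ ∈ Set.Ioc T b}, f (x + y) ≤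
      ∫⁻ z in {z : E3 | ‖z‖ ∈ Set.Icc (‖x‖ - b) (‖x‖ + b)}, f z := by
  have m1 : MeasurableSet {y : E3 | ‖y‖ ∈ Set.Ioc T b} := measurable_norm measurableSet_Ioc
  have m2 : MeasurableSet {z : E3 | ‖z‖ ∈ Set.Icc (‖x‖ - b) (‖x‖ + b)} :=
    measurable_norm measurableSet_Icc
  rw [← lintegral_indicator m1, ← lintegral_indicator m2,
    ← lintegral_add_left_eq_self ({z : E3 | ‖z‖ ∈ Set.Icc (‖x‖ - b) (‖x‖ + b)}.indicator f) x]
  refine lintegral_mono fun y => ?_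
  by_cases hy : ‖y‖ ∈ Set.Ioc T b
  · have h1 : ‖x + y‖ ∈ Set.Icc (‖x‖ - b) (‖x‖ + b) := by
      have h := norm_sub_norm_le x (-y)
      rw [norm_neg, sub_neg_eq_add] at h
      have h' := norm_add_le x y
      constructor <;> linarith [hy.2]
    rw [Set.indicator_of_mem (show y ∈ {y : E3 | ‖y‖ ∈ Set.Ioc T b} from hy),
      Set.indicator_of_mem (show x + y ∈ {z : E3 | ‖z‖ ∈ Set.Icc (‖x‖ - b) (‖x‖ + b)} from h1)]
  · rw [Set.indicator_of_notMem (show y ∉ {y : E3 | ‖y‖ ∈ Set.Ioc T b} from hy)]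
    exact zero_le

theorem lintegral_far_kernel_le {T α : ℝ} (hT : 0 < T) (x : E3) (hx : T < ‖x‖) :
    ∫⁻ y in {y : E3 | ‖y‖ ∈ Set.Ioc (T / 2) T}, ENNReal.ofReal ((‖y‖ ^ 4)⁻¹ * ‖x + y‖ ^ (-α)) ≤
      ENNReal.ofReal (16 * (T ^ 4)⁻¹ * sphMass) *
        ∫⁻ s in Set.Icc (‖x‖ - T) (‖x‖ + T), ENNReal.ofReal (s ^ (2 - α)) := by
  have m1 : MeasurableSet {y : E3 | ‖y‖ ∈ Set.Ioc (T / 2) T} := measurable_norm measurableSet_Ioc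
  have hsub : Set.Icc (‖x‖ - T) (‖x‖ + T) ⊆ Set.Ioi 0 := fun s hs => by
    have := hs.1
    rw [Set.mem_Ioi]
    linarith
  calc _ ≤ ∫⁻ y in {y : E3 | ‖y‖ ∈ Set.Ioc (T / 2) T}, ENNReal.ofReal (16 * (T ^ 4)⁻¹) *
        ENNReal.ofReal (‖x + y‖ ^ (-α)) := by
        refine setLIntegral_mono' m1 fun y hy => ?_
        rw [← ENNReal.ofReal_mul (by positivity)]
        refine ENNReal.ofReal_le_ofReal ?_
        gcongr
        have h : T / 2 < ‖y‖ := hy.1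
        rw [show 16 * (T ^ 4)⁻¹ = ((T / 2) ^ 4)⁻¹ by field_simp; norm_num]
        gcongr
    _ = ENNReal.ofReal (16 * (T ^ 4)⁻¹) * ∫⁻ y in {y : E3 | ‖y‖ ∈ Set.Ioc (T / 2) T},
        ENNReal.ofReal (‖x + y‖ ^ (-α)) := lintegral_const_mul' _ _ ENNReal.ofReal_ne_top
    _ ≤ ENNReal.ofReal (16 * (T ^ 4)⁻¹) * ∫⁻ z in {z : E3 | ‖z‖ ∈ Set.Icc (‖x‖ - T) (‖x‖ + T)},
        ENNReal.ofReal (‖z‖ ^ (-α)) := by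
        gcongr 1
        exact lintegral_translate_annulus_le x hx _
    _ = _ := by
        rw [lintegral_norm_radial (h := fun s => ENNReal.ofReal (s ^ (-α))) (by fun_prop)
          measurableSet_Icc hsub, ENNReal.ofReal_mul (p := 16 * (T ^ 4)⁻¹) (by positivity), ofReal_sphMass, mul_assoc,
          mul_comm (sphereMeasure Set.univ)]
        congr 2
        refine setLIntegral_congr_fun measurableSet_Icc fun s hs => ?_
        have hs0 : 0 < s := hsub hs
        rw [← ENNReal.ofReal_mul (by positivity), ← rpow_two, ← rpow_add hs0]
        ring_nf

theorem lintegral_near_kernel_le {T b α : ℝ} (hT : 0 < T) (hα : 0 ≤ α) (x : E3)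
    (hb : b ≤ ‖x‖ / 2) (hx : 0 < ‖x‖) :
    ∫⁻ y in {y : E3 | ‖y‖ ∈ Set.Ioc T b}, ENNReal.ofReal ((‖y‖ ^ 4)⁻¹ * ‖x + y‖ ^ (-α)) ≤
      ENNReal.ofReal ((‖x‖ / 2) ^ (-α) * T⁻¹ * sphMass) := by
  have m1 : MeasurableSet {y : E3 | ‖y‖ ∈ Set.Ioc T b} := measurable_norm measurableSet_Ioc
  have hsub : Set.Ioi T ⊆ Set.Ioi 0 := Set.Ioi_subset_Ioi hT.le
  calc _ ≤ ∫⁻ y in {y : E3 | ‖y‖ ∈ Set.Ioc T b}, ENNReal.ofReal ((‖x‖ / 2) ^ (-α)) *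
        ENNReal.ofReal ((‖y‖ ^ 4)⁻¹) := by
        refine setLIntegral_mono' m1 fun y hy => ?_
        rw [← ENNReal.ofReal_mul (by positivity)]
        refine ENNReal.ofReal_le_ofReal ?_
        rw [mul_comm]
        refine mul_le_mul_of_nonneg_right ?_ (by positivity)
        refine rpow_le_rpow_of_nonpos (by positivity) ?_ (by linarith)
        have h := norm_sub_norm_le x (-y)
        rw [norm_neg, sub_neg_eq_add] at h
        linarith [show ‖y‖ ≤ b from hy.2]
    _ = ENNReal.ofReal ((‖x‖ / 2) ^ (-α)) * ∫⁻ y in {y : E3 | ‖y‖ ∈ Set.Ioc T b},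
        ENNReal.ofReal ((‖y‖ ^ 4)⁻¹) := lintegral_const_mul' _ _ ENNReal.ofReal_ne_top
    _ ≤ ENNReal.ofReal ((‖x‖ / 2) ^ (-α)) * ∫⁻ y in {y : E3 | ‖y‖ ∈ Set.Ioi T},
        ENNReal.ofReal ((‖y‖ ^ 4)⁻¹) := by
        gcongr 1
        exact lintegral_mono_set fun y hy => hy.1
    _ = ENNReal.ofReal ((‖x‖ / 2) ^ (-α)) * ((∫⁻ s in Set.Ioi T, ENNReal.ofReal (s ^ (-2 : ℝ))) *
        sphereMeasure Set.univ) := by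
        rw [lintegral_norm_radial (h := fun s => ENNReal.ofReal (s ^ 4)⁻¹) (by fun_prop)
          measurableSet_Ioi hsub]
        congr 2
        refine setLIntegral_congr_fun measurableSet_Ioi fun s hs => ?_
        have hs0 : 0 < s := hsub hs
        rw [← ENNReal.ofReal_mul (by positivity), rpow_neg hs0.le, rpow_two]
        congr 1
        field_simp
    _ = _ := by
        rw [lintegral_Ioi_rpow (by norm_num) hT, ← ofReal_sphMass, ENNReal.ofReal_mul (by positivity),
          ENNReal.ofReal_mul (by positivity), mul_assoc]
        norm_num [rpow_neg_one]

variable {V : Type*} [NormedAddCommGroup V] [NormedSpace ℝ V] [CompleteSpace V]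

/-- The weighted first-order norm entering the trace estimates. -/
def wNorm (G : E3 → V) (α : ℝ) : ℝ≥0∞ :=
  ∫⁻ z in extDom, ENNReal.ofReal (‖z‖ ^ α * ‖fderiv ℝ G z‖ ^ 2 + ‖z‖ ^ (α - 2) * ‖G z‖ ^ 2)

theorem sphInt_far_sq_le {G : E3 → V} (hG : ContDiff ℝ 1 G) (x : E3) {T α : ℝ}
    (hT : ‖x‖ / 4 ≤ T) (hx : T + 1 < ‖x‖) (hT0 : 0 < T) :
    sphInt G x T ^ 2 ≤ ENNReal.ofReal (3200 * sphMass * (T ^ 4)⁻¹) *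
      (∫⁻ s in Set.Icc (‖x‖ - T) (‖x‖ + T), ENNReal.ofReal (s ^ (2 - α))) * wNorm G α := by
  have h := sphInt_sq_le hG x (a := T / 2) (b := T) (s₀ := T) (α := α) (by linarith) (by linarith)
    ⟨by linarith, le_rfl⟩ (by linarith) (by linarith)
  refine h.trans ((mul_le_mul' (lintegral_far_kernel_le hT0 x (by linarith)) le_rfl).trans_eq ?_)
  have hm := sphMass_nonneg
  rw [show 3200 * sphMass * (T ^ 4)⁻¹ = (16 * (T ^ 4)⁻¹ * sphMass) * 200 by ring,
    ENNReal.ofReal_mul (p := 16 * (T ^ 4)⁻¹ * sphMass) (by positivity)]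
  unfold wNorm
  ring

theorem sphInt_near_sq_le {G : E3 → V} (hG : ContDiff ℝ 1 G) (x : E3) {T α : ℝ}
    (hT : T ≤ ‖x‖ / 4) (hx : 2 ≤ ‖x‖) (hT0 : 0 < T) (hα : 0 ≤ α) (hα4 : α ≤ 4) :
    sphInt G x T ^ 2 ≤ ENNReal.ofReal (3200 * sphMass * ‖x‖ ^ (-α) * T⁻¹) * wNorm G α := by
  have h := sphInt_sq_le hG x (a := T) (b := T + ‖x‖ / 5) (s₀ := T) (α := α) hT0.le (by linarith)
    ⟨le_rfl, by linarith⟩ (by linarith) (by linarith)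
  refine h.trans ((mul_le_mul' (lintegral_near_kernel_le hT0 hα x (by linarith) (by linarith))
    le_rfl).trans ?_)
  have hm := sphMass_nonneg
  have e1 : (‖x‖ / 2) ^ (-α) ≤ 16 * ‖x‖ ^ (-α) := by
    rw [div_rpow (by positivity) (by norm_num), div_eq_mul_inv, ← rpow_neg (by norm_num), neg_neg,
      mul_comm]
    gcongr
    calc (2 : ℝ) ^ α ≤ 2 ^ (4 : ℝ) := rpow_le_rpow_of_exponent_le (by norm_num) hα4
      _ = 16 := by norm_num
  rw [← mul_assoc, ← ENNReal.ofReal_mul (by positivity)]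
  unfold wNorm
  gcongr ENNReal.ofReal ?_ * _
  have := mul_le_mul_of_nonneg_right e1 (by positivity : 0 ≤ T⁻¹ * sphMass * 200)
  nlinarith

end

section

theorem le_ofReal_sqrt_of_sq_le {a : ℝ≥0∞} {Q : ℝ} (h : a ^ 2 ≤ ENNReal.ofReal Q) :
    a ≤ ENNReal.ofReal (√Q) := by
  rcases le_total 0 Q with hQ | hQ
  · refine (ENNReal.pow_right_strictMono two_ne_zero).le_iff_le.1 ?_
    rwa [← ENNReal.ofReal_pow (sqrt_nonneg _), sq_sqrt hQ]
  · rw [ENNReal.ofReal_of_nonpos hQ, nonpos_iff_eq_zero, pow_eq_zero_iff two_ne_zero] at h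
    rw [h]
    exact zero_le

section Norms

variable {p γ : ℝ} {φ : ℝ → E3 → ℝ}

theorem add_le_two_mul_wEnergy {a b : ℝ≥0∞} (ha : a ≤ wEnergy p 1 γ φ)
    (hb : b ≤ wEnergy p 1 γ φ) (hfin : wEnergy p 1 γ φ < ⊤) :
    a + b ≤ ENNReal.ofReal (2 * (wEnergy p 1 γ φ).toReal) := by
  rw [ENNReal.ofReal_mul (by norm_num), ENNReal.ofReal_toReal hfin.ne, ENNReal.ofReal_ofNat, two_mul]
  exact add_le_add ha hb

theorem wNorm_time_derivative_le (hγ : 1 ≤ γ) (hφ : ContDiff ℝ 2 (φ 0))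
    (hφt : ContDiff ℝ 1 (dt1 φ 0)) (hfin : wEnergy p 1 γ φ < ⊤) :
    wNorm (dt1 φ 0) (γ + 2) ≤ ENNReal.ofReal (2 * (wEnergy p 1 γ φ).toReal) := by
  have h1 := setLIntegral_hessian_le_wEnergy (p := p) (φ := φ) (by linarith : 0 ≤ γ) extDom
  have h2 := (setLIntegral_gradient_le_wEnergy (p := p) (φ := φ) (by linarith : 0 ≤ γ)
    extDom).trans wEnergy_mono
  have hm := (hφt.continuous_fderiv one_ne_zero).norm.measurable
  have hm' := hφt.continuous.measurable
  have hm2 := (hφ.continuous_fderiv two_ne_zero).norm.measurable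
  refine le_trans ?_ (add_le_two_mul_wEnergy h1 h2 hfin)
  unfold wNorm
  rw [← lintegral_add_right _ (by fun_prop)]
  refine lintegral_mono fun z => ?_
  rw [← ENNReal.ofReal_add (by positivity) (by positivity), add_sub_cancel_right, norm_eq_abs, sq_abs]
  refine ENNReal.ofReal_le_ofReal (add_le_add ?_ ?_)
  · gcongr
    linarith [sq_nonneg ‖fderiv ℝ (fderiv ℝ (φ 0)) z‖]
  · gcongr
    linarith [sq_nonneg ‖fderiv ℝ (φ 0) z‖]

theorem wNorm_gradient_le (hγ : 1 ≤ γ) (hφ : ContDiff ℝ 2 (φ 0))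
    (hφt : ContDiff ℝ 1 (dt1 φ 0)) (hfin : wEnergy p 1 γ φ < ⊤) :
    wNorm (fderiv ℝ (φ 0)) (γ + 2) ≤ ENNReal.ofReal (2 * (wEnergy p 1 γ φ).toReal) := by
  have h1 := setLIntegral_hessian_le_wEnergy (p := p) (φ := φ) (by linarith : 0 ≤ γ) extDom
  have h2 := (setLIntegral_gradient_le_wEnergy (p := p) (φ := φ) (by linarith : 0 ≤ γ)
    extDom).trans wEnergy_mono
  have hm := (hφt.continuous_fderiv one_ne_zero).norm.measurable
  have hm' := hφt.continuous.measurable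
  have hm2 := (hφ.continuous_fderiv two_ne_zero).norm.measurable
  refine le_trans ?_ (add_le_two_mul_wEnergy h1 h2 hfin)
  unfold wNorm
  rw [← lintegral_add_right _ (by fun_prop)]
  refine lintegral_mono fun z => ?_
  rw [← ENNReal.ofReal_add (by positivity) (by positivity), add_sub_cancel_right]
  refine ENNReal.ofReal_le_ofReal (add_le_add ?_ ?_)
  · gcongr
    linarith [sq_nonneg ‖fderiv ℝ (dt1 φ 0) z‖]
  · gcongr
    linarith [sq_nonneg (dt1 φ 0 z)]

theorem wNorm_data_le (hγ : 1 ≤ γ) (hp : 1 < p) (hφ : ContDiff ℝ 2 (φ 0))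
    (hφt : ContDiff ℝ 1 (dt1 φ 0)) (hfin : wEnergy p 1 γ φ < ⊤) :
    wNorm (φ 0) γ ≤ ENNReal.ofReal (2 * (wEnergy p 1 γ φ).toReal) := by
  have hφ1 : ContDiff ℝ 1 (φ 0) := hφ.of_le one_le_two
  have h1 := (setLIntegral_sq_le_wEnergy hγ hp hφ1
    (ne_top_of_le_ne_top hfin.ne wEnergy_mono)).trans wEnergy_mono
  have h2 := (setLIntegral_gradient_le_wEnergy (p := p) (φ := φ) (by linarith : 0 ≤ γ)
    extDom).trans wEnergy_mono
  have hm' := hφt.continuous.measurable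
  have hm1 := hφ1.continuous.measurable
  have hm2 := (hφ1.continuous_fderiv one_ne_zero).norm.measurable
  refine le_trans ?_ (add_le_two_mul_wEnergy h2 h1 hfin)
  unfold wNorm
  rw [← lintegral_add_right _ (by fun_prop)]
  refine lintegral_mono fun z => ?_
  rw [← ENNReal.ofReal_add (by positivity) (by positivity), norm_eq_abs (φ 0 z), sq_abs]
  refine ENNReal.ofReal_le_ofReal (add_le_add ?_ le_rfl)
  gcongr
  linarith [sq_nonneg (dt1 φ 0 z)]

end Norms

section Spheres

variable {V : Type*} [NormedAddCommGroup V] [NormedSpace ℝ V] [CompleteSpace V]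
  {G : E3 → V} {γ M T : ℝ} {x : E3}

/-- The squared bound for the spherical traces of the data. -/
def traceBound (γ M T : ℝ) (x : E3) : ℝ :=
  sphMass * M * (‖x‖ ^ 2)⁻¹ * (‖x‖ - T) ^ (1 - γ)

theorem rpow_neg_succ_le_traceBound (hγ : 1 ≤ γ) (hM : 0 ≤ M) (hT : 0 ≤ T) (hx : T + 2 ≤ ‖x‖) :
    sphMass * M * ‖x‖ ^ (-γ - 1) ≤ traceBound γ M T x := by
  have hx0 : 0 < ‖x‖ := by linarith
  have hm := sphMass_nonneg
  have e : ‖x‖ ^ (-γ - 1) = (‖x‖ ^ 2)⁻¹ * ‖x‖ ^ (1 - γ) := by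
    rw [← rpow_two, ← rpow_neg hx0.le, ← rpow_add hx0]
    ring_nf
  rw [e, ← mul_assoc]
  unfold traceBound
  exact mul_le_mul_of_nonneg_left (rpow_le_rpow_of_nonpos (by linarith) (by linarith) (by linarith))
    (by positivity)

theorem sphInt_far_derivative_le (hG : ContDiff ℝ 1 G) (hγ : 1 < γ) (hM : 0 ≤ M) (hT0 : 0 < T)
    (hT : ‖x‖ / 4 ≤ T) (hx : T + 2 ≤ ‖x‖) (hN : wNorm G (γ + 2) ≤ ENNReal.ofReal (2 * M)) :
    (ENNReal.ofReal T * sphInt G x T) ^ 2 ≤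
      ENNReal.ofReal (102400 / (γ - 1) * traceBound γ M T x) := by
  have h := sphInt_far_sq_le hG x (α := γ + 2) hT (by linarith) hT0
  have hu : 0 < ‖x‖ - T := by linarith
  have hm := sphMass_nonneg
  have hx0 : 0 < ‖x‖ := by linarith
  have hI : ∫⁻ s in Set.Icc (‖x‖ - T) (‖x‖ + T), ENNReal.ofReal (s ^ (2 - (γ + 2))) ≤
      ENNReal.ofReal ((‖x‖ - T) ^ (1 - γ) / (γ - 1)) := by
    have h1 := lintegral_Ioi_rpow (c := -γ) (r := ‖x‖ - T) (by linarith) hu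
    rw [show (‖x‖ - T) ^ (1 - γ) / (γ - 1) = (‖x‖ - T) ^ (-γ + 1) / (-(-γ + 1)) by ring_nf, ← h1,
      restrict_Ioi_eq_restrict_Ici]
    rw [show 2 - (γ + 2) = -γ by ring]
    exact lintegral_mono_set fun s hs => hs.1
  rw [mul_pow, ← ENNReal.ofReal_pow hT0.le]
  refine (mul_le_mul' le_rfl (h.trans (mul_le_mul' (mul_le_mul' le_rfl hI) hN))).trans ?_
  have hg : 0 < γ - 1 := by linarith
  rw [← ENNReal.ofReal_mul (by positivity), ← ENNReal.ofReal_mul (by positivity),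
    ← ENNReal.ofReal_mul (by positivity)]
  refine ENNReal.ofReal_le_ofReal ?_
  unfold traceBound
  have e : (T ^ 2)⁻¹ ≤ 16 * (‖x‖ ^ 2)⁻¹ := by
    rw [show 16 * (‖x‖ ^ 2)⁻¹ = ((‖x‖ / 4) ^ 2)⁻¹ by field_simp; norm_num]
    gcongr
  have h2 := mul_le_mul_of_nonneg_left e
    (by positivity : 0 ≤ 6400 / (γ - 1) * (sphMass * M * (‖x‖ - T) ^ (1 - γ)))
  calc _ = 6400 / (γ - 1) * (sphMass * M * (‖x‖ - T) ^ (1 - γ)) * (T ^ 2)⁻¹ := by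
        field_simp
        ring
    _ ≤ _ := h2
    _ = _ := by ring

theorem sphInt_far_data_le (hG : ContDiff ℝ 1 G) (hγ : 1 < γ) (hγ2 : γ < 2) (hM : 0 ≤ M)
    (hT : ‖x‖ / 4 ≤ T) (hx : T + 1 < ‖x‖) (hT0 : 0 < T)
    (hN : wNorm G γ ≤ ENNReal.ofReal (2 * M)) :
    sphInt G x T ^ 2 ≤ ENNReal.ofReal (6553600 * (sphMass * M * ‖x‖ ^ (-γ - 1))) := by
  have h := sphInt_far_sq_le hG x (α := γ) hT hx hT0
  have hm := sphMass_nonneg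
  have hx0 : 0 < ‖x‖ := by linarith
  have hI : ∫⁻ s in Set.Icc (‖x‖ - T) (‖x‖ + T), ENNReal.ofReal (s ^ (2 - γ)) ≤
      ENNReal.ofReal (4 * ‖x‖ ^ (3 - γ)) := by
    have h1 := lintegral_Ioc_rpow (c := 2 - γ) (r := 2 * ‖x‖) (by linarith) (by linarith)
    refine (lintegral_mono_set (fun s hs => ⟨by linarith [hs.1], by linarith [hs.2]⟩ :
      Set.Icc (‖x‖ - T) (‖x‖ + T) ⊆ Set.Ioc 0 (2 * ‖x‖))).trans (h1.le.trans ?_)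
    refine ENNReal.ofReal_le_ofReal ((div_le_self (by positivity) (by linarith)).trans ?_)
    rw [show 2 - γ + 1 = 3 - γ by ring, mul_rpow (by norm_num) (by positivity)]
    gcongr
    calc (2 : ℝ) ^ (3 - γ) ≤ 2 ^ (2 : ℝ) := rpow_le_rpow_of_exponent_le (by norm_num) (by linarith)
      _ = 4 := by norm_num
  refine (h.trans (mul_le_mul' (mul_le_mul' le_rfl hI) hN)).trans ?_
  rw [← ENNReal.ofReal_mul (by positivity), ← ENNReal.ofReal_mul (by positivity)]
  refine ENNReal.ofReal_le_ofReal ?_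
  have e : (T ^ 4)⁻¹ ≤ 256 * (‖x‖ ^ 4)⁻¹ := by
    rw [show 256 * (‖x‖ ^ 4)⁻¹ = ((‖x‖ / 4) ^ 4)⁻¹ by field_simp; norm_num]
    gcongr
  have h2 := mul_le_mul_of_nonneg_left e
    (by positivity : 0 ≤ 25600 * (sphMass * M * ‖x‖ ^ (3 - γ)))
  have e2 : ‖x‖ ^ (-γ - 1) = ‖x‖ ^ (3 - γ) * (‖x‖ ^ 4)⁻¹ := by
    rw [show (-γ - 1) = (3 - γ) - (4 : ℕ) by push_cast; ring, rpow_sub_natCast hx0.ne',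
      div_eq_mul_inv]
  rw [e2]
  linarith

theorem sphInt_near_derivative_le (hG : ContDiff ℝ 1 G) (hγ : 1 < γ) (hγ2 : γ < 2)
    (hT0 : 0 < T) (hT : T ≤ ‖x‖ / 4) (hx : 2 ≤ ‖x‖) (hM : 0 ≤ M)
    (hN : wNorm G (γ + 2) ≤ ENNReal.ofReal (2 * M)) :
    sphInt G x T ^ 2 ≤ ENNReal.ofReal (6400 * (sphMass * M * ‖x‖ ^ (-γ - 2) * T⁻¹)) := by
  have h := sphInt_near_sq_le hG x (α := γ + 2) hT hx hT0 (by linarith) (by linarith)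
  have hm := sphMass_nonneg
  refine (h.trans (mul_le_mul' le_rfl hN)).trans_eq ?_
  rw [← ENNReal.ofReal_mul (by positivity), show -(γ + 2) = -γ - 2 by ring]
  congr 1
  ring

theorem sphInt_near_derivative_mul_le (hG : ContDiff ℝ 1 G) (hγ : 1 < γ) (hγ2 : γ < 2)
    (hM : 0 ≤ M) (hT0 : 0 < T) (hT : T ≤ ‖x‖ / 4) (hx : T + 2 ≤ ‖x‖)
    (hN : wNorm G (γ + 2) ≤ ENNReal.ofReal (2 * M)) :
    (ENNReal.ofReal T * sphInt G x T) ^ 2 ≤ ENNReal.ofReal (6400 * traceBound γ M T x) := by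
  have h := sphInt_near_derivative_le hG hγ hγ2 hT0 hT (by linarith) hM hN
  have hm := sphMass_nonneg
  have hx0 : 0 < ‖x‖ := by linarith
  rw [mul_pow, ← ENNReal.ofReal_pow hT0.le]
  refine (mul_le_mul' le_rfl h).trans ?_
  rw [← ENNReal.ofReal_mul (by positivity)]
  refine ENNReal.ofReal_le_ofReal ?_
  refine le_trans ?_ (mul_le_mul_of_nonneg_left
    (rpow_neg_succ_le_traceBound hγ.le hM hT0.le hx) (by norm_num))
  have e : ‖x‖ ^ (-γ - 1) = ‖x‖ ^ (-γ - 2) * ‖x‖ := by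
    rw [← rpow_add_one hx0.ne']
    ring_nf
  rw [e]
  have h2 := mul_le_mul_of_nonneg_left (show T ≤ ‖x‖ by linarith)
    (by positivity : 0 ≤ 6400 * (sphMass * M * ‖x‖ ^ (-γ - 2)))
  calc _ = 6400 * (sphMass * M * ‖x‖ ^ (-γ - 2)) * T := by
        field_simp
    _ ≤ _ := h2
    _ = _ := by ring

theorem sphInt_near_data_le (hG : ContDiff ℝ 2 G) (hγ : 1 < γ) (hγ2 : γ < 2) (hM : 0 ≤ M)
    (hT0 : 0 ≤ T) (hT : T ≤ ‖x‖ / 4) (hx : T + 2 ≤ ‖x‖)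
    (hN : wNorm G γ ≤ ENNReal.ofReal (2 * M))
    (hN' : wNorm (fderiv ℝ G) (γ + 2) ≤ ENNReal.ofReal (2 * M)) :
    sphInt G x T ≤ ENNReal.ofReal (2640 * √(traceBound γ M T x)) := by
  have hm := sphMass_nonneg
  have hx0 : 0 < ‖x‖ := by linarith
  have h1 := sphInt_le_add (hG.of_le one_le_two) x hT
  have h2 := le_ofReal_sqrt_of_sq_le (sphInt_far_data_le (hG.of_le one_le_two) hγ hγ2 hM
    (T := ‖x‖ / 4) le_rfl (by linarith) (by linarith) hN)
  set N := sphMass * M * ‖x‖ ^ (-γ - 1) with hNdef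
  have hN0 : 0 ≤ N := by positivity
  have h3 : ∫⁻ s in Set.Ioc T (‖x‖ / 4), sphInt (fderiv ℝ G) x s ≤ ENNReal.ofReal (80 * √N) := by
    calc ∫⁻ s in Set.Ioc T (‖x‖ / 4), sphInt (fderiv ℝ G) x s
        ≤ ∫⁻ s in Set.Ioc T (‖x‖ / 4), ENNReal.ofReal (80 * √(N * ‖x‖⁻¹)) *
            ENNReal.ofReal (s ^ (-(1 / 2) : ℝ)) := by
          refine setLIntegral_mono' measurableSet_Ioc fun s hs => ?_
          have hs0 : 0 < s := hT0.trans_lt hs.1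
          have h4 := le_ofReal_sqrt_of_sq_le (sphInt_near_derivative_le
            (hG.fderiv_right (m := 1) le_rfl) hγ hγ2 hs0 hs.2 (by linarith) hM hN')
          refine h4.trans_eq ?_
          rw [← ENNReal.ofReal_mul (by positivity)]
          congr 1
          have e : ‖x‖ ^ (-γ - 2) = ‖x‖ ^ (-γ - 1) * ‖x‖⁻¹ := by
            rw [show -γ - 2 = (-γ - 1) - 1 by ring, rpow_sub_one hx0.ne', div_eq_mul_inv]
          rw [rpow_neg hs0.le, ← sqrt_eq_rpow, ← sqrt_inv, mul_assoc 80, ← sqrt_mul (by positivity),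
            show (80 : ℝ) = √6400 by rw [show (6400 : ℝ) = 80 ^ 2 by norm_num]; simp,
            ← sqrt_mul (by norm_num), hNdef, e]
          congr 1
          ring
      _ ≤ ENNReal.ofReal (80 * √(N * ‖x‖⁻¹)) * ∫⁻ s in Set.Ioc 0 (‖x‖ / 4),
            ENNReal.ofReal (s ^ (-(1 / 2) : ℝ)) := by
          rw [lintegral_const_mul' _ _ ENNReal.ofReal_ne_top]
          gcongr 1
          exact lintegral_mono_set (Set.Ioc_subset_Ioc_left hT0)
      _ = ENNReal.ofReal (80 * √N) := by
          rw [lintegral_Ioc_rpow (by norm_num) (by linarith), ← ENNReal.ofReal_mul (by positivity)]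
          congr 1
          rw [show -(1 / 2) + 1 = (1 / 2 : ℝ) by norm_num, ← sqrt_eq_rpow,
            sqrt_div (by positivity), show (4 : ℝ) = 2 ^ 2 by norm_num, sqrt_sq (by norm_num),
            sqrt_mul hN0, sqrt_inv]
          field_simp
  have hle := sqrt_le_sqrt (rpow_neg_succ_le_traceBound (x := x) hγ.le hM hT0 hx)
  refine (h1.trans (add_le_add h2 h3)).trans ?_
  rw [← ENNReal.ofReal_add (by positivity) (by positivity)]
  refine ENNReal.ofReal_le_ofReal ?_
  rw [sqrt_mul (by norm_num), show √(6553600 : ℝ) = 2560 by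
    rw [show (6553600 : ℝ) = 2560 ^ 2 by norm_num]; simp]
  linarith

end Spheres

end

section

variable {p γ : ℝ} {φ : ℝ → E3 → ℝ}

theorem contDiff_space_slice {F : ℝ × E3 → ℝ} {n : WithTop ℕ∞} (hF : ContDiff ℝ n F) (t : ℝ) :
    ContDiff ℝ n fun x => F (t, x) :=
  hF.comp (by fun_prop : ContDiff ℝ n fun x : E3 => (t, x))

theorem dt1_eq_dT (hF : ContDiff ℝ 2 fun q : ℝ × E3 => φ q.1 q.2) (t : ℝ) :
    dt1 φ t = fun x => dT (fun q : ℝ × E3 => φ q.1 q.2) (t, x) := by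
  funext x
  exact (hasDerivAt_time_slice hF t x).deriv

theorem contDiff_dt1 (hF : ContDiff ℝ 2 fun q : ℝ × E3 => φ q.1 q.2) (t : ℝ) :
    ContDiff ℝ 1 (dt1 φ t) := by
  rw [dt1_eq_dT hF]
  exact contDiff_space_slice (contDiff_dT hF) t

theorem abs_fderiv_cone_le (hF : ContDiff ℝ 2 fun q : ℝ × E3 => φ q.1 q.2) (t : ℝ) (z : E3)
    (ω : Metric.sphere (0 : E3) 1) :
    |fderiv ℝ (fun q : ℝ × E3 => φ q.1 q.2) (t, z) (1, (ω : E3))| ≤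
      ‖dt1 φ t z‖ + ‖fderiv ℝ (φ t) z‖ := by
  have h1 : HasFDerivAt (φ t) _ z :=
    ((hF.differentiable two_ne_zero) (t, z)).hasFDerivAt.comp z
      (hasFDerivAt_prodMk_right (𝕜 := ℝ) t z)
  have h2 : fderiv ℝ (φ t) z ω = fderiv ℝ (fun q : ℝ × E3 => φ q.1 q.2) (t, z) (0, (ω : E3)) := by
    rw [h1.fderiv]
    rfl
  have h3 : dt1 φ t z = fderiv ℝ (fun q : ℝ × E3 => φ q.1 q.2) (t, z) (1, 0) :=
    (hasDerivAt_time_slice hF t z).deriv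
  have h4 : ((1 : ℝ), (ω : E3)) = (1, 0) + (0, (ω : E3)) := by simp
  rw [h4, map_add, ← h3, ← h2]
  refine (abs_add_le _ _).trans (add_le_add le_rfl ?_)
  have := (fderiv ℝ (φ t) z).le_opNorm ω
  rwa [norm_eq_of_mem_sphere, mul_one] at this

theorem lintegral_data_le (hF : ContDiff ℝ 2 fun q : ℝ × E3 => φ q.1 q.2) {T : ℝ} (hT : 0 ≤ T)
    (x : E3) :
    (∫⁻ ω : Metric.sphere (0 : E3) 1, ENNReal.ofReal (|φ 0 (x + T • (ω : E3))| +
        T * |fderiv ℝ (fun q : ℝ × E3 => φ q.1 q.2) (0, x + T • (ω : E3)) (1, (ω : E3))|)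
          ∂sphereMeasure) ≤
      sphInt (φ 0) x T + (ENNReal.ofReal T * sphInt (dt1 φ 0) x T +
        ENNReal.ofReal T * sphInt (fderiv ℝ (φ 0)) x T) := by
  have hφ : ContDiff ℝ 2 (φ 0) := contDiff_space_slice hF 0
  have hc : Continuous fun ω : Metric.sphere (0 : E3) 1 => x + T • (ω : E3) := by fun_prop
  have m1 : Measurable fun ω : Metric.sphere (0 : E3) 1 =>
      ENNReal.ofReal ‖φ 0 (x + T • (ω : E3))‖ :=
    (hφ.continuous.comp hc).norm.measurable.ennreal_ofReal
  have m2 : Measurable fun ω : Metric.sphere (0 : E3) 1 =>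
      ENNReal.ofReal ‖dt1 φ 0 (x + T • (ω : E3))‖ :=
    ((contDiff_dt1 hF 0).continuous.comp hc).norm.measurable.ennreal_ofReal
  unfold sphInt
  rw [← lintegral_const_mul' _ _ ENNReal.ofReal_ne_top, ← lintegral_const_mul' _ _ ENNReal.ofReal_ne_top,
    ← lintegral_add_left (m2.const_mul _), ← lintegral_add_left m1]
  refine lintegral_mono fun ω => ?_
  rw [← ENNReal.ofReal_mul hT, ← ENNReal.ofReal_mul hT,
    ← ENNReal.ofReal_add (by positivity) (by positivity),
    ← ENNReal.ofReal_add (by positivity) (by positivity), ← mul_add, norm_eq_abs (φ 0 _)]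
  refine ENNReal.ofReal_le_ofReal (add_le_add le_rfl ?_)
  exact mul_le_mul_of_nonneg_left (abs_fderiv_cone_le hF 0 _ ω) hT

/-- Decay of the free part in the exterior region. -/
theorem exists_lintegral_data_le (hp : 1 < p) (hγ : 1 < γ) (hγ2 : γ < 2) :
    ∃ C : ℝ, 0 ≤ C ∧ ∀ φ : ℝ → E3 → ℝ, IsNLWSolution p φ → wEnergy p 1 γ φ < ⊤ →
      ∀ T : ℝ, 0 ≤ T → ∀ x : E3, T + 2 ≤ ‖x‖ →
      (∫⁻ ω : Metric.sphere (0 : E3) 1, ENNReal.ofReal (|φ 0 (x + T • (ω : E3))| +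
        T * |fderiv ℝ (fun q : ℝ × E3 => φ q.1 q.2) (0, x + T • (ω : E3)) (1, (ω : E3))|)
          ∂sphereMeasure) ≤ ENNReal.ofReal (C * (‖x‖⁻¹ * (‖x‖ - T) ^ (-(γ - 1) / 2) *
            √(wEnergy p 1 γ φ).toReal)) := by
  have hm := sphMass_nonneg
  have hg : 0 < γ - 1 := by linarith
  refine ⟨(2640 + 2 * √(102400 / (γ - 1))) * √sphMass, by positivity, fun φ hφs hfin T hT x hx => ?_⟩
  have hF : ContDiff ℝ 2 (fun q : ℝ × E3 => φ q.1 q.2) :=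
    hφs.1.of_le (WithTop.coe_le_coe.2 (le_top : (2 : ℕ∞) ≤ ⊤))
  have hφ : ContDiff ℝ 2 (φ 0) := contDiff_space_slice hF 0
  have hφ1 : ContDiff ℝ 1 (φ 0) := hφ.of_le one_le_two
  have hφt := contDiff_dt1 hF 0
  have hφd : ContDiff ℝ 1 (fderiv ℝ (φ 0)) := hφ.fderiv_right (m := 1) le_rfl
  set M := (wEnergy p 1 γ φ).toReal with hM
  have hM0 : 0 ≤ M := ENNReal.toReal_nonneg
  have n1 := wNorm_time_derivative_le hγ.le hφ hφt hfin
  have n2 := wNorm_gradient_le hγ.le hφ hφt hfin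
  have n3 := wNorm_data_le hγ.le hp hφ hφt hfin
  have hx0 : 0 < ‖x‖ := by linarith
  have hu : 0 < ‖x‖ - T := by linarith
  have hsq : √(traceBound γ M T x) = √sphMass * (‖x‖⁻¹ * (‖x‖ - T) ^ (-(γ - 1) / 2) * √M) := by
    unfold traceBound
    have e : (‖x‖ - T) ^ (1 - γ) = ((‖x‖ - T) ^ (-(γ - 1) / 2)) ^ 2 := by
      rw [← rpow_natCast, ← rpow_mul hu.le]
      ring_nf
    rw [e, sqrt_mul (by positivity), sqrt_sq (by positivity), sqrt_mul (by positivity), ← inv_pow,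
      sqrt_sq (by positivity), sqrt_mul hm]
    ring
  set Q := traceBound γ M T x with hQ
  have hQ0 : 0 ≤ Q := by
    rw [hQ]
    unfold traceBound
    positivity
  have hK : (102400 : ℝ) ≤ 102400 / (γ - 1) := by
    rw [le_div_iff₀ hg]
    linarith
  have key : ∀ {V : Type} [NormedAddCommGroup V] [NormedSpace ℝ V] [CompleteSpace V] (G : E3 → V),
      ContDiff ℝ 1 G → wNorm G (γ + 2) ≤ ENNReal.ofReal (2 * M) →
      ENNReal.ofReal T * sphInt G x T ≤ ENNReal.ofReal (√(102400 / (γ - 1)) * √Q) := by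
    intro V _ _ _ G hG hN
    rw [← sqrt_mul (by positivity)]
    rcases hT.eq_or_lt with h0 | h0
    · rw [← h0, ENNReal.ofReal_zero, zero_mul]
      exact zero_le
    refine le_ofReal_sqrt_of_sq_le ?_
    rcases le_total T (‖x‖ / 4) with h | h
    · refine (sphInt_near_derivative_mul_le hG hγ hγ2 hM0 h0 h hx hN).trans
        (ENNReal.ofReal_le_ofReal ?_)
      rw [← hQ]
      gcongr
      linarith
    · exact sphInt_far_derivative_le hG hγ hM0 h0 h hx hN
  have k1 := key _ hφt n1
  have k2 := key _ hφd n2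
  have k3 : sphInt (φ 0) x T ≤ ENNReal.ofReal (2640 * √Q) := by
    rcases le_total T (‖x‖ / 4) with h | h
    · exact sphInt_near_data_le hφ hγ hγ2 hM0 hT h hx n3 n2
    · have h4 := le_ofReal_sqrt_of_sq_le (sphInt_far_data_le hφ1 hγ hγ2 hM0 h (by linarith)
        (by linarith) n3)
      refine h4.trans (ENNReal.ofReal_le_ofReal ?_)
      rw [show (2640 : ℝ) = √(2640 ^ 2) by simp, ← sqrt_mul (by norm_num)]
      refine sqrt_le_sqrt ?_
      have h5 := rpow_neg_succ_le_traceBound hγ.le hM0 hT hx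
      rw [← hQ] at h5
      linarith
  refine (lintegral_data_le hF hT x).trans ((add_le_add k3 (add_le_add k1 k2)).trans ?_)
  rw [← ENNReal.ofReal_add (by positivity) (by positivity),
    ← ENNReal.ofReal_add (by positivity) (by positivity)]
  refine ENNReal.ofReal_le_ofReal (le_of_eq ?_)
  rw [hsq]
  ring

end

theorem lintegral_sqrt_comp (z : ℝ) (h : ℝ → ℝ≥0∞) :
    ∫⁻ ρ in Set.Ioi (0 : ℝ), ENNReal.ofReal ρ * h √(z ^ 2 + ρ ^ 2) =
      ∫⁻ s in Set.Ioi |z|, ENNReal.ofReal s * h s := by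
  have hpos : ∀ ρ ∈ Set.Ioi (0 : ℝ), 0 < z ^ 2 + ρ ^ 2 := fun ρ hρ => by
    have : (0 : ℝ) < ρ ^ 2 := pow_pos hρ 2
    positivity
  have himg : (fun ρ : ℝ => √(z ^ 2 + ρ ^ 2)) '' Set.Ioi 0 = Set.Ioi |z| := by
    ext s
    constructor
    · rintro ⟨ρ, hρ, rfl⟩
      have : (0 : ℝ) < ρ ^ 2 := pow_pos hρ 2
      exact lt_sqrt_of_sq_lt (by rw [sq_abs]; linarith)
    · intro hs
      have hs0 : 0 < s := (abs_nonneg z).trans_lt hs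
      have h2 : z ^ 2 < s ^ 2 := by
        rw [← sq_abs z]
        exact pow_lt_pow_left₀ hs (abs_nonneg _) two_ne_zero
      refine ⟨√(s ^ 2 - z ^ 2), sqrt_pos.2 (by linarith), ?_⟩
      simp only
      rw [sq_sqrt (by linarith), add_sub_cancel, sqrt_sq hs0.le]
  have hderiv : ∀ ρ ∈ Set.Ioi (0 : ℝ), HasDerivWithinAt (fun ρ : ℝ => √(z ^ 2 + ρ ^ 2))
      (ρ / √(z ^ 2 + ρ ^ 2)) (Set.Ioi 0) ρ := fun ρ hρ => by
    have h1 : HasDerivAt (fun ρ : ℝ => z ^ 2 + ρ ^ 2) (2 * ρ) ρ := by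
      simpa using (hasDerivAt_pow 2 ρ).const_add (z ^ 2)
    refine ((h1.sqrt (hpos ρ hρ).ne').congr_deriv ?_).hasDerivWithinAt
    have := sqrt_pos.2 (hpos ρ hρ)
    field_simp
  have hinj : Set.InjOn (fun ρ : ℝ => √(z ^ 2 + ρ ^ 2)) (Set.Ioi 0) := by
    intro a ha b hb hab
    have h1 := (sqrt_inj (hpos a ha).le (hpos b hb).le).1 hab
    exact (pow_left_inj₀ (le_of_lt ha) (le_of_lt hb) two_ne_zero).1 (by linarith)
  rw [← himg, lintegral_image_eq_lintegral_abs_deriv_mul measurableSet_Ioi hderiv hinj]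
  refine setLIntegral_congr_fun measurableSet_Ioi fun ρ hρ => ?_
  have h1 := sqrt_pos.2 (hpos ρ hρ)
  have h2 : (0 : ℝ) < ρ := hρ
  rw [← mul_assoc, ← ENNReal.ofReal_mul (abs_nonneg _), abs_of_pos (by positivity)]
  congr 2
  field_simp

theorem lintegral_plane_radial {h : ℝ → ℝ≥0∞} (hh : Measurable h) (z : ℝ) :
    ∫⁻ w : ℝ × ℝ, h √(z ^ 2 + (w.1 ^ 2 + w.2 ^ 2)) =
      ENNReal.ofReal (2 * π) * ∫⁻ s in Set.Ioi |z|, ENNReal.ofReal s * h s := by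
  rw [← lintegral_comp_polarCoord_symm, ← lintegral_sqrt_comp, polarCoord_target,
    Measure.volume_eq_prod, ← Measure.prod_restrict]
  have e : ∀ q : ℝ × ℝ, ENNReal.ofReal q.1 • h √(z ^ 2 + ((polarCoord.symm q).1 ^ 2 +
      (polarCoord.symm q).2 ^ 2)) = ENNReal.ofReal q.1 * h √(z ^ 2 + q.1 ^ 2) := fun q => by
    rw [polarCoord_symm_apply, smul_eq_mul]
    congr 4
    simp only
    linear_combination q.1 ^ 2 * cos_sq_add_sin_sq q.2
  simp only [e]
  rw [lintegral_prod _ (by fun_prop)]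
  simp only [lintegral_const, Measure.restrict_apply MeasurableSet.univ, Set.univ_inter,
    Real.volume_Ioo]
  rw [lintegral_mul_const _ (by fun_prop), mul_comm]
  congr 2
  ring

theorem lintegral_norm_coord {f : ℝ → ℝ → ℝ≥0∞} (hf : Measurable (Function.uncurry f)) :
    ∫⁻ y : E3, f ‖y‖ (y 0) =
      ENNReal.ofReal (2 * π) * ∫⁻ z : ℝ, ∫⁻ s in Set.Ioi |z|, ENNReal.ofReal s * f s z := by
  have e2 := volume_preserving_piFinSuccAbove (fun _ : Fin 3 => ℝ) 0
  have hg : Measurable fun v : ℝ × (Fin 2 → ℝ) => f √(v.1 ^ 2 + (v.2 0 ^ 2 + v.2 1 ^ 2)) v.1 :=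
    hf.comp (by fun_prop :
      Measurable fun v : ℝ × (Fin 2 → ℝ) => (√(v.1 ^ 2 + (v.2 0 ^ 2 + v.2 1 ^ 2)), v.1))
  have h1 : ∫⁻ y : E3, f ‖y‖ (y 0) =
      ∫⁻ v : Fin 3 → ℝ, f √(v 0 ^ 2 + (v 1 ^ 2 + v 2 ^ 2)) (v 0) := by
    have hm : Measurable fun v : Fin 3 → ℝ => f √(v 0 ^ 2 + (v 1 ^ 2 + v 2 ^ 2)) (v 0) :=
      hf.comp (by fun_prop :
        Measurable fun v : Fin 3 → ℝ => (√(v 0 ^ 2 + (v 1 ^ 2 + v 2 ^ 2)), v 0))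
    rw [← (PiLp.volume_preserving_ofLp (Fin 3)).lintegral_comp hm]
    refine lintegral_congr fun y => ?_
    rw [← add_assoc, ← norm_sq_eq, sqrt_sq (norm_nonneg y)]
  have h2 : ∫⁻ v : Fin 3 → ℝ, f √(v 0 ^ 2 + (v 1 ^ 2 + v 2 ^ 2)) (v 0) =
      ∫⁻ v : ℝ × (Fin 2 → ℝ), f √(v.1 ^ 2 + (v.2 0 ^ 2 + v.2 1 ^ 2)) v.1 := by
    rw [← e2.lintegral_comp hg]
    rfl
  rw [h1, h2, Measure.volume_eq_prod, lintegral_prod _ hg.aemeasurable,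
    ← lintegral_const_mul' _ _ ENNReal.ofReal_ne_top]
  refine lintegral_congr fun z => ?_
  have hfz : Measurable fun s => f s z := hf.comp (by fun_prop : Measurable fun s : ℝ => (s, z))
  have hw : Measurable fun w : ℝ × ℝ => f √(z ^ 2 + (w.1 ^ 2 + w.2 ^ 2)) z :=
    hfz.comp (by fun_prop : Measurable fun w : ℝ × ℝ => √(z ^ 2 + (w.1 ^ 2 + w.2 ^ 2)))
  rw [← lintegral_plane_radial hfz z]
  exact (volume_preserving_finTwoArrow ℝ).lintegral_comp hw

theorem exists_isometry_to_axis {e : E3} (he : ‖e‖ = 1) :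
    ∃ L : E3 ≃ₗᵢ[ℝ] E3, ∀ y, (L y) 0 = ⟪e, y⟫_ℝ := by
  have hb : ‖e‖ = ‖bv 0‖ := by simp [he]
  refine ⟨(ℝ ∙ (e - bv 0))ᗮ.reflection, fun y => ?_⟩
  have h := Submodule.reflection_sub hb
  have h2 := ((ℝ ∙ (e - bv 0))ᗮ.reflection).inner_map_map e y
  rw [h] at h2
  rw [← h2]
  simp [EuclideanSpace.inner_single_left]

theorem lintegral_ball_norm_inner {f : ℝ → ℝ → ℝ≥0∞} (hf : Measurable (Function.uncurry f))
    {e : E3} (he : ‖e‖ = 1) (T : ℝ) :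
    ∫⁻ y in Metric.ball (0 : E3) T, f ‖y‖ ⟪e, y⟫_ℝ =
      ENNReal.ofReal (2 * π) * ∫⁻ s in Set.Ioo 0 T, ENNReal.ofReal s *
        ∫⁻ μ in Set.Ioo 0 (2 * s), f s (μ - s) := by
  obtain ⟨L, hL⟩ := exists_isometry_to_axis he
  set g : ℝ → ℝ → ℝ≥0∞ := fun s z => (Set.Iio T).indicator (fun _ => f s z) s with hgdef
  have hg : Measurable (Function.uncurry g) := by
    have : Function.uncurry g = (Prod.fst ⁻¹' Set.Iio T).indicator (Function.uncurry f) := by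
      funext q
      simp [hgdef, Function.uncurry, Set.indicator]
    rw [this]
    exact hf.indicator (measurable_fst measurableSet_Iio)
  have h1 : ∫⁻ y in Metric.ball (0 : E3) T, f ‖y‖ ⟪e, y⟫_ℝ = ∫⁻ y : E3, g ‖L y‖ ((L y) 0) := by
    rw [← lintegral_indicator measurableSet_ball]
    refine lintegral_congr fun y => ?_
    simp [hgdef, Set.indicator, hL]
  have hm : Measurable fun y : E3 => g ‖y‖ (y 0) :=
    hg.comp (by fun_prop : Measurable fun y : E3 => (‖y‖, y 0))
  rw [h1, L.measurePreserving.lintegral_comp hm, lintegral_norm_coord hg]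
  congr 1
  have hG : Measurable fun q : ℝ × ℝ => {q : ℝ × ℝ | |q.1| < q.2}.indicator
      (fun q => ENNReal.ofReal q.2 * g q.2 q.1) q := by
    refine Measurable.indicator ?_ (measurableSet_lt (by fun_prop) (by fun_prop))
    have := hg.comp measurable_swap
    exact (by fun_prop : Measurable fun q : ℝ × ℝ => ENNReal.ofReal q.2).mul this
  calc ∫⁻ z : ℝ, ∫⁻ s in Set.Ioi |z|, ENNReal.ofReal s * g s z
      = ∫⁻ z : ℝ, ∫⁻ s : ℝ, {q : ℝ × ℝ | |q.1| < q.2}.indicator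
          (fun q => ENNReal.ofReal q.2 * g q.2 q.1) (z, s) := by
        refine lintegral_congr fun z => ?_
        rw [← lintegral_indicator measurableSet_Ioi]
        rfl
    _ = ∫⁻ s : ℝ, ∫⁻ z : ℝ, {q : ℝ × ℝ | |q.1| < q.2}.indicator
          (fun q => ENNReal.ofReal q.2 * g q.2 q.1) (z, s) :=
        lintegral_lintegral_swap hG.aemeasurable
    _ = _ := by
        rw [← lintegral_indicator measurableSet_Ioo]
        refine lintegral_congr fun s => ?_
        by_cases hs : s ∈ Set.Ioo 0 T
        · rw [Set.indicator_of_mem hs, ← lintegral_const_mul' _ _ ENNReal.ofReal_ne_top,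
            ← lintegral_indicator measurableSet_Ioo, ← lintegral_sub_right_eq_self
              ((Set.Ioo 0 (2 * s)).indicator fun μ => ENNReal.ofReal s * f s (μ - s)) (-s)]
          refine lintegral_congr fun μ => ?_
          have hiff : |μ| < s ↔ μ - -s ∈ Set.Ioo 0 (2 * s) := by
            rw [abs_lt, Set.mem_Ioo]
            constructor <;> rintro ⟨h1, h2⟩ <;> constructor <;> linarith
          by_cases hμ : |μ| < s
          · rw [Set.indicator_of_mem (show (μ, s) ∈ {q : ℝ × ℝ | |q.1| < q.2} from hμ),
              Set.indicator_of_mem (hiff.1 hμ)]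
            simp [hgdef, hs.2]
          · rw [Set.indicator_of_notMem (show (μ, s) ∉ {q : ℝ × ℝ | |q.1| < q.2} from hμ),
              Set.indicator_of_notMem (fun h => hμ (hiff.2 h))]
        · rw [Set.indicator_of_notMem hs, lintegral_eq_zero_iff' (by fun_prop)]
          refine Filter.Eventually.of_forall fun z => ?_
          by_cases hz : |z| < s
          · have hT : ¬ s < T := fun h => hs ⟨(abs_nonneg z).trans_lt hz, h⟩
            simp [Set.indicator, hgdef, hT]
          · simp [Set.indicator, hz]

theorem exp_neg_le_rpow {x η : ℝ} (hx : 0 < x) (h0 : 0 ≤ η) (h1 : η ≤ 1) :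
    exp (-x) ≤ x ^ (-η) := by
  rw [rpow_def_of_pos hx, exp_le_exp]
  have h2 := log_le_sub_one_of_pos hx
  rcases le_total 0 (log x) with h | h <;> nlinarith

theorem mul_le_rpow_neg_sub {ε τ s : ℝ} (hε : 0 ≤ ε) (hs : 0 ≤ s) (hτ : s < τ) :
    ε * s * τ ^ (-1 - ε) ≤ (τ - s) ^ (-ε) - τ ^ (-ε) := by
  have hτ0 : 0 < τ := hs.trans_lt hτ
  have h1 : 0 < 1 - s / τ := by rw [sub_pos, div_lt_one hτ0]; exact hτ
  have h2 : 1 + ε * (s / τ) ≤ (1 - s / τ) ^ (-ε) := by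
    rw [rpow_def_of_pos h1]
    have h3 := log_le_sub_one_of_pos h1
    have h4 := add_one_le_exp (log (1 - s / τ) * -ε)
    nlinarith
  have h5 : (τ - s) ^ (-ε) = τ ^ (-ε) * (1 - s / τ) ^ (-ε) := by
    rw [← mul_rpow hτ0.le h1.le]
    congr 1
    field_simp
  have h6 : τ ^ (-1 - ε) = τ ^ (-ε) / τ := by
    rw [show -1 - ε = -ε - 1 by ring, rpow_sub_one hτ0.ne']
  have h7 : 0 < τ ^ (-ε) := rpow_pos_of_pos hτ0 _
  calc ε * s * τ ^ (-1 - ε) = τ ^ (-ε) * (1 + ε * (s / τ)) - τ ^ (-ε) := by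
        rw [h6]; ring
    _ ≤ _ := by
        rw [h5]
        gcongr

theorem mul_rpow_le_rpow_neg_sub {ε τ τ' : ℝ} (hε : 0 ≤ ε) (hτ : 0 < τ) (h : 2 * τ ≤ τ') :
    (1 - 2 ^ (-ε)) * τ ^ (-ε) ≤ τ ^ (-ε) - τ' ^ (-ε) := by
  have h1 : τ' ^ (-ε) ≤ (2 * τ) ^ (-ε) :=
    rpow_le_rpow_of_nonpos (by positivity) h (by linarith)
  rw [mul_rpow two_pos.le hτ.le] at h1
  linarith

/-- The exponential weight along a backward cone. -/
def expWeight (ε L T s : ℝ) : ℝ := exp (-(L * ((2 + T - s) ^ (-ε) - (2 + T) ^ (-ε))))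

theorem expWeight_nonneg (ε L T s : ℝ) : 0 ≤ expWeight ε L T s := (exp_pos _).le

theorem expWeight_le_near {ε L T s r η : ℝ} (hε : 0 < ε) (hL : 0 < L) (hη0 : 0 ≤ η)
    (hη1 : η ≤ 1) (hs : 0 < s) (hsT : s < T) (hr : T + 2 ≤ r) :
    expWeight ε L T s ≤ (L * (ε * s * r ^ (-1 - ε))) ^ (-η) := by
  have hr0 : 0 < r := by linarith
  refine le_trans (exp_le_exp.2 (neg_le_neg ?_))
    (exp_neg_le_rpow (x := L * (ε * s * r ^ (-1 - ε))) (by positivity) hη0 hη1)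
  gcongr
  refine le_trans ?_ (mul_le_rpow_neg_sub hε.le hs.le (by linarith))
  gcongr ?_ * ?_
  exact rpow_le_rpow_of_nonpos (by linarith) (by linarith) (by linarith)

theorem expWeight_le_far {ε L T s r η : ℝ} (hε : 0 < ε) (hL : 0 < L) (hη0 : 0 ≤ η)
    (hη1 : η ≤ 1) (hsT : s < T) (hr : T + 2 ≤ r) (hsr : r ≤ 2 * s) :
    expWeight ε L T s ≤ (L * ((1 - 2 ^ (-ε)) * (2 + T - s) ^ (-ε))) ^ (-η) := by
  have h1 : 0 < 2 + T - s := by linarith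
  have h2 : (2 : ℝ) ^ (-ε) < 1 := rpow_lt_one_of_one_lt_of_neg one_lt_two (by linarith)
  have h3 : 0 < 1 - (2 : ℝ) ^ (-ε) := by linarith
  refine le_trans (exp_le_exp.2 (neg_le_neg ?_))
    (exp_neg_le_rpow (x := L * ((1 - 2 ^ (-ε)) * (2 + T - s) ^ (-ε))) (by positivity) hη0 hη1)
  gcongr
  exact mul_rpow_le_rpow_neg_sub hε.le h1 (by linarith)

theorem cone_factor_ge {r₀ s μ R : ℝ} (hs : 0 < s) (hsr : s < r₀) (hμ : 0 < μ) (hR : 0 < R)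
    (hRR : R ^ 2 = (r₀ - s) ^ 2 + 2 * r₀ * μ) :
    r₀ * μ / (s * R) ≤ 1 + (s ^ 2 + r₀ * (μ - s)) / (s * R) ∧
      r₀ * μ / R ^ 2 ≤ 1 + (s ^ 2 + r₀ * (μ - s)) / (s * R) := by
  have hr0 : 0 < r₀ := hs.trans hsr
  have hρ : r₀ - s ≤ R := by
    have : 0 < r₀ * μ := by positivity
    nlinarith
  have h1 : 1 + (s ^ 2 + r₀ * (μ - s)) / (s * R) = (s * (R - (r₀ - s)) + r₀ * μ) / (s * R) := by
    field_simp
    ring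
  rw [h1]
  constructor
  · gcongr
    have : 0 ≤ s * (R - (r₀ - s)) := mul_nonneg hs.le (by linarith)
    linarith
  · rw [div_le_div_iff₀ (by positivity) (by positivity)]
    have h2 : r₀ * μ ≤ (R - (r₀ - s)) * R := by nlinarith
    have h3 : 0 ≤ r₀ * μ * R ^ 2 := by positivity
    have h4 : s * R * (r₀ * μ) ≤ s * R * ((R - (r₀ - s)) * R) := by gcongr
    nlinarith

/-- Distance to the origin of the point at distance `s` and axial coordinate `ζ` from a point at
distance `r₀`. -/
def axDist (r₀ s ζ : ℝ) : ℝ := √(r₀ ^ 2 + 2 * r₀ * ζ + s ^ 2)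

/-- The weight of the flux through a backward cone in axial coordinates. -/
def axWeight (γ r₀ s ζ : ℝ) : ℝ :=
  (1 + (s ^ 2 + r₀ * ζ) / (s * axDist r₀ s ζ)) * axDist r₀ s ζ ^ γ + 1

theorem axDist_sq {r₀ s μ : ℝ} (h : 0 ≤ r₀ * μ) :
    axDist r₀ s (μ - s) ^ 2 = (r₀ - s) ^ 2 + 2 * r₀ * μ := by
  have h2 := sq_nonneg (r₀ - s)
  rw [axDist, sq_sqrt (by nlinarith)]
  ring

theorem axDist_pos {r₀ s μ : ℝ} (h : 0 < r₀ * μ) : 0 < axDist r₀ s (μ - s) := by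
  have h2 := sq_nonneg (r₀ - s)
  exact sqrt_pos.2 (by nlinarith)

theorem near_integrand_le {a γ θ r₀ s μ : ℝ} (ha : 0 ≤ a) (hγ1 : 1 ≤ γ) (hγ2 : γ ≤ 2)
    (hθ : 0 ≤ θ) (hs : 0 < s) (hsr : 2 * s ≤ r₀) (hμ : 0 < μ) :
    s ^ (-a) * axWeight γ r₀ s (μ - s) ^ (-θ) * axDist r₀ s (μ - s) ^ (-a) ≤
      2 ^ (a + θ) * r₀ ^ (-a - γ * θ) * s ^ (θ - a) * μ ^ (-θ) := by
  have hr0 : 0 < r₀ := by linarith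
  have hμr : 0 < r₀ * μ := by positivity
  have hR := axDist_pos (s := s) hμr
  have hRR := axDist_sq (s := s) hμr.le
  set R := axDist r₀ s (μ - s) with hRdef
  have hR2 : r₀ / 2 ≤ R := by
    refine le_of_sq_le_sq ?_ hR.le
    rw [hRR]
    nlinarith
  have hw : r₀ ^ γ * μ / (2 * s) ≤ axWeight γ r₀ s (μ - s) := by
    have h1 := (cone_factor_ge hs (by linarith) hμ hR hRR).1
    have h2 : r₀ ^ (γ - 1) / 2 ≤ R ^ (γ - 1) := by
      calc r₀ ^ (γ - 1) / 2 ≤ r₀ ^ (γ - 1) * (1 / 2) ^ (γ - 1) := by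
            rw [div_eq_mul_one_div]
            gcongr
            exact self_le_rpow_of_le_one (by norm_num) (by norm_num) (by linarith)
        _ = (r₀ / 2) ^ (γ - 1) := by
            rw [← mul_rpow hr0.le (by norm_num)]; ring_nf
        _ ≤ R ^ (γ - 1) := rpow_le_rpow (by positivity) hR2 (by linarith)
    have h3 : r₀ ^ γ = r₀ ^ (γ - 1) * r₀ := by rw [← rpow_add_one hr0.ne']; ring_nf
    have h4 : R ^ γ = R ^ (γ - 1) * R := by rw [← rpow_add_one hR.ne']; ring_nf
    calc r₀ ^ γ * μ / (2 * s) = r₀ ^ (γ - 1) / 2 * (r₀ * μ / s) := by rw [h3]; ring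
      _ ≤ R ^ (γ - 1) * (r₀ * μ / s) := by gcongr
      _ = r₀ * μ / (s * R) * R ^ γ := by rw [h4]; field_simp
      _ ≤ _ := by
          rw [axWeight, ← hRdef]
          have : r₀ * μ / (s * R) * R ^ γ ≤
            (1 + (s ^ 2 + r₀ * (μ - s)) / (s * R)) * R ^ γ := by gcongr
          linarith
  have h1 : axWeight γ r₀ s (μ - s) ^ (-θ) ≤ (r₀ ^ γ * μ / (2 * s)) ^ (-θ) :=
    rpow_le_rpow_of_nonpos (by positivity) hw (by linarith)
  have h2 : R ^ (-a) ≤ (r₀ / 2) ^ (-a) := rpow_le_rpow_of_nonpos (by positivity) hR2 (by linarith)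
  calc s ^ (-a) * axWeight γ r₀ s (μ - s) ^ (-θ) * R ^ (-a)
      ≤ s ^ (-a) * (r₀ ^ γ * μ / (2 * s)) ^ (-θ) * (r₀ / 2) ^ (-a) := by gcongr
    _ = _ := by
      rw [div_rpow (by positivity) (by positivity), mul_rpow (by positivity) hμ.le,
        mul_rpow two_pos.le hs.le, div_rpow hr0.le two_pos.le, ← rpow_mul hr0.le,
        rpow_add two_pos, rpow_sub hr0, rpow_sub hs, rpow_neg two_pos.le, rpow_neg two_pos.le,
        rpow_neg hs.le, rpow_neg hs.le, mul_neg, rpow_neg hr0.le, rpow_neg hr0.le]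
      have := rpow_pos_of_pos hs θ
      have := rpow_pos_of_pos hs a
      have := rpow_pos_of_pos hr0 (γ * θ)
      have := rpow_pos_of_pos hr0 a
      field_simp

theorem far_integrand_le {a γ θ r₀ s μ : ℝ} (hθ : 0 ≤ θ) (hs : 0 < s) (hsr : s < r₀)
    (hμ : 0 < μ) (hγ0 : 0 ≤ a - (2 - γ) * θ) :
    axWeight γ r₀ s (μ - s) ^ (-θ) * axDist r₀ s (μ - s) ^ (-a) ≤
        (r₀ * μ) ^ (-θ) * (r₀ - s) ^ (-(a - (2 - γ) * θ)) ∧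
    axWeight γ r₀ s (μ - s) ^ (-θ) * axDist r₀ s (μ - s) ^ (-a) ≤
        (r₀ * μ) ^ (-(a + γ * θ) / 2) := by
  have hr0 : 0 < r₀ := by linarith
  have hμr : 0 < r₀ * μ := by positivity
  have hR := axDist_pos (s := s) hμr
  have hRR := axDist_sq (s := s) hμr.le
  set R := axDist r₀ s (μ - s) with hRdef
  have hw : R ^ (γ - 2) * (r₀ * μ) ≤ axWeight γ r₀ s (μ - s) := by
    have h1 := (cone_factor_ge hs hsr hμ hR hRR).2
    calc R ^ (γ - 2) * (r₀ * μ) = r₀ * μ / R ^ 2 * R ^ γ := by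
          rw [rpow_sub hR, rpow_two]; ring
      _ ≤ _ := by
          rw [axWeight, ← hRdef]
          have : r₀ * μ / R ^ 2 * R ^ γ ≤
            (1 + (s ^ 2 + r₀ * (μ - s)) / (s * R)) * R ^ γ := by gcongr
          linarith
  have h1 : axWeight γ r₀ s (μ - s) ^ (-θ) ≤ (R ^ (γ - 2) * (r₀ * μ)) ^ (-θ) :=
    rpow_le_rpow_of_nonpos (by positivity) hw (by linarith)
  have h2 : axWeight γ r₀ s (μ - s) ^ (-θ) * R ^ (-a) ≤
      (r₀ * μ) ^ (-θ) * R ^ (-(a - (2 - γ) * θ)) := by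
    calc axWeight γ r₀ s (μ - s) ^ (-θ) * R ^ (-a)
        ≤ (R ^ (γ - 2) * (r₀ * μ)) ^ (-θ) * R ^ (-a) := by gcongr
      _ = (r₀ * μ) ^ (-θ) * (R ^ ((γ - 2) * (-θ)) * R ^ (-a)) := by
          rw [mul_rpow (by positivity) hμr.le, ← rpow_mul hR.le]; ring
      _ = _ := by
          rw [← rpow_add hR]; ring_nf
  constructor
  · refine h2.trans ?_
    gcongr ?_ * ?_
    refine rpow_le_rpow_of_nonpos (by linarith) ?_ (by linarith)
    nlinarith
  · refine h2.trans ?_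
    have h3 : R ^ (-(a - (2 - γ) * θ)) ≤ (√(r₀ * μ)) ^ (-(a - (2 - γ) * θ)) := by
      refine rpow_le_rpow_of_nonpos (sqrt_pos.2 hμr) (sqrt_le_iff.2 ⟨hR.le, ?_⟩) (by linarith)
      nlinarith [sq_nonneg (r₀ - s)]
    calc (r₀ * μ) ^ (-θ) * R ^ (-(a - (2 - γ) * θ))
        ≤ (r₀ * μ) ^ (-θ) * (√(r₀ * μ)) ^ (-(a - (2 - γ) * θ)) := by gcongr
      _ = _ := by
          rw [sqrt_eq_rpow, ← rpow_mul hμr.le, ← rpow_add hμr]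
          ring_nf

theorem lintegral_near_le {a γ θ r₀ s E : ℝ} (ha : 0 ≤ a) (hγ1 : 1 ≤ γ) (hγ2 : γ ≤ 2)
    (hθ : 0 ≤ θ) (hθ1 : θ < 1) (hs : 0 < s) (hsr : 2 * s ≤ r₀) (hE : 0 ≤ E) :
    ∫⁻ μ in Set.Ioo 0 (2 * s), ENNReal.ofReal
        (s ^ (-a) * axWeight γ r₀ s (μ - s) ^ (-θ) * axDist r₀ s (μ - s) ^ (-a) * E) ≤
      ENNReal.ofReal (2 ^ (a + 1) / (1 - θ) * r₀ ^ (-a - γ * θ) * s ^ (1 - a) * E) := by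
  have hr0 : 0 < r₀ := by linarith
  calc _ ≤ ∫⁻ μ in Set.Ioo 0 (2 * s), ENNReal.ofReal
        (2 ^ (a + θ) * r₀ ^ (-a - γ * θ) * s ^ (θ - a) * E) * ENNReal.ofReal (μ ^ (-θ)) := by
        refine setLIntegral_mono' measurableSet_Ioo fun μ hμ => ?_
        rw [← ENNReal.ofReal_mul (by positivity)]
        refine ENNReal.ofReal_le_ofReal ?_
        calc _ ≤ 2 ^ (a + θ) * r₀ ^ (-a - γ * θ) * s ^ (θ - a) * μ ^ (-θ) * E := by
              exact mul_le_mul_of_nonneg_right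
                (near_integrand_le ha hγ1 hγ2 hθ hs hsr hμ.1) hE
          _ = _ := by ring
    _ ≤ ENNReal.ofReal (2 ^ (a + θ) * r₀ ^ (-a - γ * θ) * s ^ (θ - a) * E) *
          ∫⁻ μ in Set.Ioc 0 (2 * s), ENNReal.ofReal (μ ^ (-θ)) := by
        rw [lintegral_const_mul' _ _ ENNReal.ofReal_ne_top]
        gcongr 1
        exact lintegral_mono_set Set.Ioo_subset_Ioc_self
    _ = _ := by
        rw [lintegral_Ioc_rpow (by linarith) (by positivity),
          ← ENNReal.ofReal_mul (by positivity)]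
        congr 1
        rw [show -θ + 1 = 1 - θ by ring, mul_rpow two_pos.le hs.le,
          show s ^ (1 - a) = s ^ (θ - a) * s ^ (1 - θ) by rw [← rpow_add hs]; ring_nf,
          show (2 : ℝ) ^ (a + 1) = 2 ^ (a + θ) * 2 ^ (1 - θ) by rw [← rpow_add two_pos]; ring_nf]
        ring

theorem lintegral_far_le {a γ θ r₀ s E : ℝ} (hθ : 0 ≤ θ) (hθ1 : θ < 1)
    (haγ : 2 < a + γ * θ) (hβ : 0 ≤ a - (2 - γ) * θ)
    (hs : 0 < s) (hsr : s < r₀) (hE : 0 ≤ E) :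
    ∫⁻ μ in Set.Ioo 0 (2 * s), ENNReal.ofReal
        (s ^ (-a) * axWeight γ r₀ s (μ - s) ^ (-θ) * axDist r₀ s (μ - s) ^ (-a) * E) ≤
      ENNReal.ofReal (s ^ (-a) * ((1 / (1 - θ) + 2 / (a + γ * θ - 2)) * r₀⁻¹ *
        (r₀ - s) ^ (2 - a - γ * θ)) * E) := by
  have hr0 : 0 < r₀ := hs.trans hsr
  have hρ : 0 < r₀ - s := by linarith
  set m : ℝ := (r₀ - s) ^ 2 / r₀ with hm
  have hm0 : 0 < m := by positivity
  have hterm : ∀ μ, 0 < μ →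
      (s ^ (-a) * axWeight γ r₀ s (μ - s) ^ (-θ) * axDist r₀ s (μ - s) ^ (-a) * E ≤
        s ^ (-a) * E * (r₀ ^ (-θ) * (r₀ - s) ^ (-(a - (2 - γ) * θ))) * μ ^ (-θ)) ∧
      (s ^ (-a) * axWeight γ r₀ s (μ - s) ^ (-θ) * axDist r₀ s (μ - s) ^ (-a) * E ≤
        s ^ (-a) * E * r₀ ^ (-(a + γ * θ) / 2) * μ ^ (-(a + γ * θ) / 2)) := fun μ hμ => by
    have h := far_integrand_le (a := a) hθ hs hsr hμ hβ
    have e : s ^ (-a) * axWeight γ r₀ s (μ - s) ^ (-θ) * axDist r₀ s (μ - s) ^ (-a) * E =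
      s ^ (-a) * E * (axWeight γ r₀ s (μ - s) ^ (-θ) * axDist r₀ s (μ - s) ^ (-a)) := by ring
    rw [e, mul_assoc (s ^ (-a) * E), mul_assoc (s ^ (-a) * E)]
    constructor
    · refine mul_le_mul_of_nonneg_left (h.1.trans (le_of_eq ?_)) (by positivity)
      rw [mul_rpow hr0.le hμ.le]
      ring
    · refine mul_le_mul_of_nonneg_left (h.2.trans (le_of_eq ?_)) (by positivity)
      rw [mul_rpow hr0.le hμ.le]
  have hsub : Set.Ioo 0 (2 * s) ⊆ Set.Ioc 0 m ∪ Set.Ioi m := fun μ hμ => by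
    rcases le_or_gt μ m with h | h
    exacts [Or.inl ⟨hμ.1, h⟩, Or.inr h]
  have hnear : ∫⁻ μ in Set.Ioc 0 m, ENNReal.ofReal
      (s ^ (-a) * axWeight γ r₀ s (μ - s) ^ (-θ) * axDist r₀ s (μ - s) ^ (-a) * E) ≤
      ENNReal.ofReal (s ^ (-a) * (1 / (1 - θ) * r₀⁻¹ * (r₀ - s) ^ (2 - a - γ * θ)) * E) := by
    calc _ ≤ ∫⁻ μ in Set.Ioc 0 m, ENNReal.ofReal
          (s ^ (-a) * E * (r₀ ^ (-θ) * (r₀ - s) ^ (-(a - (2 - γ) * θ)))) *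
            ENNReal.ofReal (μ ^ (-θ)) := by
          refine setLIntegral_mono' measurableSet_Ioc fun μ hμ => ?_
          rw [← ENNReal.ofReal_mul (by positivity)]
          exact ENNReal.ofReal_le_ofReal (hterm μ hμ.1).1
      _ = _ := by
          rw [lintegral_const_mul' _ _ ENNReal.ofReal_ne_top,
            lintegral_Ioc_rpow (by linarith) hm0.le, ← ENNReal.ofReal_mul (by positivity)]
          congr 1
          rw [hm, div_rpow (by positivity) hr0.le, ← rpow_natCast, ← rpow_mul hρ.le,
            show -θ + 1 = 1 - θ by ring,
            show (r₀ - s) ^ (2 - a - γ * θ) = (r₀ - s) ^ (-(a - (2 - γ) * θ)) *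
              (r₀ - s) ^ (((2 : ℕ) : ℝ) * (1 - θ)) by
                rw [← rpow_add hρ]; push_cast; ring_nf,
            show r₀⁻¹ = r₀ ^ (-θ) / r₀ ^ (1 - θ) by
              rw [← rpow_sub hr0, ← rpow_neg_one]; ring_nf]
          ring
  have hfar : ∫⁻ μ in Set.Ioi m, ENNReal.ofReal
      (s ^ (-a) * axWeight γ r₀ s (μ - s) ^ (-θ) * axDist r₀ s (μ - s) ^ (-a) * E) ≤
      ENNReal.ofReal (s ^ (-a) * (2 / (a + γ * θ - 2) * r₀⁻¹ *
        (r₀ - s) ^ (2 - a - γ * θ)) * E) := by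
    calc _ ≤ ∫⁻ μ in Set.Ioi m, ENNReal.ofReal (s ^ (-a) * E * r₀ ^ (-(a + γ * θ) / 2)) *
            ENNReal.ofReal (μ ^ (-(a + γ * θ) / 2)) := by
          refine setLIntegral_mono' measurableSet_Ioi fun μ hμ => ?_
          rw [← ENNReal.ofReal_mul (by positivity)]
          exact ENNReal.ofReal_le_ofReal (hterm μ (hm0.trans hμ)).2
      _ = _ := by
          rw [lintegral_const_mul' _ _ ENNReal.ofReal_ne_top,
            lintegral_Ioi_rpow (by linarith) hm0, ← ENNReal.ofReal_mul (by positivity)]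
          congr 1
          have h2 : a + γ * θ - 2 ≠ 0 := by linarith
          rw [hm, div_rpow (by positivity) hr0.le, ← rpow_natCast, ← rpow_mul hρ.le,
            show ((2 : ℕ) : ℝ) * (-(a + γ * θ) / 2 + 1) = 2 - a - γ * θ by push_cast; ring,
            show r₀⁻¹ = r₀ ^ (-(a + γ * θ) / 2) / r₀ ^ (-(a + γ * θ) / 2 + 1) by
              rw [← rpow_sub hr0, ← rpow_neg_one]; ring_nf,
            show -(-(a + γ * θ) / 2 + 1) = (a + γ * θ - 2) / 2 by ring]
          field_simp
  calc _ ≤ _ := lintegral_mono_set hsub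
    _ ≤ _ := lintegral_union_le _ _ _
    _ ≤ _ := add_le_add hnear hfar
    _ = _ := by
        have h1 : 0 < 1 - θ := by linarith
        have h2 : 0 < a + γ * θ - 2 := by linarith
        rw [← ENNReal.ofReal_add (by positivity) (by positivity)]
        congr 1
        ring

theorem lintegral_reflect_rpow_le {c T : ℝ} (hc : c < -1) :
    ∫⁻ s in Set.Ioo 0 T, ENNReal.ofReal ((2 + T - s) ^ c) ≤
      ENNReal.ofReal (2 ^ (c + 1) / (-(c + 1))) := by
  rw [← lintegral_Ioi_rpow hc two_pos, ← lintegral_indicator measurableSet_Ioi,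
    ← lintegral_sub_left_eq_self ((Set.Ioi 2).indicator fun τ => ENNReal.ofReal (τ ^ c)) (2 + T), ← lintegral_indicator measurableSet_Ioo]
  refine lintegral_mono fun s => ?_
  by_cases h : s ∈ Set.Ioo 0 T
  · rw [Set.indicator_of_mem h, Set.indicator_of_mem]
    have := h.2
    simp only [Set.mem_Ioi]
    linarith
  · rw [Set.indicator_of_notMem h]
    exact bot_le

theorem exists_lintegral_axKernel_le {a γ θ η : ℝ} (ha : 1 ≤ a) (ha3 : a < 3) (hγ1 : 1 ≤ γ)
    (hγ2 : γ ≤ 2) (hθ : 0 ≤ θ) (hθ1 : θ < 1) (haγ : 3 < a + γ * θ)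
    (hη : 0 ≤ η) (hη1 : η < 1) (hη3 : η < 3 - a) :
    ∃ C, 0 ≤ C ∧ ∀ T r₀ L : ℝ, 0 ≤ T → T + 2 ≤ r₀ → 0 < L →
      ∫⁻ s in Set.Ioo 0 T, ENNReal.ofReal s * ∫⁻ μ in Set.Ioo 0 (2 * s), ENNReal.ofReal
        (s ^ (-a) * axWeight γ r₀ s (μ - s) ^ (-θ) * axDist r₀ s (μ - s) ^ (-a) *
          expWeight (a + γ * θ - 3) L T s) ≤
        ENNReal.ofReal (C * (L ^ (-η) * r₀ ^ (-a))) := by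
  set ε := a + γ * θ - 3 with hε
  have hε0 : 0 < ε := by linarith
  have hβ : 0 ≤ a - (2 - γ) * θ := by nlinarith
  have h2ε : (2 : ℝ) ^ (-ε) < 1 := rpow_lt_one_of_one_lt_of_neg one_lt_two (by linarith)
  have h2ε' : 0 < 1 - (2 : ℝ) ^ (-ε) := by linarith
  have h1θ : 0 < 1 - θ := by linarith
  have h3aη : 0 < 3 - a - η := by linarith
  have hag2 : 0 < a + γ * θ - 2 := by linarith
  have hεη : 0 < ε * (1 - η) := mul_pos hε0 (by linarith)
  set C₁ := 2 ^ (a + 1) / (1 - θ) * ε ^ (-η) / (3 - a - η) with hC1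
  set C₂ := 2 ^ (a - 1) * (1 / (1 - θ) + 2 / (a + γ * θ - 2)) * (1 - 2 ^ (-ε)) ^ (-η) *
    (2 ^ (-(ε * (1 - η))) / (ε * (1 - η))) with hC2
  refine ⟨C₁ + C₂, by positivity, fun T r₀ L hT hr hL => ?_⟩
  have hr0 : 0 < r₀ := by linarith
  have hA : ∫⁻ s in Set.Ioo 0 T ∩ Set.Iio (r₀ / 2), ENNReal.ofReal s *
      ∫⁻ μ in Set.Ioo 0 (2 * s), ENNReal.ofReal
        (s ^ (-a) * axWeight γ r₀ s (μ - s) ^ (-θ) * axDist r₀ s (μ - s) ^ (-a) *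
          expWeight ε L T s) ≤ ENNReal.ofReal (C₁ * (L ^ (-η) * r₀ ^ (-a))) := by
    have hms : MeasurableSet (Set.Ioo 0 T ∩ Set.Iio (r₀ / 2)) :=
      measurableSet_Ioo.inter measurableSet_Iio
    calc _ ≤ ∫⁻ s in Set.Ioo 0 T ∩ Set.Iio (r₀ / 2), ENNReal.ofReal
          (2 ^ (a + 1) / (1 - θ) * r₀ ^ (-a - γ * θ) * (L * (ε * r₀ ^ (-1 - ε))) ^ (-η)) *
            ENNReal.ofReal (s ^ (2 - a - η)) := by
          refine setLIntegral_mono' hms fun s hs => ?_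
          obtain ⟨⟨hs0, hsT⟩, hsr⟩ := hs
          have hsr' : 2 * s ≤ r₀ := by
            have : s < r₀ / 2 := hsr
            linarith
          refine (mul_le_mul_right (lintegral_near_le (by linarith) hγ1 hγ2 hθ hθ1 hs0 hsr'
            (expWeight_nonneg _ _ _ _)) _).trans ?_
          rw [← ENNReal.ofReal_mul hs0.le, ← ENNReal.ofReal_mul (by positivity)]
          refine ENNReal.ofReal_le_ofReal ?_
          have h := expWeight_le_near (T := T) (s := s) hε0 hL hη hη1.le hs0 hsT hr
          have h2 : (L * (ε * s * r₀ ^ (-1 - ε))) ^ (-η) =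
              (L * (ε * r₀ ^ (-1 - ε))) ^ (-η) * s ^ (-η) := by
            rw [← mul_rpow (by positivity) hs0.le]
            ring_nf
          have h3 : s ^ (2 - a - η) = s * s ^ (1 - a) * s ^ (-η) := by
            nth_rw 2 [← rpow_one s]
            rw [← rpow_add hs0, ← rpow_add hs0]
            ring_nf
          rw [h2] at h
          calc _ ≤ s * (2 ^ (a + 1) / (1 - θ) * r₀ ^ (-a - γ * θ) * s ^ (1 - a) *
                ((L * (ε * r₀ ^ (-1 - ε))) ^ (-η) * s ^ (-η))) := by gcongr
            _ = _ := by rw [h3]; ring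
      _ ≤ ENNReal.ofReal (2 ^ (a + 1) / (1 - θ) * r₀ ^ (-a - γ * θ) *
            (L * (ε * r₀ ^ (-1 - ε))) ^ (-η)) *
              ∫⁻ s in Set.Ioc 0 r₀, ENNReal.ofReal (s ^ (2 - a - η)) := by
          rw [lintegral_const_mul' _ _ ENNReal.ofReal_ne_top]
          gcongr 1
          refine lintegral_mono_set fun s hs => ⟨hs.1.1, ?_⟩
          have := hs.1.2
          linarith
      _ ≤ _ := by
          rw [lintegral_Ioc_rpow (by linarith) hr0.le, ← ENNReal.ofReal_mul (by positivity)]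
          refine ENNReal.ofReal_le_ofReal ?_
          have h4 : r₀ ^ (-a - γ * θ) * (r₀ ^ (-1 - ε)) ^ (-η) * r₀ ^ (2 - a - η + 1) ≤
              r₀ ^ (-a) := by
            rw [← rpow_mul hr0.le, ← rpow_add hr0, ← rpow_add hr0]
            refine rpow_le_rpow_of_exponent_le (by linarith) ?_
            nlinarith
          rw [mul_rpow hL.le (by positivity), mul_rpow hε0.le (by positivity), hC1]
          calc _ = 2 ^ (a + 1) / (1 - θ) * ε ^ (-η) / (3 - a - η) * L ^ (-η) *
              (r₀ ^ (-a - γ * θ) * (r₀ ^ (-1 - ε)) ^ (-η) * r₀ ^ (2 - a - η + 1)) := by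
                rw [show 2 - a - η + 1 = 3 - a - η by ring]
                ring
            _ ≤ 2 ^ (a + 1) / (1 - θ) * ε ^ (-η) / (3 - a - η) * L ^ (-η) * r₀ ^ (-a) := by
                gcongr
            _ = _ := by ring
  have hB : ∫⁻ s in Set.Ioo 0 T ∩ Set.Ici (r₀ / 2), ENNReal.ofReal s *
      ∫⁻ μ in Set.Ioo 0 (2 * s), ENNReal.ofReal
        (s ^ (-a) * axWeight γ r₀ s (μ - s) ^ (-θ) * axDist r₀ s (μ - s) ^ (-a) *
          expWeight ε L T s) ≤ ENNReal.ofReal (C₂ * (L ^ (-η) * r₀ ^ (-a))) := by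
    have hms : MeasurableSet (Set.Ioo 0 T ∩ Set.Ici (r₀ / 2)) :=
      measurableSet_Ioo.inter measurableSet_Ici
    calc _ ≤ ∫⁻ s in Set.Ioo 0 T ∩ Set.Ici (r₀ / 2), ENNReal.ofReal
          (2 ^ (a - 1) * r₀ ^ (-a) * (1 / (1 - θ) + 2 / (a + γ * θ - 2)) *
            (L * (1 - 2 ^ (-ε))) ^ (-η)) *
            ENNReal.ofReal ((2 + T - s) ^ (-1 - ε * (1 - η))) := by
          refine setLIntegral_mono' hms fun s hs => ?_
          obtain ⟨⟨hs0, hsT⟩, hsr⟩ := hs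
          have hsr' : r₀ ≤ 2 * s := by
            have : r₀ / 2 ≤ s := hsr
            linarith
          have hτ : 0 < 2 + T - s := by linarith
          refine (mul_le_mul_right (lintegral_far_le (a := a) hθ hθ1 (by linarith) hβ hs0
            (by linarith : s < r₀) (expWeight_nonneg _ _ _ _)) _).trans ?_
          rw [← ENNReal.ofReal_mul hs0.le, ← ENNReal.ofReal_mul (by positivity)]
          refine ENNReal.ofReal_le_ofReal ?_
          have h := expWeight_le_far (T := T) (s := s) hε0 hL hη hη1.le hsT hr hsr'
          rw [← mul_assoc, mul_rpow (by positivity) (by positivity), ← rpow_mul hτ.le] at h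
          have h2 : s * s ^ (-a) ≤ 2 ^ (a - 1) * r₀ ^ (1 - a) := by
            calc s * s ^ (-a) = s ^ (1 - a) := by
                  nth_rw 1 [← rpow_one s]
                  rw [← rpow_add hs0]
                  ring_nf
              _ ≤ (r₀ / 2) ^ (1 - a) :=
                  rpow_le_rpow_of_nonpos (by positivity) hsr (by linarith)
              _ = _ := by
                  rw [div_rpow hr0.le two_pos.le, show a - 1 = -(1 - a) by ring,
                    rpow_neg two_pos.le]
                  ring
          have h3 : (r₀ - s) ^ (2 - a - γ * θ) ≤ (2 + T - s) ^ (2 - a - γ * θ) :=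
            rpow_le_rpow_of_nonpos hτ (by linarith) (by linarith)
          have h4 : r₀ ^ (-a) = r₀ ^ (1 - a) * r₀⁻¹ := by
            rw [← rpow_neg_one, ← rpow_add hr0]
            ring_nf
          have h5 : (2 + T - s) ^ (-1 - ε * (1 - η)) =
              (2 + T - s) ^ (2 - a - γ * θ) * (2 + T - s) ^ (-ε * -η) := by
            rw [← rpow_add hτ]
            congr 1
            rw [hε]
            ring
          have hr's : 0 < r₀ - s := by linarith
          have hE := expWeight_nonneg ε L T s
          calc _ = s * s ^ (-a) * ((1 / (1 - θ) + 2 / (a + γ * θ - 2)) * r₀⁻¹ *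
                (r₀ - s) ^ (2 - a - γ * θ)) * expWeight ε L T s := by ring
            _ ≤ 2 ^ (a - 1) * r₀ ^ (1 - a) * ((1 / (1 - θ) + 2 / (a + γ * θ - 2)) * r₀⁻¹ *
                (2 + T - s) ^ (2 - a - γ * θ)) *
                  ((L * (1 - 2 ^ (-ε))) ^ (-η) * (2 + T - s) ^ (-ε * -η)) := by
                gcongr
            _ = _ := by rw [h4, h5]; ring
      _ ≤ ENNReal.ofReal (2 ^ (a - 1) * r₀ ^ (-a) * (1 / (1 - θ) + 2 / (a + γ * θ - 2)) *
            (L * (1 - 2 ^ (-ε))) ^ (-η)) *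
              ENNReal.ofReal (2 ^ (-1 - ε * (1 - η) + 1) / (-(-1 - ε * (1 - η) + 1))) := by
          rw [lintegral_const_mul' _ _ ENNReal.ofReal_ne_top]
          gcongr 1
          exact (lintegral_mono_set Set.inter_subset_left).trans
            (lintegral_reflect_rpow_le (by linarith))
      _ = _ := by
          rw [← ENNReal.ofReal_mul (by positivity), mul_rpow hL.le h2ε'.le, hC2]
          congr 1
          rw [show -1 - ε * (1 - η) + 1 = -(ε * (1 - η)) by ring, neg_neg]
          ring
  have hsplit : Set.Ioo 0 T ⊆ (Set.Ioo 0 T ∩ Set.Iio (r₀ / 2)) ∪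
      (Set.Ioo 0 T ∩ Set.Ici (r₀ / 2)) := fun s hs => by
    rcases lt_or_ge s (r₀ / 2) with h | h
    exacts [Or.inl ⟨hs, h⟩, Or.inr ⟨hs, h⟩]
  calc _ ≤ _ := lintegral_mono_set hsplit
    _ ≤ _ := lintegral_union_le _ _ _
    _ ≤ _ := add_le_add hA hB
    _ = _ := by
        rw [← ENNReal.ofReal_add (by positivity) (by positivity)]
        congr 1
        ring

theorem exists_interpolation_exponent {a γ : ℝ} (hγ : 1 < γ) (ha : 1 < a) (ha3 : a < 3)
    (h : 2 < (a - 1) * (γ + 1)) :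
    ∃ θ, 0 ≤ θ ∧ θ < 1 ∧ θ ≤ a - 1 ∧ 3 < a + γ * θ := by
  rcases lt_or_ge a 2 with h2 | h2
  · exact ⟨a - 1, by linarith, by linarith, le_rfl, by linarith⟩
  · have hq : γ * ((3 - a) / γ) = 3 - a := by field_simp
    have hq0 : 0 ≤ (3 - a) / γ := div_nonneg (by linarith) (by linarith)
    have hq1 : (3 - a) / γ < 1 := by rw [div_lt_one (by linarith)]; linarith
    exact ⟨(1 + (3 - a) / γ) / 2, by linarith, by linarith, by linarith, by linarith⟩

theorem measurable_coneWeight (γ T : ℝ) (x : E3) :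
    Measurable fun y : E3 => coneWeight γ y (T - ‖y‖, x + y) := by
  unfold coneWeight cosN dirv unitv
  fun_prop

theorem one_le_coneWeight {γ : ℝ} {y : E3} {q : ℝ × E3} (hq : q.2 ≠ 0) :
    1 ≤ coneWeight γ y q := by
  have h := neg_le_of_abs_le (abs_cosN_le y hq)
  have : 0 ≤ (1 + cosN y q) * ‖q.2‖ ^ γ :=
    mul_nonneg (by linarith) (rpow_nonneg (norm_nonneg _) _)
  rw [coneWeight]
  linarith

theorem norm_add_eq_axDist {x : E3} (hx : x ≠ 0) (y : E3) :
    ‖x + y‖ = axDist ‖x‖ ‖y‖ ⟪‖x‖⁻¹ • x, y⟫_ℝ := by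
  have h0 : ‖x‖ ≠ 0 := norm_ne_zero_iff.2 hx
  rw [axDist, inner_smul_left, ← sqrt_sq (norm_nonneg (x + y)), norm_add_sq_real]
  congr 2
  simp only [conj_trivial]
  field_simp

theorem coneWeight_eq_axWeight {x : E3} (hx : x ≠ 0) (γ T : ℝ) (y : E3) :
    coneWeight γ y (T - ‖y‖, x + y) = axWeight γ ‖x‖ ‖y‖ ⟪‖x‖⁻¹ • x, y⟫_ℝ := by
  have h0 : ‖x‖ ≠ 0 := norm_ne_zero_iff.2 hx
  have h1 : cosN y (T - ‖y‖, x + y) = (‖y‖ ^ 2 + ‖x‖ * ⟪‖x‖⁻¹ • x, y⟫_ℝ) / (‖y‖ * ‖x + y‖) := by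
    have h2 : ‖y‖ ^ 2 + ‖x‖ * ⟪‖x‖⁻¹ • x, y⟫_ℝ = ⟪y, x + y⟫_ℝ := by
      rw [inner_smul_left, inner_add_right, real_inner_self_eq_norm_sq, real_inner_comm y x]
      simp only [conj_trivial]
      field_simp
      ring
    rw [h2, cosN]
    simp only [dirv, unitv, PiLp.inner_apply, Fin.sum_univ_three]
    simp
    ring
  rw [coneWeight, axWeight, h1, ← norm_add_eq_axDist hx]

theorem norm_add_ge_two {T : ℝ} {x y : E3} (hx : T + 2 ≤ ‖x‖) (hy : ‖y‖ ≤ T) :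
    2 ≤ ‖x + y‖ := by
  have := norm_sub_norm_le x (-y)
  rw [norm_neg, sub_neg_eq_add] at this
  linarith

theorem measurable_axKernel (a γ θ r₀ ε L T : ℝ) :
    Measurable (Function.uncurry fun s ζ : ℝ => ENNReal.ofReal (s ^ (-a) *
      axWeight γ r₀ s ζ ^ (-θ) * axDist r₀ s ζ ^ (-a) * expWeight ε L T s)) := by
  unfold axWeight axDist expWeight Function.uncurry
  fun_prop

theorem exists_lintegral_coneKernel_le {a γ θ η : ℝ} (ha : 1 ≤ a) (ha3 : a < 3) (hγ1 : 1 ≤ γ)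
    (hγ2 : γ ≤ 2) (hθ : 0 ≤ θ) (hθ1 : θ < 1) (haγ : 3 < a + γ * θ)
    (hη : 0 ≤ η) (hη1 : η < 1) (hη3 : η < 3 - a) :
    ∃ C, 0 ≤ C ∧ ∀ (T : ℝ) (x : E3) (L : ℝ), 0 ≤ T → T + 2 ≤ ‖x‖ → 0 < L →
      ∫⁻ y in Metric.ball (0 : E3) T, ENNReal.ofReal (‖y‖ ^ (-a) *
        coneWeight γ y (T - ‖y‖, x + y) ^ (-θ) * ‖x + y‖ ^ (-a) *
          expWeight (a + γ * θ - 3) L T ‖y‖) ≤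
        ENNReal.ofReal (C * (L ^ (-η) * ‖x‖ ^ (-a))) := by
  obtain ⟨C, hC, h⟩ := exists_lintegral_axKernel_le ha ha3 hγ1 hγ2 hθ hθ1 haγ hη hη1 hη3
  refine ⟨2 * π * C, by positivity, fun T x L hT hx hL => ?_⟩
  have hx0 : x ≠ 0 := norm_pos_iff.1 (by linarith)
  have he : ‖‖x‖⁻¹ • x‖ = 1 := norm_smul_inv_norm (𝕜 := ℝ) hx0
  have h1 := lintegral_ball_norm_inner
    (measurable_axKernel a γ θ ‖x‖ (a + γ * θ - 3) L T) he T
  simp only [coneWeight_eq_axWeight hx0, norm_add_eq_axDist hx0]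
  rw [h1, mul_assoc, ENNReal.ofReal_mul (p := 2 * π) (by positivity)]
  gcongr 1
  exact h T ‖x‖ L hT hx hL

theorem lintegral_weighted_holder {α : Type*} [MeasurableSpace α] {μ : Measure α} {p : ℝ}
    (hp : 1 < p) {w ψ κ : α → ℝ} (hw : Measurable w) (hψ : Measurable ψ) (hκ : Measurable κ)
    (hw0 : ∀ᵐ y ∂μ, 0 < w y) (hψ0 : ∀ y, 0 ≤ ψ y) (hκ0 : ∀ y, 0 ≤ κ y) :
    ∫⁻ y, ENNReal.ofReal (ψ y ^ p * κ y) ∂μ ≤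
      (∫⁻ y, ENNReal.ofReal (w y * ψ y ^ (p + 1)) ∂μ) ^ ((p - 1) / (p + 1)) *
      (∫⁻ y, ENNReal.ofReal (w y ^ (-((p + 1) / 2 - 1)) * (ψ y * κ y) ^ ((p + 1) / 2)) ∂μ) ^
        (1 / ((p + 1) / 2)) := by
  have hpq : ((p + 1) / (p - 1)).HolderConjugate ((p + 1) / 2) := by
    have h1 : 0 < p - 1 := by linarith
    refine Real.holderConjugate_iff.2 ⟨by rw [lt_div_iff₀ h1]; linarith, ?_⟩
    have : p + 1 ≠ 0 := by linarith
    field_simp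
    ring
  have hp1 : p - 1 ≠ 0 := by linarith
  have hp2 : p + 1 ≠ 0 := by linarith
  have H := ENNReal.lintegral_mul_le_Lp_mul_Lq μ hpq
    (f := fun y => ENNReal.ofReal (w y ^ ((p - 1) / (p + 1)) * ψ y ^ (p - 1)))
    (g := fun y => ENNReal.ofReal (w y ^ (-((p - 1) / (p + 1))) * (ψ y * κ y)))
    (by fun_prop) (by fun_prop)
  have e1 : ∫⁻ y, ENNReal.ofReal (ψ y ^ p * κ y) ∂μ =
      ∫⁻ y, ((fun y => ENNReal.ofReal (w y ^ ((p - 1) / (p + 1)) * ψ y ^ (p - 1))) *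
        fun y => ENNReal.ofReal (w y ^ (-((p - 1) / (p + 1))) * (ψ y * κ y))) y ∂μ := by
    refine lintegral_congr_ae ?_
    filter_upwards [hw0] with y hy
    have h0 := hψ0 y
    rw [Pi.mul_apply, ← ENNReal.ofReal_mul (by positivity)]
    congr 1
    have h3 : ψ y ^ p = ψ y ^ (p - 1) * ψ y := by
      rw [← rpow_add_one' h0 (by linarith), sub_add_cancel]
    have h4 : w y ^ ((p - 1) / (p + 1)) * w y ^ (-((p - 1) / (p + 1))) = 1 := by
      rw [← rpow_add hy, add_neg_cancel, rpow_zero]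
    rw [h3]
    linear_combination -(ψ y ^ (p - 1) * ψ y * κ y) * h4
  have e2 : ∫⁻ y, ENNReal.ofReal (w y ^ ((p - 1) / (p + 1)) * ψ y ^ (p - 1)) ^
      ((p + 1) / (p - 1)) ∂μ = ∫⁻ y, ENNReal.ofReal (w y * ψ y ^ (p + 1)) ∂μ := by
    refine lintegral_congr_ae ?_
    filter_upwards [hw0] with y hy
    have h0 := hψ0 y
    rw [ENNReal.ofReal_rpow_of_nonneg (by positivity)
      (div_nonneg (by linarith) (by linarith)), mul_rpow (by positivity) (by positivity),
      ← rpow_mul hy.le, ← rpow_mul h0]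
    congr 2
    · convert rpow_one (w y) using 2
      field_simp
    · congr 1
      field_simp
  have e3 : ∫⁻ y, ENNReal.ofReal (w y ^ (-((p - 1) / (p + 1))) * (ψ y * κ y)) ^
      ((p + 1) / 2) ∂μ = ∫⁻ y, ENNReal.ofReal (w y ^ (-((p + 1) / 2 - 1)) *
        (ψ y * κ y) ^ ((p + 1) / 2)) ∂μ := by
    refine lintegral_congr_ae ?_
    filter_upwards [hw0] with y hy
    have h0 := hψ0 y
    have h1 := hκ0 y
    rw [ENNReal.ofReal_rpow_of_nonneg (by positivity) (by linarith),
      mul_rpow (by positivity) (by positivity), ← rpow_mul hy.le]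
    congr 3
    field_simp
    ring
  rw [e1]
  refine H.trans (le_of_eq ?_)
  rw [e2, e3]
  congr 2
  field_simp

theorem exists_lintegral_nonlinear_le {p γ B : ℝ} (hp : 1 < p) (hp5 : p < 5) (hγ1 : 1 < γ)
    (hγ2 : γ < 2) (hγp : γ < p - 1) (hpγ : 4 / (p - 1) - 1 < γ) (hB : 0 < B) :
    ∃ C ε η : ℝ, 0 ≤ C ∧ 0 < ε ∧ 0 < η ∧ ∀ φ, IsNLWSolution p φ →
      wEnergy p 0 γ φ ≤ ENNReal.ofReal B →
      ∀ (T : ℝ) (x : E3) (L M : ℝ), 0 ≤ T → T + 2 ≤ ‖x‖ → 0 < L → 0 ≤ M →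
      (∀ y ∈ Metric.ball (0 : E3) T,
        |φ (T - ‖y‖) (x + y)| ≤ M * ‖x + y‖⁻¹ * expWeight ε L T ‖y‖) →
      ∫⁻ y in Metric.ball (0 : E3) T, ENNReal.ofReal (|φ (T - ‖y‖) (x + y)| ^ p * ‖y‖⁻¹) ≤
        ENNReal.ofReal (C * L ^ (-η) * M * ‖x‖⁻¹) := by
  set a := (p + 1) / 2 with ha
  have ha1 : 1 < a := by linarith
  have ha3 : a < 3 := by linarith
  have haγ : 2 < (a - 1) * (γ + 1) := by
    have h1 : 0 < p - 1 := by linarith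
    have h2 : 4 / (p - 1) < γ + 1 := by linarith
    rw [div_lt_iff₀ h1] at h2
    rw [ha]
    linarith
  obtain ⟨θ, hθ0, hθ1, hθa, hθ⟩ := exists_interpolation_exponent hγ1 ha1 ha3 haγ
  set η := min (1 / 2) ((3 - a) / 2) with hη
  have hη0 : 0 < η := lt_min (by norm_num) (by linarith)
  have hη1 : η < 1 := (min_le_left _ _).trans_lt (by norm_num)
  have hη3 : η < 3 - a := (min_le_right _ _).trans_lt (by linarith)
  obtain ⟨C, hC, h⟩ := exists_lintegral_coneKernel_le ha1.le ha3 hγ1.le hγ2.le hθ0 hθ1 hθ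
    hη0.le hη1 hη3
  set ε := a + γ * θ - 3 with hε
  refine ⟨(7 * (p + 1) * B) ^ ((p - 1) / (p + 1)) * (C * a ^ (-η)) ^ (1 / a), ε, η * (1 / a),
    by positivity, by linarith, by positivity, fun φ hφ hE T x L M hT hx hL hM hb => ?_⟩
  have hx0 : 0 < ‖x‖ := by linarith
  have hφc : Continuous fun q : ℝ × E3 => φ q.1 q.2 := hφ.1.continuous
  have hψ : Measurable fun y : E3 => |φ (T - ‖y‖) (x + y)| :=
    (hφc.comp (by fun_prop : Continuous fun y : E3 => (T - ‖y‖, x + y))).abs.measurable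
  have hw1 : ∀ y ∈ Metric.ball (0 : E3) T, 1 ≤ coneWeight γ y (T - ‖y‖, x + y) :=
    fun y hy => one_le_coneWeight (norm_pos_iff.1
      (two_pos.trans_le (norm_add_ge_two hx (mem_ball_zero_iff.1 hy).le)))
  have hH := lintegral_weighted_holder (μ := volume.restrict (Metric.ball (0 : E3) T)) hp
    (measurable_coneWeight γ T x) hψ (by fun_prop : Measurable fun y : E3 => ‖y‖⁻¹)
    ((ae_restrict_iff' measurableSet_ball).2 (Filter.Eventually.of_forall fun y hy =>
      zero_lt_one.trans_le (hw1 y hy))) (fun y => abs_nonneg _) (fun y => by positivity)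
  have hflux : ∫⁻ y in Metric.ball (0 : E3) T, ENNReal.ofReal
      (coneWeight γ y (T - ‖y‖, x + y) * |φ (T - ‖y‖) (x + y)| ^ (p + 1)) ≤
      ENNReal.ofReal (7 * (p + 1) * B) := by
    rw [ENNReal.ofReal_mul (p := 7 * (p + 1)) (by linarith)]
    refine (lintegral_coneWeight_le hp hγ1.le hγ2.le hγp.le hφ
      (ne_top_of_le_ne_top ENNReal.ofReal_ne_top hE) hx).trans ?_
    gcongr
  have hker : ∫⁻ y in Metric.ball (0 : E3) T, ENNReal.ofReal
      (coneWeight γ y (T - ‖y‖, x + y) ^ (-(a - 1)) *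
        (|φ (T - ‖y‖) (x + y)| * ‖y‖⁻¹) ^ a) ≤
      ENNReal.ofReal (M ^ a * (C * ((a * L) ^ (-η) * ‖x‖ ^ (-a)))) := by
    rw [ENNReal.ofReal_mul (by positivity)]
    refine le_trans ?_ (mul_le_mul_right (h T x (a * L) hT hx (by positivity)) _)
    rw [← lintegral_const_mul' _ _ ENNReal.ofReal_ne_top]
    refine setLIntegral_mono' measurableSet_ball fun y hy => ?_
    rw [← ENNReal.ofReal_mul (by positivity)]
    refine ENNReal.ofReal_le_ofReal ?_
    have hw := hw1 y hy
    have hE0 := expWeight_nonneg ε L T ‖y‖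
    have h1 : coneWeight γ y (T - ‖y‖, x + y) ^ (-(a - 1)) ≤
        coneWeight γ y (T - ‖y‖, x + y) ^ (-θ) :=
      rpow_le_rpow_of_exponent_le hw (by linarith)
    have h2 : (|φ (T - ‖y‖) (x + y)| * ‖y‖⁻¹) ^ a ≤
        M ^ a * ‖x + y‖ ^ (-a) * expWeight ε (a * L) T ‖y‖ * ‖y‖ ^ (-a) := by
      have h3 : expWeight ε L T ‖y‖ ^ a = expWeight ε (a * L) T ‖y‖ := by
        rw [expWeight, expWeight, ← exp_mul]
        congr 1
        ring
      rw [mul_rpow (abs_nonneg _) (by positivity), rpow_neg (norm_nonneg y),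
        ← inv_rpow (norm_nonneg y)]
      gcongr
      refine (rpow_le_rpow (abs_nonneg _) (hb y hy) (by linarith)).trans (le_of_eq ?_)
      rw [mul_rpow (by positivity) hE0, mul_rpow hM (by positivity), h3,
        inv_rpow (norm_nonneg _), rpow_neg (norm_nonneg _)]
    have hE1 := expWeight_nonneg ε (a * L) T ‖y‖
    calc _ ≤ coneWeight γ y (T - ‖y‖, x + y) ^ (-θ) *
          (M ^ a * ‖x + y‖ ^ (-a) * expWeight ε (a * L) T ‖y‖ * ‖y‖ ^ (-a)) := by gcongr
      _ = _ := by ring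
  refine hH.trans ((mul_le_mul' (ENNReal.rpow_le_rpow hflux
    (div_nonneg (by linarith) (by linarith)))
    (ENNReal.rpow_le_rpow hker (by positivity))).trans (le_of_eq ?_))
  rw [ENNReal.ofReal_rpow_of_nonneg (by positivity) (div_nonneg (by linarith) (by linarith)),
    ENNReal.ofReal_rpow_of_nonneg (by positivity) (by positivity),
    ← ENNReal.ofReal_mul (by positivity)]
  congr 1
  have ha0 : a ≠ 0 := by linarith
  have hr : (M ^ a * (C * ((a * L) ^ (-η) * ‖x‖ ^ (-a)))) ^ (1 / a) =
      M * ((C * a ^ (-η)) ^ (1 / a) * L ^ (-(η * (1 / a))) * ‖x‖⁻¹) := by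
    have h1 : (M ^ a) ^ (1 / a) = M := by
      rw [← rpow_mul hM, mul_one_div_cancel ha0, rpow_one]
    have h2 : (‖x‖ ^ (-a)) ^ (1 / a) = ‖x‖⁻¹ := by
      rw [← rpow_mul hx0.le, neg_mul, mul_one_div_cancel ha0, rpow_neg_one]
    rw [mul_rpow (x := a) (by positivity) hL.le, show C * (a ^ (-η) * L ^ (-η) * ‖x‖ ^ (-a)) =
      C * a ^ (-η) * L ^ (-η) * ‖x‖ ^ (-a) by ring, mul_rpow (by positivity) (by positivity),
      mul_rpow (y := ‖x‖ ^ (-a)) (by positivity) (by positivity),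
      mul_rpow (y := L ^ (-η)) (by positivity) (by positivity), h1, h2, ← rpow_mul hL.le,
      neg_mul]
  rw [hr]
  ring

theorem sphMass_pos : 0 < sphMass := by
  rw [sphMass, measureReal_def, ENNReal.toReal_pos_iff]
  refine ⟨?_, measure_lt_top _ _⟩
  rw [sphereMeasure, Measure.toSphere_apply_univ]
  refine ENNReal.mul_pos ?_ (Metric.measure_ball_pos _ _ one_pos).ne'
  simp

/-- The solid backward light cone with vertex `(T, x)`. -/
def backwardCone (T : ℝ) (x : E3) : Set (ℝ × E3) :=
  {q | 0 ≤ q.1 ∧ ‖q.2 - x‖ ≤ T - q.1}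

theorem isCompact_backwardCone (T : ℝ) (x : E3) : IsCompact (backwardCone T x) := by
  refine (isCompact_Icc.prod (isCompact_closedBall x T)).of_isClosed_subset
    (s := Set.Icc 0 T ×ˢ Metric.closedBall x T) ?_ ?_
  · exact (isClosed_le continuous_const continuous_fst).inter
      (isClosed_le (by fun_prop : Continuous fun q : ℝ × E3 => ‖q.2 - x‖)
        (by fun_prop : Continuous fun q : ℝ × E3 => T - q.1))
  · rintro q ⟨h1, h2⟩
    have := norm_nonneg (q.2 - x)
    exact ⟨⟨h1, by linarith⟩, mem_closedBall_iff_norm.2 (by linarith)⟩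

theorem backwardCone_slice_mem {T₀ T : ℝ} {x₀ x y : E3} (h : (T, x) ∈ backwardCone T₀ x₀)
    (hy : ‖y‖ ≤ T) : (T - ‖y‖, x + y) ∈ backwardCone T₀ x₀ := by
  obtain ⟨h1, h2⟩ := h
  refine ⟨by simpa using hy, ?_⟩
  have := norm_add_le (x - x₀) y
  simp only at h2 ⊢
  rw [add_sub_right_comm]
  linarith

theorem exists_absorption {C m η : ℝ} (hC : 0 ≤ C) (hm : 0 < m) (hη : 0 < η) :
    ∃ L : ℝ, 0 < L ∧ C * L ^ (-η) ≤ m / 2 := by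
  refine ⟨(2 * C / m + 1) ^ (1 / η), by positivity, ?_⟩
  rw [← rpow_mul (by positivity), show 1 / η * -η = -1 by field_simp, rpow_neg_one,
    ← div_eq_mul_inv, div_le_iff₀ (by positivity)]
  have : m / 2 * (2 * C / m + 1) = C + m / 2 := by field_simp
  linarith

theorem exists_abs_mul_norm_le {p γ B : ℝ} (hp : 1 < p) (hp5 : p < 5) (hγ1 : 1 < γ)
    (hγ2 : γ < 2) (hγp : γ < p - 1) (hpγ : 4 / (p - 1) - 1 < γ) (hB : 0 < B) :
    ∃ C : ℝ, 0 ≤ C ∧ ∀ φ, IsNLWSolution p φ →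
      wEnergy p 0 γ φ ≤ ENNReal.ofReal B → wEnergy p 1 γ φ < ⊤ →
      ∀ (T : ℝ) (x : E3), 0 ≤ T → T + 2 ≤ ‖x‖ →
        |φ T x| * ‖x‖ ≤ C * ((‖x‖ - T) ^ (-(γ - 1) / 2) * √(wEnergy p 1 γ φ).toReal) := by
  obtain ⟨D, hD, hdata⟩ := exists_lintegral_data_le hp hγ1 hγ2
  obtain ⟨N, ε, η, hN, hε, hη, hnl⟩ := exists_lintegral_nonlinear_le hp hp5 hγ1 hγ2 hγp hpγ hB
  have hm := sphMass_pos
  obtain ⟨L, hL, hLm⟩ := exists_absorption hN hm hη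
  refine ⟨exp L * (2 * D / sphMass), by positivity, fun φ hφ hE0 hE1 T₀ x₀ hT₀ hx₀ => ?_⟩
  set A := √(wEnergy p 1 γ φ).toReal with hA
  have hA0 : 0 ≤ A := sqrt_nonneg _
  have hF : ContDiff ℝ 2 (fun q : ℝ × E3 => φ q.1 q.2) :=
    hφ.1.of_le (WithTop.coe_le_coe.2 (le_top : (2 : ℕ∞) ≤ ⊤))
  have hcone : (T₀, x₀) ∈ backwardCone T₀ x₀ := ⟨hT₀, by simp⟩
  have hcont : ContinuousOn
      (fun q : ℝ × E3 => |φ q.1 q.2| * ‖q.2‖ * exp (L * (2 + q.1) ^ (-ε)))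
      (backwardCone T₀ x₀) := by
    have h1 : Continuous fun q : ℝ × E3 => |φ q.1 q.2| * ‖q.2‖ :=
      hF.continuous.abs.mul (by fun_prop)
    have h2 : ContinuousOn (fun q : ℝ × E3 => (2 + q.1) ^ (-ε)) (backwardCone T₀ x₀) :=
      ContinuousOn.rpow_const (by fun_prop) fun q hq => Or.inl (by have := hq.1; linarith)
    exact h1.continuousOn.mul (h2.const_mul L).rexp
  obtain ⟨⟨T, x⟩, hq, hmax⟩ :=
    (isCompact_backwardCone T₀ x₀).exists_isMaxOn ⟨_, hcone⟩ hcont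
  have hT : 0 ≤ T := hq.1
  have hu : ‖x₀‖ - T₀ ≤ ‖x‖ - T := by
    have h1 : ‖x - x₀‖ ≤ T₀ - T := hq.2
    have h2 := norm_sub_norm_le x₀ x
    rw [norm_sub_rev] at h2
    linarith
  have hx : T + 2 ≤ ‖x‖ := by linarith
  have hx0 : 0 < ‖x‖ := by linarith
  have hbound : ∀ y ∈ Metric.ball (0 : E3) T, |φ (T - ‖y‖) (x + y)| ≤
      (|φ T x| * ‖x‖) * ‖x + y‖⁻¹ * expWeight ε L T ‖y‖ := fun y hy => by
    have hy' : ‖y‖ ≤ T := (mem_ball_zero_iff.1 hy).le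
    have h1 : |φ (T - ‖y‖) (x + y)| * ‖x + y‖ * exp (L * (2 + (T - ‖y‖)) ^ (-ε)) ≤
        |φ T x| * ‖x‖ * exp (L * (2 + T) ^ (-ε)) := hmax (backwardCone_slice_mem hq hy')
    have h2 : 0 < ‖x + y‖ := two_pos.trans_le (norm_add_ge_two hx hy')
    have h3 : expWeight ε L T ‖y‖ =
        exp (L * (2 + T) ^ (-ε)) / exp (L * (2 + (T - ‖y‖)) ^ (-ε)) := by
      rw [expWeight, ← exp_sub]
      ring_nf
    rw [h3, ← div_eq_mul_inv, div_mul_div_comm, le_div_iff₀ (by positivity)]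
    linarith
  have hK := kirchhoff_bound hp hF (solvesNLW_of_isNLWSolution hφ) hT x
  have hsum : sphMass * |φ T x| ≤ D * (‖x‖⁻¹ * (‖x‖ - T) ^ (-(γ - 1) / 2) * A) +
      N * L ^ (-η) * (|φ T x| * ‖x‖) * ‖x‖⁻¹ := by
    have hu0 : 0 ≤ ‖x‖ - T := by linarith
    rw [← ENNReal.ofReal_le_ofReal_iff (by positivity),
      ENNReal.ofReal_add (by positivity) (by positivity)]
    exact hK.trans (add_le_add (hdata φ hφ hE1 T hT x hx)
      (hnl φ hφ hE0 T x L _ hT hx hL (by positivity) hbound))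
  have hu2 : (‖x‖ - T) ^ (-(γ - 1) / 2) ≤ (‖x₀‖ - T₀) ^ (-(γ - 1) / 2) :=
    rpow_le_rpow_of_nonpos (by linarith) hu (by linarith)
  have hmain : |φ T x| * ‖x‖ ≤ 2 * D / sphMass * ((‖x₀‖ - T₀) ^ (-(γ - 1) / 2) * A) := by
    have h1 : sphMass * (|φ T x| * ‖x‖) ≤
        D * ((‖x‖ - T) ^ (-(γ - 1) / 2) * A) + N * L ^ (-η) * (|φ T x| * ‖x‖) := by
      calc sphMass * (|φ T x| * ‖x‖) = sphMass * |φ T x| * ‖x‖ := by ring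
        _ ≤ _ := mul_le_mul_of_nonneg_right hsum hx0.le
        _ = _ := by field_simp
    have h2 : N * L ^ (-η) * (|φ T x| * ‖x‖) ≤ sphMass / 2 * (|φ T x| * ‖x‖) := by gcongr
    have h3 : D * ((‖x‖ - T) ^ (-(γ - 1) / 2) * A) ≤
        D * ((‖x₀‖ - T₀) ^ (-(γ - 1) / 2) * A) := by gcongr
    rw [div_mul_eq_mul_div, le_div_iff₀ hm]
    linarith
  have hT1 : (2 + T) ^ (-ε) ≤ 1 := rpow_le_one_of_one_le_of_nonpos (by linarith) (by linarith)
  calc |φ T₀ x₀| * ‖x₀‖ ≤ |φ T₀ x₀| * ‖x₀‖ * exp (L * (2 + T₀) ^ (-ε)) := by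
        refine le_mul_of_one_le_right (by positivity) (one_le_exp ?_)
        positivity
    _ ≤ |φ T x| * ‖x‖ * exp (L * (2 + T) ^ (-ε)) := hmax hcone
    _ ≤ 2 * D / sphMass * ((‖x₀‖ - T₀) ^ (-(γ - 1) / 2) * A) * exp L := by
        gcongr
        · exact mul_nonneg (by positivity) (mul_nonneg (rpow_nonneg (by linarith) _) hA0)
        · exact mul_le_of_le_one_right hL.le hT1
    _ = _ := by ring

end NLW

open NLW

/-- Pointwise decay in the exterior region `{t₀ ≥ 0, |x₀| ≥ t₀ + 2}`
for `(1+√17)/2 < p < 5` and `max{4/(p−1) − 1, 1} < γ₀ < min{p−1, 2}`. -/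
theorem nlw_exterior_decay_large_p (p γ₀ B : ℝ)
    (hp : (1 + Real.sqrt 17) / 2 < p) (hp5 : p < 5)
    (hγ₁ : max (4 / (p - 1) - 1) 1 < γ₀) (hγ₂ : γ₀ < min (p - 1) 2) (hB : 0 < B) :
    ∃ C : ℝ, 0 < C ∧ ∀ φ : ℝ → E3 → ℝ, IsNLWSolution p φ →
      wEnergy p 0 γ₀ φ ≤ ENNReal.ofReal B → wEnergy p 1 γ₀ φ < ⊤ →
      ∀ t₀ : ℝ, 0 ≤ t₀ → ∀ x₀ : E3, t₀ + 2 ≤ ‖x₀‖ →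
        |φ t₀ x₀| ≤ C * (1 + t₀ + ‖x₀‖) ^ (-(1 : ℝ))
          * (1 + ‖x₀‖ - t₀) ^ (-(γ₀ - 1) / 2)
          * Real.sqrt (wEnergy p 1 γ₀ φ).toReal := by
  obtain ⟨hpγ, hγ1⟩ := max_lt_iff.1 hγ₁
  obtain ⟨hγp, hγ2⟩ := lt_min_iff.1 hγ₂
  obtain ⟨C, hC, h⟩ := exists_abs_mul_norm_le (by linarith) hp5 hγ1 hγ2 hγp hpγ hB
  refine ⟨2 * 2 ^ ((γ₀ - 1) / 2) * C + 1, by positivity, fun φ hφ hE0 hE1 T hT x hx => ?_⟩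
  have hx0 : 0 < ‖x‖ := by linarith
  have hu : 0 < ‖x‖ - T := by linarith
  have hu1 : 0 < 1 + ‖x‖ - T := by linarith
  have h1 := h φ hφ hE0 hE1 T x hT hx
  set A := √(wEnergy p 1 γ₀ φ).toReal with hA
  have hA0 : 0 ≤ A := sqrt_nonneg _
  have h2 : ‖x‖⁻¹ ≤ 2 * (1 + T + ‖x‖) ^ (-(1 : ℝ)) := by
    rw [rpow_neg_one, ← div_eq_mul_inv, inv_eq_one_div, div_le_div_iff₀ hx0 (by linarith)]
    linarith
  have h3 : (‖x‖ - T) ^ (-(γ₀ - 1) / 2) ≤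
      2 ^ ((γ₀ - 1) / 2) * (1 + ‖x‖ - T) ^ (-(γ₀ - 1) / 2) := by
    calc (‖x‖ - T) ^ (-(γ₀ - 1) / 2) ≤ ((1 + ‖x‖ - T) / 2) ^ (-(γ₀ - 1) / 2) :=
          rpow_le_rpow_of_nonpos (by linarith) (by linarith) (by linarith)
      _ = _ := by
          rw [div_rpow hu1.le two_pos.le, neg_div, rpow_neg two_pos.le]
          field_simp
  calc |φ T x| = |φ T x| * ‖x‖ * ‖x‖⁻¹ := by field_simp
    _ ≤ C * ((2 ^ ((γ₀ - 1) / 2) * (1 + ‖x‖ - T) ^ (-(γ₀ - 1) / 2)) * A) *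
          (2 * (1 + T + ‖x‖) ^ (-(1 : ℝ))) := by
        have : 0 ≤ (2 : ℝ) ^ ((γ₀ - 1) / 2) * (1 + ‖x‖ - T) ^ (-(γ₀ - 1) / 2) := by positivity
        refine mul_le_mul (h1.trans ?_) h2 (by positivity) (by positivity)
        gcongr
    _ = 2 * 2 ^ ((γ₀ - 1) / 2) * C * (1 + T + ‖x‖) ^ (-(1 : ℝ)) *
          (1 + ‖x‖ - T) ^ (-(γ₀ - 1) / 2) * A := by ring
    _ ≤ _ := by
        gcongr
        linarith
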